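/- Let Ω be a domain in ℂⁿ and let u be a plurisubharmonic function of class C^{1,1} on Ω (so that its second-order partial derivatives exist almost everywhere and the complex Hessian matrix (u_{i j̄}) is positive semidefinite almost everywhere). Suppose that det(u_{i j̄}) = f almost everywhere in Ω, where f ≥ λ > 0 in Ω for some constant λ and f is α-Hölder continuous on Ω for some α ∈ (0,1). Then u is of class C^{2,α} on Ω, i.e. u is twice continuously differentiable in Ω and all its second-order partial derivatives are locally α-Hölder continuous. -/

import Mathlib

open MeasureTheory Metric Set
open scoped ComplexOrder

noncomputable section

/-- `ℂⁿ` with its Euclidean (Hermitian) structure. -/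
abbrev Cn (n : ℕ) := EuclideanSpace ℂ (Fin n)

instance {n : ℕ} : MeasurableSpace (Cn n) := borel _
instance {n : ℕ} : BorelSpace (Cn n) := ⟨rfl⟩
/-- Lebesgue (Haar) measure on `ℂⁿ`. -/
instance {n : ℕ} : MeasureSpace (Cn n) := ⟨Measure.addHaar⟩

/-- Second derivative of `u` at `z` in the (real) directions `v, w`. -/
def D2 {n : ℕ} (u : Cn n → ℝ) (z v w : Cn n) : ℝ := fderiv ℝ (fderiv ℝ u) z v w

/-- The complex Hessian matrix `(u_{i j̄})` of a real valued function on `ℂⁿ`: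
`u_{i j̄} = (1/4)(u_{x_i x_j} + u_{y_i y_j}) + (i/4)(u_{x_i y_j} - u_{y_i x_j})`. -/
def complexHessian {n : ℕ} (u : Cn n → ℝ) (z : Cn n) : Matrix (Fin n) (Fin n) ℂ := fun i j =>
  (1/4 : ℂ) * ( ((D2 u z (EuclideanSpace.single i 1) (EuclideanSpace.single j 1)
      + D2 u z (EuclideanSpace.single i Complex.I) (EuclideanSpace.single j Complex.I) : ℝ) : ℂ)
    + Complex.I * ((D2 u z (EuclideanSpace.single i 1) (EuclideanSpace.single j Complex.I)
      - D2 u z (EuclideanSpace.single i Complex.I) (EuclideanSpace.single j 1) : ℝ) : ℂ) )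

/-- `u` is of class `C^{1,1}` on the open set `Ω`: continuously differentiable with
locally Lipschitz gradient. -/
def C11On {n : ℕ} (u : Cn n → ℝ) (Ω : Set (Cn n)) : Prop :=
  ContDiffOn ℝ 1 u Ω ∧
    ∀ z ∈ Ω, ∃ ε > 0, ∃ K : NNReal, ball z ε ⊆ Ω ∧ LipschitzOnWith K (fderiv ℝ u) (ball z ε)

/-- The second order derivatives of `u` exist almost everywhere in `Ω`
(automatic for `C^{1,1}` functions, by Rademacher's theorem). -/
def AESecondDiff {n : ℕ} (u : Cn n → ℝ) (Ω : Set (Cn n)) : Prop :=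
  ∀ᵐ z, z ∈ Ω → DifferentiableAt ℝ (fderiv ℝ u) z

/-- A `C^{1,1}` function is plurisubharmonic iff its complex Hessian is positive
semidefinite almost everywhere. -/
def PshAE {n : ℕ} (u : Cn n → ℝ) (Ω : Set (Cn n)) : Prop :=
  ∀ᵐ z, z ∈ Ω → (complexHessian u z).PosSemidef

namespace EvansKrylov

set_option linter.unusedSectionVars false
set_option maxSynthPendingDepth 3

open Filter Topology
open scoped NNReal ENNReal

/-- Bilinear forms on `E`. -/
abbrev Bil (E : Type*) [NormedAddCommGroup E] [InnerProductSpace ℝ E] := E →L[ℝ] E →L[ℝ] ℝ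

section Basic

variable {E : Type*} [NormedAddCommGroup E] [InnerProductSpace ℝ E]

/-- The second derivative of `u` at `x`, as a bilinear form. -/
def hess (u : E → ℝ) (x : E) : Bil E := fderiv ℝ (fderiv ℝ u) x

/-- Symmetric bilinear forms. -/
def Symm (B : Bil E) : Prop := ∀ x y, B x y = B y x

/-- Positive semidefiniteness of a bilinear form. -/
def NonNeg (B : Bil E) : Prop := ∀ x, 0 ≤ B x x

/-- `u` is differentiable with `K`-Lipschitz derivative on `s`. -/
structure C11 (u : E → ℝ) (K : ℝ≥0) (s : Set E) : Prop where
  diff : ∀ x ∈ s, DifferentiableAt ℝ u x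
  lip : LipschitzOnWith K (fderiv ℝ u) s

theorem C11.mono {u : E → ℝ} {K : ℝ≥0} {s t : Set E} (h : C11 u K s) (hts : t ⊆ s) :
    C11 u K t :=
  ⟨fun x hx => h.diff x (hts hx), h.lip.mono hts⟩

theorem C11.norm_sub_le {u : E → ℝ} {K : ℝ≥0} {s : Set E} (h : C11 u K s) {x y : E}
    (hx : x ∈ s) (hy : y ∈ s) : ‖fderiv ℝ u x - fderiv ℝ u y‖ ≤ K * ‖x - y‖ := by
  simpa [dist_eq_norm] using h.lip.dist_le_mul x hx y hy

theorem C11.continuousOn {u : E → ℝ} {K : ℝ≥0} {s : Set E} (h : C11 u K s) :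
    ContinuousOn u s := fun x hx => (h.diff x hx).continuousAt.continuousWithinAt

theorem C11.norm_hess_le {u : E → ℝ} {K : ℝ≥0} {s : Set E} (h : C11 u K s) {x : E}
    (hx : s ∈ 𝓝 x) : ‖hess u x‖ ≤ K :=
  norm_fderiv_le_of_lipschitzOn ℝ hx h.lip

theorem C11.symm_hess {u : E → ℝ} {K : ℝ≥0} {s : Set E} (h : C11 u K s) {x : E}
    (hx : s ∈ 𝓝 x) (hd : DifferentiableAt ℝ (fderiv ℝ u) x) : Symm (hess u x) := fun v w =>
  second_derivative_symmetric_of_eventually (𝕜 := ℝ)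
    (by filter_upwards [hx] with y hy using (h.diff y hy).hasFDerivAt) hd.hasFDerivAt v w

theorem hess_nonneg_of_isLocalMin {w : E → ℝ} {x : E} (hw : ∀ᶠ y in 𝓝 x, DifferentiableAt ℝ w y)
    (hd : DifferentiableAt ℝ (fderiv ℝ w) x) (hm : IsLocalMin w x) : NonNeg (hess w x) := by
  intro e
  by_contra! hneg
  set g : ℝ → ℝ := fun t => w (x + t • e) with hg
  have hline : ∀ t : ℝ, HasDerivAt (fun t : ℝ => x + t • e) e t := fun t => by
    simpa using ((hasDerivAt_id t).smul_const e).const_add x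
  have hcont : Tendsto (fun t : ℝ => x + t • e) (𝓝 0) (𝓝 x) := by
    have := (hline 0).continuousAt.tendsto
    simpa using this
  have hg' : ∀ᶠ t in 𝓝 (0 : ℝ), HasDerivAt g (fderiv ℝ w (x + t • e) e) t := by
    filter_upwards [hcont.eventually hw] with t ht
    exact ht.hasFDerivAt.comp_hasDerivAt t (hline t)
  have hgd : deriv g =ᶠ[𝓝 0] fun t => fderiv ℝ w (x + t • e) e := by
    filter_upwards [hg'] with t ht using ht.deriv
  have h2 : HasDerivAt (fun t : ℝ => fderiv ℝ w (x + t • e) e) (hess w x e e) 0 := by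
    have h1 : HasFDerivAt (fderiv ℝ w) (hess w x) (x + (0 : ℝ) • e) := by
      simpa [hess] using hd.hasFDerivAt
    have := h1.comp_hasDerivAt (0 : ℝ) (hline 0)
    exact (this.clm_apply (hasDerivAt_const (0 : ℝ) e)).congr_deriv (by simp)
  have hdd : deriv (deriv g) 0 = hess w x e e := by
    rw [hgd.deriv_eq]; exact h2.deriv
  have hgmin : IsLocalMin g 0 := by
    have : ∀ᶠ t in 𝓝 (0 : ℝ), w x ≤ w (x + t • e) := hcont.eventually hm
    filter_upwards [this] with t ht
    simpa [hg] using ht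
  have hd0 : deriv g 0 = 0 := hgmin.deriv_eq_zero
  have hgmax := isLocalMax_of_deriv_deriv_neg (f := g) (by rw [hdd]; exact hneg) hd0
    (hg'.self_of_nhds).continuousAt
  have hconst : g =ᶠ[𝓝 0] fun _ => g 0 := by
    filter_upwards [hgmin, hgmax] with t h1 h2 using le_antisymm h2 h1
  have h3 : deriv g =ᶠ[𝓝 0] fun _ => 0 := by
    filter_upwards [hconst.eventuallyEq_nhds] with t ht
    rw [ht.deriv_eq]; simp
  rw [h3.deriv_eq] at hdd
  simp at hdd
  linarith

theorem hess_sub {u v : E → ℝ} {x : E} (hu : ∀ᶠ y in 𝓝 x, DifferentiableAt ℝ u y)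
    (hv : ∀ᶠ y in 𝓝 x, DifferentiableAt ℝ v y) (hu2 : DifferentiableAt ℝ (fderiv ℝ u) x)
    (hv2 : DifferentiableAt ℝ (fderiv ℝ v) x) :
    hess (fun y => u y - v y) x = hess u x - hess v x ∧
      DifferentiableAt ℝ (fderiv ℝ fun y => u y - v y) x := by
  have h : (fderiv ℝ fun y => u y - v y) =ᶠ[𝓝 x] fun y => fderiv ℝ u y - fderiv ℝ v y := by
    filter_upwards [hu, hv] with y h1 h2 using fderiv_fun_sub h1 h2
  refine ⟨?_, (hu2.sub hv2).congr_of_eventuallyEq h⟩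
  rw [hess, h.fderiv_eq]
  exact fderiv_fun_sub hu2 hv2

theorem hess_add {u v : E → ℝ} {x : E} (hu : ∀ᶠ y in 𝓝 x, DifferentiableAt ℝ u y)
    (hv : ∀ᶠ y in 𝓝 x, DifferentiableAt ℝ v y) (hu2 : DifferentiableAt ℝ (fderiv ℝ u) x)
    (hv2 : DifferentiableAt ℝ (fderiv ℝ v) x) :
    hess (fun y => u y + v y) x = hess u x + hess v x ∧
      DifferentiableAt ℝ (fderiv ℝ fun y => u y + v y) x := by
  have h : (fderiv ℝ fun y => u y + v y) =ᶠ[𝓝 x] fun y => fderiv ℝ u y + fderiv ℝ v y := by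
    filter_upwards [hu, hv] with y h1 h2 using fderiv_fun_add h1 h2
  refine ⟨?_, (hu2.add hv2).congr_of_eventuallyEq h⟩
  rw [hess, h.fderiv_eq]
  exact fderiv_fun_add hu2 hv2

theorem hess_const_mul {u : E → ℝ} {x : E} (hu : ∀ᶠ y in 𝓝 x, DifferentiableAt ℝ u y)
    (hu2 : DifferentiableAt ℝ (fderiv ℝ u) x) (c : ℝ) :
    hess (fun y => c * u y) x = c • hess u x ∧
      DifferentiableAt ℝ (fderiv ℝ fun y => c * u y) x := by
  have h : (fderiv ℝ fun y => c * u y) =ᶠ[𝓝 x] fun y => c • fderiv ℝ u y := by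
    filter_upwards [hu] with y h1 using fderiv_const_mul h1 c
  refine ⟨?_, (hu2.const_smul c).congr_of_eventuallyEq h⟩
  rw [hess, h.fderiv_eq]
  exact fderiv_fun_const_smul hu2 c

end Basic

section ABP

variable {E : Type*} [NormedAddCommGroup E] [InnerProductSpace ℝ E] [FiniteDimensional ℝ E]

/-- The linear map sending a continuous functional to the vector representing it. -/
def rieszCLM : (E →L[ℝ] ℝ) →L[ℝ] E :=
  ∑ i, (ContinuousLinearMap.apply ℝ ℝ (stdOrthonormalBasis ℝ E i)).smulRight
    (stdOrthonormalBasis ℝ E i)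

theorem rieszCLM_innerSL (p : E) : rieszCLM (innerSL ℝ p) = p := by
  simp only [rieszCLM, sum_apply, ContinuousLinearMap.smulRight_apply,
    ContinuousLinearMap.apply_apply, innerSL_apply_apply]
  conv_rhs => rw [← (stdOrthonormalBasis ℝ E).sum_repr' p]
  simp [real_inner_comm]

theorem norm_rieszCLM_apply (φ : E →L[ℝ] ℝ) : ‖rieszCLM φ‖ = ‖φ‖ := by
  obtain ⟨p, rfl⟩ := (InnerProductSpace.toDual ℝ E).surjective φ
  have : (InnerProductSpace.toDual ℝ E p : E →L[ℝ] ℝ) = innerSL ℝ p := by ext; simp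
  rw [LinearIsometryEquiv.norm_map, this, rieszCLM_innerSL]

variable [MeasurableSpace E] [BorelSpace E] (μ : Measure E) [μ.IsAddHaarMeasure]

theorem abs_det_le_norm_pow (L : E →L[ℝ] E) : |L.det| ≤ ‖L‖ ^ Module.finrank ℝ E := by
  have h1 := Measure.addHaar_image_continuousLinearMap (Measure.addHaar (G := E)) L (closedBall 0 1)
  have h2 : L '' closedBall 0 1 ⊆ closedBall 0 ‖L‖ := by
    rintro _ ⟨x, hx, rfl⟩
    simp only [mem_closedBall, dist_zero_right] at hx ⊢
    calc ‖L x‖ ≤ ‖L‖ * ‖x‖ := L.le_opNorm x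
      _ ≤ ‖L‖ * 1 := by gcongr
      _ = _ := mul_one _
  have h3 := measure_mono (μ := Measure.addHaar (G := E)) h2
  rw [h1, Measure.addHaar_closedBall _ _ (norm_nonneg _),
    Measure.addHaar_closedBall _ _ zero_le_one] at h3
  simp only [one_pow, ENNReal.ofReal_one, one_mul] at h3
  have h4 := (ENNReal.mul_le_mul_iff_left (measure_ball_pos _ _ one_pos).ne'
    measure_ball_lt_top.ne).1 h3
  exact (ENNReal.ofReal_le_ofReal_iff (by positivity)).1 h4

theorem LipschitzOnWith.image_null {G : E → E} {K : ℝ≥0} {s : Set E} (hG : LipschitzOnWith K G s)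
    (hs : μ s = 0) : μ (G '' s) = 0 := by
  have hac : Measure.hausdorffMeasure (Module.finrank ℝ E) ≪ μ :=
    Measure.absolutelyContinuous_isAddHaarMeasure _ _
  have hac' : μ ≪ Measure.hausdorffMeasure (Module.finrank ℝ E) :=
    Measure.absolutelyContinuous_isAddHaarMeasure _ _
  apply hac'
  have := hG.hausdorffMeasure_image_le (d := Module.finrank ℝ E) (by positivity)
  rw [hac hs, mul_zero] at this
  exact le_antisymm this zero_le

/-- If `w` dips by `m` below its values on the sphere of radius `R`, every small slope is attained
at an interior contact point. -/
theorem exists_contact {w : E → ℝ} {a m R : ℝ} (hR : 0 < R)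
    (hd : ∀ x ∈ ball (0 : E) R, DifferentiableAt ℝ w x) (hc : ContinuousOn w (closedBall 0 R))
    (hs : ∀ x, ‖x‖ = R → a ≤ w x) {x0 : E} (hx0 : ‖x0‖ < R) (hwx : w x0 ≤ a - m) {p : E}
    (hp : ‖p‖ < m / (2 * R)) :
    ∃ x ∈ ball (0 : E) R, w x ≤ a ∧ fderiv ℝ w x = innerSL ℝ p ∧
      IsLocalMin (fun y => w y - inner ℝ p y) x := by
  have hp' : ‖p‖ * (2 * R) < m := by rwa [lt_div_iff₀ (by positivity)] at hp
  have hin : ∀ y : E, ‖y‖ ≤ R → |inner ℝ p y| ≤ ‖p‖ * R := fun y hy =>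
    (abs_real_inner_le_norm p y).trans (by gcongr)
  obtain ⟨x, hx, hmin⟩ := (isCompact_closedBall (0 : E) R).exists_isMinOn
    ⟨0, by simp [hR.le]⟩ (hc.sub (by fun_prop : ContinuousOn (fun y => inner ℝ p y) _))
  have hxR : ‖x‖ ≤ R := by simpa using hx
  have h0 : w x - inner ℝ p x ≤ w x0 - inner ℝ p x0 := hmin (by simpa using hx0.le)
  have h1 := abs_le.1 (hin x hxR)
  have h2 := abs_le.1 (hin x0 hx0.le)
  have hlt : ‖x‖ < R := by
    refine lt_of_le_of_ne hxR fun h => ?_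
    have := hs x h
    linarith [h1.1, h1.2, h2.1, h2.2]
  have hxb : x ∈ ball (0 : E) R := by simpa using hlt
  have hloc : IsLocalMin (fun y => w y - inner ℝ p y) x :=
    hmin.isLocalMin (mem_of_superset (isOpen_ball.mem_nhds hxb) ball_subset_closedBall)
  refine ⟨x, hxb, by linarith [h1.1, h1.2, h2.1, h2.2], ?_, hloc⟩
  have h3 : HasFDerivAt (fun y => w y - inner ℝ p y) (fderiv ℝ w x - innerSL ℝ p) x :=
    (hd x hxb).hasFDerivAt.sub (innerSL ℝ p).hasFDerivAt
  have := hloc.hasFDerivAt_eq_zero h3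
  exact sub_eq_zero.1 this

/-- The Aleksandrov–Bakelman–Pucci estimate for functions with Lipschitz derivative. -/
theorem abp {w : E → ℝ} {a m R Λ : ℝ} {K : ℝ≥0} (hR : 0 < R) (hΛ : 0 ≤ Λ)
    (hw : C11 w K (ball 0 R)) (hc : ContinuousOn w (closedBall 0 R))
    (hs : ∀ x, ‖x‖ = R → a ≤ w x) {x0 : E} (hx0 : ‖x0‖ < R) (hwx : w x0 ≤ a - m)
    {A : Set E} (hA : MeasurableSet A)
    (hgood : ∀ᵐ x ∂μ, x ∈ ball 0 R → DifferentiableAt ℝ (fderiv ℝ w) x ∧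
      (NonNeg (hess w x) → w x ≤ a → x ∈ A ∧ ‖hess w x‖ ≤ Λ)) :
    μ (ball 0 (m / (2 * R))) ≤ ENNReal.ofReal (Λ ^ Module.finrank ℝ E) * μ A := by
  set G : E → E := fun x => rieszCLM (fderiv ℝ w x) with hG
  set N : Set E := {x | ¬ (x ∈ ball 0 R → DifferentiableAt ℝ (fderiv ℝ w) x ∧
      (NonNeg (hess w x) → w x ≤ a → x ∈ A ∧ ‖hess w x‖ ≤ Λ))} with hN
  have hN0 : μ N = 0 := hgood
  set s : Set E := A ∩ ({x | DifferentiableAt ℝ (fderiv ℝ w) x} ∩ {x | ‖hess w x‖ ≤ Λ}) with hs'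
  have hsm : MeasurableSet s :=
    hA.inter ((measurableSet_of_differentiableAt ℝ _).inter
      (measurableSet_le (measurable_fderiv ℝ _).norm measurable_const))
  have hder : ∀ x ∈ s, HasFDerivWithinAt G (rieszCLM.comp (hess w x)) s x := fun x hx =>
    (rieszCLM.hasFDerivAt.comp x (DifferentiableAt.hasFDerivAt hx.2.1)).hasFDerivWithinAt
  have hGl : LipschitzOnWith (‖(rieszCLM : (E →L[ℝ] ℝ) →L[ℝ] E)‖₊ * K) G (ball 0 R) :=
    rieszCLM.lipschitz.comp_lipschitzOnWith hw.lip
  have hsub : ball 0 (m / (2 * R)) ⊆ G '' s ∪ G '' (N ∩ ball 0 R) := by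
    intro p hp
    obtain ⟨x, hxb, hxa, hfx, hloc⟩ := exists_contact hR hw.diff hc hs hx0 hwx
      (p := p) (by simpa using hp)
    have hGx : G x = p := by simp only [hG, hfx, rieszCLM_innerSL]
    by_cases hxN : x ∈ N
    · exact Or.inr ⟨x, ⟨hxN, hxb⟩, hGx⟩
    · have hx : x ∈ ball 0 R → DifferentiableAt ℝ (fderiv ℝ w) x ∧
        (NonNeg (hess w x) → w x ≤ a → x ∈ A ∧ ‖hess w x‖ ≤ Λ) := by simpa [hN] using hxN
      obtain ⟨hdx, hx2⟩ := hx hxb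
      have hlin : (fun y : E => inner ℝ p y) = innerSL ℝ p := by ext; simp
      have hl1 : fderiv ℝ (fun y : E => inner ℝ p y) = fun _ => innerSL ℝ p := by
        rw [hlin]; ext1 y; exact ContinuousLinearMap.fderiv _
      have hwd : ∀ᶠ y in 𝓝 x, DifferentiableAt ℝ w y := by
        filter_upwards [isOpen_ball.mem_nhds hxb] with y hy using hw.diff y hy
      have hld : ∀ᶠ y in 𝓝 x, DifferentiableAt ℝ (fun y : E => inner ℝ p y) y :=
        Eventually.of_forall fun y => by rw [hlin]; exact (innerSL ℝ p).differentiableAt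
      obtain ⟨e1, e2⟩ := hess_sub hwd hld hdx (by rw [hl1]; exact differentiableAt_const _)
      have : NonNeg (hess (fun y => w y - inner ℝ p y) x) :=
        hess_nonneg_of_isLocalMin (hwd.and hld |>.mono fun y hy => hy.1.sub hy.2) e2 hloc
      rw [e1] at this
      have e3 : hess (fun y : E => inner ℝ p y) x = 0 := by
        rw [hess, hl1]; simp
      rw [e3] at this
      replace this : NonNeg (hess w x) := fun y => by simpa using this y
      obtain ⟨h4, h5⟩ := hx2 this hxa
      exact Or.inl ⟨x, ⟨h4, hdx, h5⟩, hGx⟩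
  calc μ (ball 0 (m / (2 * R))) ≤ μ (G '' s) + μ (G '' (N ∩ ball 0 R)) :=
        (measure_mono hsub).trans (measure_union_le _ _)
    _ = μ (G '' s) := by
        rw [LipschitzOnWith.image_null μ (hGl.mono inter_subset_right)
          (measure_mono_null inter_subset_left hN0), add_zero]
    _ ≤ ∫⁻ x in s, ENNReal.ofReal |(rieszCLM.comp (hess w x)).det| ∂μ :=
        addHaar_image_le_lintegral_abs_det_fderiv μ hsm hder
    _ ≤ ∫⁻ _ in s, ENNReal.ofReal (Λ ^ Module.finrank ℝ E) ∂μ := by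
        refine setLIntegral_mono measurable_const fun x hx => ENNReal.ofReal_le_ofReal ?_
        refine (abs_det_le_norm_pow _).trans ?_
        have : ‖rieszCLM.comp (hess w x)‖ ≤ Λ :=
          ContinuousLinearMap.opNorm_le_bound _ hΛ fun y => by
            rw [ContinuousLinearMap.comp_apply, norm_rieszCLM_apply]
            exact ((hess w x).le_opNorm y).trans (by gcongr; exact hx.2.2)
        gcongr
    _ = ENNReal.ofReal (Λ ^ Module.finrank ℝ E) * μ s := by rw [setLIntegral_const]
    _ ≤ _ := by gcongr; exact inter_subset_left

/-- A function which dips below its values on a sphere has an interior contact point in any set of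
full measure. -/
theorem exists_good_contact {w : E → ℝ} {a R : ℝ} {K : ℝ≥0} (hR : 0 < R)
    (hw : C11 w K (ball 0 R)) (hc : ContinuousOn w (closedBall 0 R))
    (hs : ∀ x, ‖x‖ = R → a ≤ w x) {x0 : E} (hx0 : ‖x0‖ < R) (hwx : w x0 < a)
    {p : E → Prop} (hp : ∀ᵐ x ∂μ, x ∈ ball 0 R → p x)
    (hd : ∀ᵐ x ∂μ, x ∈ ball 0 R → DifferentiableAt ℝ (fderiv ℝ w) x) :
    ∃ x ∈ ball (0 : E) R, p x ∧ DifferentiableAt ℝ (fderiv ℝ w) x ∧ NonNeg (hess w x) := by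
  by_contra! hcon
  have := abp (m := a - w x0) μ hR le_rfl hw hc hs hx0 (by linarith) MeasurableSet.empty (by
    filter_upwards [hp, hd] with x h1 h2 hx
    exact ⟨h2 hx, fun h3 _ => absurd h3 (hcon x hx (h1 hx) (h2 hx))⟩)
  rw [measure_empty, mul_zero] at this
  have hpos := measure_ball_pos μ (0 : E) (r := (a - w x0) / (2 * R))
    (div_pos (by linarith) (by positivity))
  exact absurd this (not_le.2 hpos)

end ABP

section Affine

variable {E : Type*} [NormedAddCommGroup E] [InnerProductSpace ℝ E]

theorem fderiv_comp_affine (v : E → ℝ) (t r : ℝ) (z x : E) :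
    fderiv ℝ (fun y => t * v (z + r • y)) x = (t * r) • fderiv ℝ v (z + r • x) := by
  have h1 : fderiv ℝ (fun y => t • v (z + r • y)) x
      = t • fderiv ℝ (fun y => v (z + r • y)) x := by
    exact congrFun (fderiv_const_smul_field (𝕜 := ℝ) (f := fun y => v (z + r • y)) t) x
  have h2 : fderiv ℝ (fun y => v (z + r • y)) x = r • fderiv ℝ v (z + r • x) := by
    have := fderiv_comp_smul (𝕜 := ℝ) (f := fun y => v (z + y)) (x := x) r
    rw [this, fderiv_comp_add_left]
  simp only [smul_eq_mul] at h1
  rw [h1, h2, smul_smul]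

theorem fderiv_comp_affine' {F : Type*} [NormedAddCommGroup F] [NormedSpace ℝ F]
    (v : E → F) (t r : ℝ) (z x : E) :
    fderiv ℝ (fun y => t • v (z + r • y)) x = (t * r) • fderiv ℝ v (z + r • x) := by
  have h1 : fderiv ℝ (fun y => t • v (z + r • y)) x
      = t • fderiv ℝ (fun y => v (z + r • y)) x :=
    congrFun (fderiv_const_smul_field (𝕜 := ℝ) (f := fun y => v (z + r • y)) t) x
  have h2 : fderiv ℝ (fun y => v (z + r • y)) x = r • fderiv ℝ v (z + r • x) := by
    have := fderiv_comp_smul (𝕜 := ℝ) (f := fun y => v (z + y)) (x := x) r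
    rw [this, fderiv_comp_add_left]
  rw [h1, h2, smul_smul]

theorem hess_comp_affine (v : E → ℝ) (t r : ℝ) (z x : E) :
    hess (fun y => t * v (z + r • y)) x = (t * r ^ 2) • hess v (z + r • x) := by
  have : fderiv ℝ (fun y => t * v (z + r • y)) = fun y => (t * r) • fderiv ℝ v (z + r • y) :=
    funext fun y => fderiv_comp_affine v t r z y
  rw [hess, this, fderiv_comp_affine', hess]
  ring_nf

theorem differentiableAt_comp_affine {F : Type*} [NormedAddCommGroup F] [NormedSpace ℝ F]
    {v : E → F} {r : ℝ} {z x : E} (h : DifferentiableAt ℝ v (z + r • x)) :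
    DifferentiableAt ℝ (fun y => v (z + r • y)) x :=
  h.comp (f := fun y => z + r • y) x (by fun_prop)

theorem differentiableAt_fderiv_comp_affine {v : E → ℝ} {t r : ℝ} {z x : E}
    (h : DifferentiableAt ℝ (fderiv ℝ v) (z + r • x)) :
    DifferentiableAt ℝ (fderiv ℝ fun y => t * v (z + r • y)) x := by
  have : fderiv ℝ (fun y => t * v (z + r • y)) = fun y => (t * r) • fderiv ℝ v (z + r • y) :=
    funext fun y => fderiv_comp_affine v t r z y
  rw [this]
  exact (differentiableAt_comp_affine h).const_smul (t * r)

theorem C11.comp_affine {v : E → ℝ} {K : ℝ≥0} {s : Set E} (h : C11 v K s) (t r : ℝ) (z : E) :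
    C11 (fun y => t * v (z + r • y)) (‖t * r ^ 2‖₊ * K) ((fun y => z + r • y) ⁻¹' s) := by
  refine ⟨fun x hx => (differentiableAt_comp_affine (h.diff _ hx)).const_mul _, ?_⟩
  refine LipschitzOnWith.of_dist_le_mul fun x hx y hy => ?_
  rw [dist_eq_norm, fderiv_comp_affine, fderiv_comp_affine, ← smul_sub, norm_smul, dist_eq_norm]
  have := h.norm_sub_le hx hy
  rw [add_sub_add_left_eq_sub, ← smul_sub, norm_smul] at this
  push_cast
  calc ‖t * r‖ * _ ≤ ‖t * r‖ * (K * (‖r‖ * ‖x - y‖)) := by gcongr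
    _ = _ := by simp only [norm_mul, norm_pow]; ring

variable [MeasurableSpace E] [BorelSpace E] [FiniteDimensional ℝ E] (μ : Measure E)
  [μ.IsAddHaarMeasure]

theorem ae_comp_affine {p : E → Prop} (h : ∀ᵐ x ∂μ, p x) {r : ℝ} (hr : r ≠ 0) (z : E) :
    ∀ᵐ x ∂μ, p (z + r • x) := by
  have h1 := (Measure.quasiMeasurePreserving_smul μ hr)
  have h2 : ∀ᵐ x ∂μ, p (z + x) := (quasiMeasurePreserving_add_left μ z).ae h
  exact h1.ae h2

theorem measure_preimage_affine {r : ℝ} (hr : 0 < r) (z : E) (s : Set E) :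
    μ ((fun y => z + r • y) ⁻¹' s) = ENNReal.ofReal ((r ^ Module.finrank ℝ E)⁻¹) * μ s := by
  have := Measure.addHaar_preimage_smul μ hr.ne' ((fun y => z + y) ⁻¹' s)
  rw [measure_preimage_add, abs_of_pos (by positivity)] at this
  exact this

theorem preimage_affine_closedBall {r : ℝ} (hr : 0 < r) (z : E) (ρ : ℝ) :
    (fun y => z + r • y) ⁻¹' closedBall z (r * ρ) = closedBall 0 ρ := by
  ext y
  simp [dist_eq_norm, norm_smul, abs_of_pos hr, hr]

end Affine

section WeakHarnack

variable {E : Type*} [NormedAddCommGroup E] [InnerProductSpace ℝ E]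

/-- Linear functionals of bilinear forms which are uniformly elliptic with constants `c`, `C`. -/
def Ell (c C : ℝ) : Set (Bil E →L[ℝ] ℝ) :=
  {ℓ | ∀ B, Symm B → NonNeg B → c * ‖B‖ ≤ ℓ B ∧ ℓ B ≤ C * ‖B‖}

variable (E) in
/-- The inner product as a bilinear form. -/
def idForm : Bil E := innerSL ℝ

@[simp] theorem idForm_apply (x y : E) : idForm E x y = inner ℝ x y := rfl

theorem symm_idForm : Symm (idForm E) := fun x y => real_inner_comm y x

theorem nonNeg_idForm : NonNeg (idForm E) := fun _ => real_inner_self_nonneg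

theorem norm_idForm_le : ‖idForm E‖ ≤ 1 :=
  ContinuousLinearMap.opNorm_le_bound _ zero_le_one fun x => by
    rw [one_mul]; exact (innerSL_apply_norm ℝ x).le

/-- The rank one form `x ⊗ x`. -/
def tensorSq (x : E) : Bil E := (innerSL ℝ x).smulRight (innerSL ℝ x)

@[simp] theorem tensorSq_apply (x y z : E) :
    tensorSq x y z = inner ℝ x y * inner ℝ x z := by simp [tensorSq]

theorem symm_tensorSq (x : E) : Symm (tensorSq x) := fun y z => by simp [mul_comm]

theorem nonNeg_tensorSq (x : E) : NonNeg (tensorSq x) := fun y => by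
  simpa using mul_self_nonneg _

theorem norm_tensorSq (x : E) : ‖tensorSq x‖ = ‖x‖ ^ 2 := by
  rw [tensorSq, ContinuousLinearMap.norm_smulRight_apply]
  simp [sq]

theorem Symm.sub {A B : Bil E} (hA : Symm A) (hB : Symm B) : Symm (A - B) := fun x y => by
  simp [hA x y, hB x y]

theorem Symm.add {A B : Bil E} (hA : Symm A) (hB : Symm B) : Symm (A + B) := fun x y => by
  simp [hA x y, hB x y]

theorem Symm.smul {A : Bil E} (hA : Symm A) (t : ℝ) : Symm (t • A) := fun x y => by
  simp [hA x y]

theorem Ell.mono {c C : ℝ} {ℓ : Bil E →L[ℝ] ℝ} (hc : 0 ≤ c) (hℓ : ℓ ∈ Ell c C) {A B : Bil E}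
    (hA : Symm A) (hB : Symm B) (hAB : ∀ x, A x x ≤ B x x) : ℓ A ≤ ℓ B := by
  have := (hℓ (B - A) (hB.sub hA) fun x => by simpa using hAB x).1
  rw [map_sub] at this
  nlinarith [norm_nonneg (B - A), mul_nonneg hc (norm_nonneg (B - A))]

variable [MeasurableSpace E] (μ : Measure E)

/-- Supersolutions of some uniformly elliptic equation without lower order terms. -/
structure Super (c C : ℝ) (v : E → ℝ) : Prop where
  c11 : ∃ K, C11 v K univ
  ae : ∀ᵐ x ∂μ, DifferentiableAt ℝ (fderiv ℝ v) x ∧ ∃ ℓ ∈ Ell c C, ℓ (hess v x) ≤ 0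

variable {μ} [BorelSpace E] [FiniteDimensional ℝ E] [μ.IsAddHaarMeasure]

theorem Super.comp_affine {c C : ℝ} {v : E → ℝ} (h : Super μ c C v) {t r : ℝ} (ht : 0 ≤ t)
    (hr : r ≠ 0) (z : E) : Super μ c C (fun y => t * v (z + r • y)) := by
  obtain ⟨K, hK⟩ := h.c11
  refine ⟨⟨_, by simpa using hK.comp_affine t r z⟩, ?_⟩
  filter_upwards [ae_comp_affine μ h.ae hr z] with x hx
  obtain ⟨h1, ℓ, hℓ, h2⟩ := hx
  refine ⟨differentiableAt_fderiv_comp_affine h1, ℓ, hℓ, ?_⟩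
  rw [hess_comp_affine, map_smul, smul_eq_mul]
  exact mul_nonpos_of_nonneg_of_nonpos (by positivity) h2

theorem C11.add {u v : E → ℝ} {K L : ℝ≥0} {s : Set E} (hu : C11 u K s) (hv : C11 v L s) :
    C11 (fun y => u y + v y) (K + L) s := by
  refine ⟨fun x hx => (hu.diff x hx).add (hv.diff x hx), ?_⟩
  refine LipschitzOnWith.of_dist_le_mul fun x hx y hy => ?_
  rw [dist_eq_norm, fderiv_fun_add (hu.diff x hx) (hv.diff x hx),
    fderiv_fun_add (hu.diff y hy) (hv.diff y hy), add_sub_add_comm, dist_eq_norm]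
  calc _ ≤ ‖fderiv ℝ u x - fderiv ℝ u y‖ + ‖fderiv ℝ v x - fderiv ℝ v y‖ := norm_add_le _ _
    _ ≤ K * ‖x - y‖ + L * ‖x - y‖ := add_le_add (hu.norm_sub_le hx hy) (hv.norm_sub_le hx hy)
    _ = _ := by push_cast; ring

theorem ContDiff.differentiable_fderiv {φ : E → ℝ} (h : ContDiff ℝ 2 φ) :
    Differentiable ℝ (fderiv ℝ φ) :=
  (h.fderiv_right (m := 1) (by norm_num)).differentiable (by norm_num)

theorem ContDiff.exists_c11 {φ : E → ℝ} (h : ContDiff ℝ 2 φ) (z : E) (R : ℝ) :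
    ∃ K, C11 φ K (ball z R) := by
  have h1 : ContDiff ℝ 1 (fderiv ℝ φ) := h.fderiv_right (by norm_num)
  have h2 : Continuous (hess φ) := h1.continuous_fderiv (by norm_num)
  obtain ⟨K, hK⟩ := (isCompact_closedBall z R).exists_bound_of_continuousOn h2.continuousOn
  refine ⟨K.toNNReal, fun x _ => h.differentiable (by norm_num) x, ?_⟩
  refine (convex_ball z R).lipschitzOnWith_of_nnnorm_fderiv_le
    (fun x _ => ContDiff.differentiable_fderiv h x) fun x hx => ?_
  exact NNReal.le_toNNReal_of_coe_le (hK x (ball_subset_closedBall hx))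

theorem hasFDerivAt_gauss (a k b : ℝ) (x : E) :
    HasFDerivAt (fun y : E => a * (Real.exp (-k * ‖y‖ ^ 2) - b))
      ((-2 * a * k * Real.exp (-k * ‖x‖ ^ 2)) • idForm E x) x := by
  have h1 : HasFDerivAt (fun y : E => ‖y‖ ^ 2) ((2 : ℝ) • idForm E x) x :=
    ((hasStrictFDerivAt_norm_sq x).hasFDerivAt).congr_fderiv (by
      ext; simp [idForm, two_smul]; rfl)
  have h2 := (((h1.const_mul (-k)).exp.sub_const b).const_mul a)
  refine h2.congr_fderiv ?_
  ext y
  simp only [smul_apply, idForm_apply, smul_eq_mul]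
  ring

theorem hess_gauss (a k b : ℝ) (x : E) :
    hess (fun y : E => a * (Real.exp (-k * ‖y‖ ^ 2) - b)) x
      = (a * Real.exp (-k * ‖x‖ ^ 2)) • ((4 * k ^ 2) • tensorSq x - (2 * k) • idForm E) := by
  have h1 : fderiv ℝ (fun y : E => a * (Real.exp (-k * ‖y‖ ^ 2) - b))
      = fun x => ((-2 * k) * (a * (Real.exp (-k * ‖x‖ ^ 2) - 0))) • idForm E x :=
    funext fun x => by rw [(hasFDerivAt_gauss a k b x).fderiv]; ring_nf
  rw [hess, h1]
  have h2 := ((hasFDerivAt_gauss a k 0 x).const_mul (-2 * k)).fun_smul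
    (idForm E).hasFDerivAt
  rw [h2.fderiv]
  ext y z
  simp only [add_apply, smul_apply, ContinuousLinearMap.smulRight_apply, tensorSq_apply,
    idForm_apply, smul_eq_mul, FunLike.coe_sub, Pi.sub_apply]
  ring

theorem contDiff_gauss (a k b : ℝ) :
    ContDiff ℝ 2 (fun y : E => a * (Real.exp (-k * ‖y‖ ^ 2) - b)) :=
  contDiff_const.mul (((contDiff_const.mul (contDiff_norm_sq ℝ)).exp).sub contDiff_const)

set_option maxHeartbeats 800000 in
/-- A nonnegative supersolution which is small at one point is bounded on a set of definite
measure. -/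
theorem exists_density [Nontrivial E] {c C : ℝ} (hc : 0 < c) (hC : 0 < C) :
    ∃ M δ : ℝ, 1 < M ∧ 0 < δ ∧ δ < 1 ∧ ∀ v : E → ℝ, Super μ c C v → (∀ x, 0 ≤ v x) →
      ∀ x0, ‖x0‖ ≤ 3 → v x0 ≤ 1 → ENNReal.ofReal δ * μ (closedBall 0 1) ≤
        μ ({x | v x ≤ M} ∩ closedBall 0 1) := by
  set k : ℝ := 2 * C / c + 1 with hk
  have hk0 : 0 < k := by positivity
  have hkc : 2 * C < k * c := by
    rw [hk, add_mul, div_mul_cancel₀ _ hc.ne']; linarith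
  set d : ℝ := Real.exp (-k * 9) - Real.exp (-k * 16) with hd
  have hd0 : 0 < d := by
    rw [hd, sub_pos, Real.exp_lt_exp]; nlinarith
  have hd1 : d < 1 := by
    have h1 : Real.exp (-k * 9) < 1 := by rw [Real.exp_lt_one_iff]; nlinarith
    have := Real.exp_pos (-k * 16)
    linarith
  set K0 : ℝ := 2 / d with hK0
  have hK0' : 1 < K0 := by rw [hK0, lt_div_iff₀ hd0]; linarith
  have hK0p : 0 < K0 := by linarith
  set Λ : ℝ := 2 * k * K0 * C / c with hΛ
  have hΛ0 : 0 < Λ := by positivity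
  set n := Module.finrank ℝ E with hn
  set δ : ℝ := min (1 / 2) ((1 / 8) ^ n / Λ ^ n) with hδ
  refine ⟨K0, δ, hK0', by positivity, (min_le_left _ _).trans_lt (by norm_num), ?_⟩
  intro v hv hv0 x0 hx0 hvx0
  obtain ⟨K1, hK1⟩ := hv.c11
  set b : ℝ := Real.exp (-k * 16) with hb
  set φ : E → ℝ := fun y => -K0 * (Real.exp (-k * ‖y‖ ^ 2) - b) with hφ
  have hφc : ContDiff ℝ 2 φ := contDiff_gauss _ _ _
  obtain ⟨K2, hK2⟩ := ContDiff.exists_c11 hφc (0 : E) 4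
  have hwC := (hK1.mono (subset_univ (ball (0 : E) 4))).add hK2
  have hvc : Continuous v := continuousOn_univ.1 hK1.continuousOn
  have hA : MeasurableSet ({x | v x ≤ K0} ∩ closedBall (0 : E) 1) :=
    (measurableSet_le hvc.measurable measurable_const).inter isClosed_closedBall.measurableSet
  have hexp1 : ∀ x : E, Real.exp (-k * ‖x‖ ^ 2) ≤ 1 := fun x => by
    rw [Real.exp_le_one_iff]; nlinarith [sq_nonneg ‖x‖]
  have key := abp (w := fun y => v y + φ y) (a := 0) (m := 1) (R := 4) (Λ := Λ) (x0 := x0) μ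
    (by norm_num) hΛ0.le hwC (hvc.add hφc.continuous).continuousOn ?_ (by linarith) ?_ hA ?_
  · have h1 : μ (ball 0 (1 / (2 * 4))) = ENNReal.ofReal ((1 / 8) ^ n) * μ (closedBall 0 1) := by
      rw [Measure.addHaar_ball _ _ (by norm_num), Measure.addHaar_closedBall _ _ (by norm_num)]
      norm_num
      rfl
    rw [h1] at key
    calc ENNReal.ofReal δ * μ (closedBall 0 1)
        ≤ ENNReal.ofReal ((Λ ^ n)⁻¹ * (1 / 8) ^ n) * μ (closedBall 0 1) := by
          gcongr
          exact (min_le_right _ _).trans (le_of_eq (by rw [div_eq_inv_mul]))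
      _ = ENNReal.ofReal ((Λ ^ n)⁻¹) * (ENNReal.ofReal ((1 / 8) ^ n) * μ (closedBall 0 1)) := by
          rw [ENNReal.ofReal_mul (by positivity), mul_assoc]
      _ ≤ ENNReal.ofReal ((Λ ^ n)⁻¹) * (ENNReal.ofReal (Λ ^ n) * _) := by gcongr
      _ = _ := by
          rw [← mul_assoc, ← ENNReal.ofReal_mul (by positivity),
            inv_mul_cancel₀ (by positivity), ENNReal.ofReal_one, one_mul]
  · intro x hx
    have : φ x = 0 := by simp only [hφ, hx, hb]; norm_num
    simp only [this, add_zero]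
    exact hv0 x
  · have h1 : Real.exp (-k * 9) ≤ Real.exp (-k * ‖x0‖ ^ 2) := by
      rw [Real.exp_le_exp]
      nlinarith [norm_nonneg x0, mul_le_mul hx0 hx0 (norm_nonneg x0) (by norm_num)]
    have h2 : K0 * d = 2 := by rw [hK0, div_mul_cancel₀ _ hd0.ne']
    have h3 : φ x0 ≤ -K0 * d := by
      have h4 := mul_le_mul_of_nonneg_left h1 hK0p.le
      simp only [hφ, hd]
      linarith
    show v x0 + φ x0 ≤ 0 - 1
    linarith
  · filter_upwards [hv.ae] with x hx hxb
    obtain ⟨hdx, ℓ, hℓ, hℓx⟩ := hx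
    obtain ⟨e1, e2⟩ := hess_add (Eventually.of_forall fun y => hK1.diff y trivial)
      (Eventually.of_forall fun y => hφc.differentiable (by norm_num) y) hdx
      (ContDiff.differentiable_fderiv hφc x)
    refine ⟨e2, fun hnn hwx => ?_⟩
    have hsv : Symm (hess v x) := hK1.symm_hess univ_mem hdx
    set g : ℝ := K0 * Real.exp (-k * ‖x‖ ^ 2) with hg
    have hg0 : 0 < g := by positivity
    have hgK : g ≤ K0 := by nlinarith [hexp1 x]
    have hsφ : hess φ x = (2 * k * g) • idForm E - (4 * k ^ 2 * g) • tensorSq x := by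
      rw [hφ, hess_gauss, hg]; module
    have hsφ' : Symm (hess φ x) := by
      rw [hsφ]; exact (symm_idForm.smul _).sub ((symm_tensorSq x).smul _)
    rw [e1] at hnn
    have hsw : Symm (hess v x + hess φ x) := hsv.add hsφ'
    have hI : ℓ (idForm E) ≤ C := by
      have := (hℓ _ symm_idForm nonNeg_idForm).2
      nlinarith [norm_idForm_le (E := E)]
    have hT : c * ‖x‖ ^ 2 ≤ ℓ (tensorSq x) := by
      have := (hℓ _ (symm_tensorSq x) (nonNeg_tensorSq x)).1
      rwa [norm_tensorSq] at this
    have hwℓ := (hℓ _ hsw hnn).1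
    have hsum : ℓ (hess v x + hess φ x)
        ≤ 2 * k * g * C - 4 * k ^ 2 * g * (c * ‖x‖ ^ 2) := by
      rw [map_add, hsφ, map_sub, map_smul, map_smul, smul_eq_mul, smul_eq_mul]
      have h1 : 2 * k * g * ℓ (idForm E) ≤ 2 * k * g * C := by gcongr
      have h2 : 4 * k ^ 2 * g * (c * ‖x‖ ^ 2) ≤ 4 * k ^ 2 * g * ℓ (tensorSq x) := by gcongr
      linarith
    have hnorm := norm_nonneg (hess v x + hess φ x)
    have hx1 : ‖x‖ ^ 2 ≤ 1 := by
      by_contra! hcon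
      have h1 : 0 ≤ 2 * k * g * C - 4 * k ^ 2 * g * (c * ‖x‖ ^ 2) :=
        (mul_nonneg hc.le hnorm).trans (hwℓ.trans hsum)
      have h2 : 2 * k * g * C - 4 * k ^ 2 * g * (c * ‖x‖ ^ 2)
        = 2 * k * g * (C - 2 * (k * c) * ‖x‖ ^ 2) := by ring
      rw [h2] at h1
      have h3 : 0 ≤ C - 2 * (k * c) * ‖x‖ ^ 2 := nonneg_of_mul_nonneg_right h1 (by positivity)
      nlinarith [mul_pos hk0 hc]
    refine ⟨⟨?_, ?_⟩, ?_⟩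
    · have : -φ x ≤ K0 := by
        have h7 : Real.exp (-k * ‖x‖ ^ 2) - b ≤ 1 := by linarith [hexp1 x, Real.exp_pos (-k * 16)]
        have h8 := mul_le_mul_of_nonneg_left h7 hK0p.le
        simp only [hφ]
        linarith
      have h4 : v x + φ x ≤ 0 := hwx
      show v x ≤ K0
      linarith
    · rw [mem_closedBall_zero_iff]
      nlinarith [norm_nonneg x]
    · rw [e1, hΛ, le_div_iff₀ hc]
      have h5 : 0 ≤ 4 * k ^ 2 * g * (c * ‖x‖ ^ 2) := by positivity
      have h6 : 2 * k * g * C ≤ 2 * k * K0 * C := by gcongr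
      linarith

end WeakHarnack

section InkSpots

variable {E : Type*} [NormedAddCommGroup E] [InnerProductSpace ℝ E] [MeasurableSpace E]
  {μ : Measure E} [BorelSpace E] [FiniteDimensional ℝ E] [μ.IsAddHaarMeasure]

theorem Super.continuous {c C : ℝ} {v : E → ℝ} (h : Super μ c C v) : Continuous v := by
  obtain ⟨K, hK⟩ := h.c11
  exact continuousOn_univ.1 hK.continuousOn

variable (μ) in
/-- The conclusion of `exists_density`. -/
def Density (c C M δ : ℝ) : Prop :=
  ∀ v : E → ℝ, Super μ c C v → (∀ x, 0 ≤ v x) →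
      ∀ x0, ‖x0‖ ≤ 3 → v x0 ≤ 1 → ENNReal.ofReal δ * μ (closedBall 0 1) ≤
        μ ({x | v x ≤ M} ∩ closedBall 0 1)

theorem Density.spread {c C M δ : ℝ} (hD : Density μ c C M δ) (hδ : 0 < δ) (hδ1 : δ < 1)
    {v : E → ℝ} (hv : Super μ c C v) (hv0 : ∀ x, 0 ≤ v x) {t r : ℝ} (ht : 0 < t) (hr : 0 < r)
    {z : E} (hbig : ENNReal.ofReal (1 - δ) * μ (closedBall z r) <
      μ ({x | t * M < v x} ∩ closedBall z r)) : ∀ x ∈ closedBall z (3 * r), t < v x := by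
  intro x hx
  by_contra! hcon
  set x0 : E := r⁻¹ • (x - z) with hx0
  have hzx : z + r • x0 = x := by
    rw [hx0, smul_smul, mul_inv_cancel₀ hr.ne', one_smul]; abel
  have hx0n : ‖x0‖ ≤ 3 := by
    rw [hx0, norm_smul, norm_inv, Real.norm_of_nonneg hr.le, inv_mul_le_iff₀ hr, mul_comm]
    simpa [dist_eq_norm] using hx
  have hlow := hD (fun y => t⁻¹ * v (z + r • y)) (hv.comp_affine (by positivity) hr.ne' z)
    (fun y => mul_nonneg (by positivity) (hv0 _)) x0 hx0n (by
      rw [hzx, inv_mul_le_iff₀ ht]; linarith)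
  have hpre : {y | t⁻¹ * v (z + r • y) ≤ M} ∩ closedBall 0 1
      = (fun y => z + r • y) ⁻¹' ({x | v x ≤ t * M} ∩ closedBall z r) := by
    have := preimage_affine_closedBall hr z 1
    rw [mul_one] at this
    rw [preimage_inter, this]
    ext y
    simp [inv_mul_le_iff₀ ht]
  have hpre1 : closedBall (0 : E) 1 = (fun y => z + r • y) ⁻¹' closedBall z r := by
    have := preimage_affine_closedBall hr z 1
    rw [mul_one] at this
    exact this.symm
  rw [hpre, hpre1, measure_preimage_affine μ hr, measure_preimage_affine μ hr,
    mul_left_comm] at hlow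
  have hrn : ENNReal.ofReal ((r ^ Module.finrank ℝ E)⁻¹) ≠ 0 := by
    rw [Ne, ENNReal.ofReal_eq_zero, not_le]; positivity
  rw [ENNReal.mul_le_mul_iff_right hrn ENNReal.ofReal_ne_top] at hlow
  have hmeas : MeasurableSet {x | t * M < v x} :=
    measurableSet_lt measurable_const hv.continuous.measurable
  have hsplit := measure_inter_add_sdiff (μ := μ) (closedBall z r) hmeas
  have e1 : closedBall z r ∩ {x | t * M < v x} = {x | t * M < v x} ∩ closedBall z r :=
    inter_comm _ _
  have e2 : closedBall z r \ {x | t * M < v x} = {x | v x ≤ t * M} ∩ closedBall z r := by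
    ext y; simp [and_comm]
  rw [e1, e2] at hsplit
  have hfin : μ (closedBall z r) ≠ ⊤ := measure_closedBall_lt_top.ne
  have : μ (closedBall z r) < μ (closedBall z r) := by
    calc μ (closedBall z r)
        = ENNReal.ofReal (1 - δ) * μ (closedBall z r) + ENNReal.ofReal δ * μ (closedBall z r) := by
          rw [← add_mul, ← ENNReal.ofReal_add (by linarith) hδ.le]; simp
      _ < μ ({x | t * M < v x} ∩ closedBall z r) + ENNReal.ofReal δ * μ (closedBall z r) :=
          ENNReal.add_lt_add_right (ENNReal.mul_ne_top ENNReal.ofReal_ne_top hfin) hbig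
      _ ≤ _ := by
          conv_rhs => rw [← hsplit]
          gcongr
  exact lt_irrefl _ this

theorem Density.growth {c C M δ : ℝ} (hD : Density μ c C M δ) (hδ : 0 < δ) (hδ1 : δ < 1)
    {v : E → ℝ} (hv : Super μ c C v) (hv0 : ∀ x, 0 ≤ v x) {t : ℝ} (ht : 0 < t) (hM : 1 < M) :
    (∀ x ∈ closedBall (0 : E) 1, t < v x) ∨
      ENNReal.ofReal (1 + δ / 5 ^ Module.finrank ℝ E) * μ ({x | t * M < v x} ∩ closedBall 0 1) ≤
        μ ({x | t < v x} ∩ closedBall 0 1) := by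
  set n := Module.finrank ℝ E with hn
  set S : Set E := {x | t * M < v x} with hS
  set S' : Set E := {x | t < v x} with hS'
  have hSm : MeasurableSet S := measurableSet_lt measurable_const hv.continuous.measurable
  have hS'm : MeasurableSet S' := measurableSet_lt measurable_const hv.continuous.measurable
  have hSS' : S ⊆ S' := fun x hx => by
    have h1 : t * M < v x := hx
    show t < v x
    nlinarith
  by_cases hbig : ENNReal.ofReal (1 - δ) * μ (closedBall 0 1) < μ (S ∩ closedBall 0 1)
  · left
    intro x hx
    exact hD.spread hδ hδ1 hv hv0 ht one_pos hbig x (closedBall_subset_closedBall (by norm_num) hx)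
  right
  set s : ℕ → ℝ := fun i => (1 / 2) ^ i with hs
  have hs0 : ∀ i, 0 < s i := fun i => by positivity
  have hs1 : ∀ i, s i ≤ 1 := fun i => pow_le_one₀ (by norm_num) (by norm_num)
  have hss : ∀ i, s i = 2 * s (i + 1) := fun i => by simp only [hs, pow_succ]; ring
  have hstend : Tendsto s atTop (𝓝[>] 0) := by
    rw [tendsto_nhdsWithin_iff]
    exact ⟨tendsto_pow_atTop_nhds_zero_of_lt_one (by norm_num) (by norm_num),
      Eventually.of_forall fun i => hs0 i⟩
  have hparent : ∀ᵐ x ∂μ, x ∈ S ∩ closedBall 0 1 → ∃ i : ℕ,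
      μ (S ∩ closedBall ((1 - s i) • x) (s i)) ≤
        ENNReal.ofReal (1 - δ) * μ (closedBall ((1 - s i) • x) (s i)) ∧
      closedBall ((1 - s i) • x) (s i) ⊆ S' := by
    have hdens := IsUnifLocDoublingMeasure.ae_tendsto_measure_inter_div μ S 1
    rw [ae_restrict_iff' hSm] at hdens
    filter_upwards [hdens] with x hx hxS
    have hxn : ‖x‖ ≤ 1 := by simpa using hxS.2
    have hlim := hx hxS.1 (fun i => (1 - s i) • x) s hstend (Eventually.of_forall fun i => by
      rw [mem_closedBall, dist_eq_norm, one_mul,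
        show x - (1 - s i) • x = s i • x by module, norm_smul, Real.norm_of_nonneg (hs0 i).le]
      exact mul_le_of_le_one_right (hs0 i).le hxn)
    have h1 : ∀ᶠ i in atTop, ENNReal.ofReal (1 - δ) <
        μ (S ∩ closedBall ((1 - s i) • x) (s i)) / μ (closedBall ((1 - s i) • x) (s i)) := by
      apply hlim.eventually_const_lt
      rw [← ENNReal.ofReal_one]
      exact (ENNReal.ofReal_lt_ofReal_iff one_pos).2 (by linarith)
    have h2 : ∃ i, ENNReal.ofReal (1 - δ) * μ (closedBall ((1 - s i) • x) (s i)) <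
        μ (S ∩ closedBall ((1 - s i) • x) (s i)) := by
      obtain ⟨i, hi⟩ := h1.exists
      refine ⟨i, ?_⟩
      rwa [ENNReal.lt_div_iff_mul_lt (Or.inl (measure_closedBall_pos μ _ (hs0 i)).ne')
        (Or.inl measure_closedBall_lt_top.ne)] at hi
    classical
    obtain ⟨hj, hmin⟩ := And.intro (Nat.find_spec h2) (fun i => Nat.find_min (m := i) h2)
    rcases hjj : Nat.find h2 with _ | i
    · rw [hjj] at hj
      simp [hs] at hj
      exact absurd hj (by simpa using hbig)
    · rw [hjj] at hj hmin
      refine ⟨i, not_lt.1 (hmin i (Nat.lt_succ_self i)), ?_⟩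
      have hsp := hD.spread hδ hδ1 hv hv0 ht (hs0 (i + 1)) hj
      intro y hy
      refine hsp y ?_
      rw [mem_closedBall, dist_eq_norm] at hy ⊢
      calc ‖y - (1 - s (i + 1)) • x‖
          = ‖(y - (1 - s i) • x) + (-s (i + 1)) • x‖ := by
            rw [hss i]; congr 1; module
        _ ≤ s i + s (i + 1) * 1 := by
            refine (norm_add_le _ _).trans (add_le_add hy ?_)
            rw [norm_smul, norm_neg, Real.norm_of_nonneg (hs0 _).le]
            exact mul_le_mul_of_nonneg_left hxn (hs0 _).le
        _ = _ := by rw [hss i]; ring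
  set T : Set (E × ℕ) := {p | p.1 ∈ S ∩ closedBall 0 1 ∧
      μ (S ∩ closedBall ((1 - s p.2) • p.1) (s p.2)) ≤
        ENNReal.ofReal (1 - δ) * μ (closedBall ((1 - s p.2) • p.1) (s p.2)) ∧
      closedBall ((1 - s p.2) • p.1) (s p.2) ⊆ S'} with hT
  obtain ⟨u, huT, hdisj, hcov⟩ := Vitali.exists_disjoint_subfamily_covering_enlargement_closedBall
    T (fun p => (1 - s p.2) • p.1) (fun p => s p.2) 1 (fun p _ => hs1 _) 5 (by norm_num)
  have hcount : u.Countable := hdisj.countable_of_nonempty_interior fun p _ =>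
    ⟨(1 - s p.2) • p.1, ball_subset_interior_closedBall (mem_ball_self (hs0 _))⟩
  have : Countable u := hcount.to_subtype
  set β : u → Set E := fun p => closedBall ((1 - s p.1.2) • p.1.1) (s p.1.2) with hβ
  have hβd : Pairwise (Function.onFun Disjoint β) := fun p q hpq =>
    hdisj p.2 q.2 (fun h => hpq (Subtype.ext h))
  have hβ1 : ∀ p, β p ⊆ closedBall 0 1 := fun p => by
    apply closedBall_subset_closedBall'
    have : ‖p.1.1‖ ≤ 1 := by simpa using (huT p.2).1.2
    rw [dist_zero_right, norm_smul, Real.norm_of_nonneg (by linarith [hs1 p.1.2])]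
    nlinarith [hs1 p.1.2, hs0 p.1.2]
  have hβfin : ∀ p, μ (β p) ≠ ⊤ := fun p => measure_closedBall_lt_top.ne
  have hβδ : ∀ p, ENNReal.ofReal δ * μ (β p) ≤ μ (β p \ S) := fun p => by
    have h1 : μ (S ∩ β p) ≤ ENNReal.ofReal (1 - δ) * μ (β p) := (huT p.2).2.1
    have h2 := measure_inter_add_sdiff (μ := μ) (β p) hSm
    rw [inter_comm] at h2
    have h3 : ENNReal.ofReal (1 - δ) * μ (β p) + ENNReal.ofReal δ * μ (β p) = μ (β p) := by
      rw [← add_mul, ← ENNReal.ofReal_add (by linarith) hδ.le]; simp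
    have h4 : ENNReal.ofReal (1 - δ) * μ (β p) + ENNReal.ofReal δ * μ (β p) ≤
        ENNReal.ofReal (1 - δ) * μ (β p) + μ (β p \ S) := by
      rw [h3]; conv_lhs => rw [← h2]
      gcongr
    exact (ENNReal.add_le_add_iff_left
      (ENNReal.mul_ne_top ENNReal.ofReal_ne_top (hβfin p))).1 h4
  have hcover : μ (S ∩ closedBall 0 1) ≤ ∑' p : u, ENNReal.ofReal (5 ^ n) * μ (β p) := by
    calc μ (S ∩ closedBall 0 1)
        ≤ μ (⋃ p : u, closedBall ((1 - s p.1.2) • p.1.1) (5 * s p.1.2)) := by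
          apply measure_mono_ae
          filter_upwards [hparent] with x hx hxS
          obtain ⟨i, hi1, hi2⟩ := hx hxS
          obtain ⟨q, hq, hsub⟩ := hcov (x, i) ⟨hxS, hi1, hi2⟩
          have hxn : ‖x‖ ≤ 1 := by
            have h0 : x ∈ closedBall (0 : E) 1 := hxS.2
            simpa using h0
          refine mem_iUnion.2 ⟨⟨q, hq⟩, hsub ?_⟩
          rw [mem_closedBall, dist_eq_norm, show x - (1 - s i) • x = s i • x by module, norm_smul,
            Real.norm_of_nonneg (hs0 i).le]
          exact mul_le_of_le_one_right (hs0 i).le hxn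
      _ ≤ ∑' p : u, μ (closedBall ((1 - s p.1.2) • p.1.1) (5 * s p.1.2)) := measure_iUnion_le _
      _ = _ := by
          congr 1; ext p
          rw [Measure.addHaar_closedBall_mul μ _ (by norm_num) (hs0 _).le, hβ,
            Measure.addHaar_closedBall_center μ ((1 - s p.1.2) • p.1.1)]
  have hdiff : ENNReal.ofReal (δ / 5 ^ n) * μ (S ∩ closedBall 0 1) ≤
      μ ((S' ∩ closedBall 0 1) \ S) := by
    calc ENNReal.ofReal (δ / 5 ^ n) * μ (S ∩ closedBall 0 1)
        ≤ ENNReal.ofReal (δ / 5 ^ n) * ∑' p : u, ENNReal.ofReal (5 ^ n) * μ (β p) := by gcongr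
      _ = ∑' p : u, ENNReal.ofReal δ * μ (β p) := by
          rw [← ENNReal.tsum_mul_left]
          congr 1; ext p
          rw [← mul_assoc, ← ENNReal.ofReal_mul (by positivity),
            div_mul_cancel₀ _ (by positivity)]
      _ ≤ ∑' p : u, μ (β p \ S) := ENNReal.tsum_le_tsum hβδ
      _ = μ (⋃ p, β p \ S) := by
          rw [measure_iUnion (fun p q hpq => (hβd hpq).mono sdiff_subset sdiff_subset)
            fun p => isClosed_closedBall.measurableSet.diff hSm]
      _ ≤ _ := by
        refine measure_mono (iUnion_subset fun p x hx => ?_)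
        exact
          ⟨⟨(huT p.2).2.2 hx.1, hβ1 p hx.1⟩, hx.2⟩
  have hsplit := measure_inter_add_sdiff (μ := μ) (S' ∩ closedBall 0 1) hSm
  have e1 : S' ∩ closedBall 0 1 ∩ S = S ∩ closedBall 0 1 := by
    ext y
    constructor
    · rintro ⟨⟨_, h2⟩, h3⟩; exact ⟨h3, h2⟩
    · rintro ⟨h2, h3⟩; exact ⟨⟨hSS' h2, h3⟩, h2⟩
  rw [e1] at hsplit
  rw [← hsplit, ENNReal.ofReal_add zero_le_one (by positivity), add_mul, ENNReal.ofReal_one,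
    one_mul]
  gcongr

/-- The weak Harnack inequality: a nonnegative supersolution which is at least one on a portion of
the unit ball is bounded below in the unit ball. -/
theorem exists_weakHarnack (μ : Measure E) [μ.IsAddHaarMeasure] [Nontrivial E] {c C : ℝ}
    (hc : 0 < c) (hC : 0 < C) {θ : ℝ} (hθ : 0 < θ) :
    ∃ η > 0, ∀ v : E → ℝ, Super μ c C v → (∀ x, 0 ≤ v x) →
      ENNReal.ofReal θ * μ (closedBall 0 1) ≤ μ ({x | 1 ≤ v x} ∩ closedBall 0 1) →
      ∀ x ∈ closedBall (0 : E) 1, η < v x := by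
  obtain ⟨M, δ, hM, hδ, hδ1, hD⟩ := exists_density (μ := μ) hc hC
  replace hD : Density μ c C M δ := hD
  set κ : ℝ := δ / 5 ^ Module.finrank ℝ E with hκ
  have hκ0 : 0 < κ := by positivity
  have hM0 : 0 < M := by linarith
  obtain ⟨k, hk⟩ := pow_unbounded_of_one_lt (1 / θ) (show 1 < 1 + κ by linarith)
  refine ⟨1 / 2 * (M⁻¹) ^ k, by positivity, fun v hv hv0 hvθ => ?_⟩
  have hind : ∀ j : ℕ, (∀ x ∈ closedBall (0 : E) 1, 1 / 2 * (M⁻¹) ^ j < v x) ∨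
      ENNReal.ofReal ((1 + κ) ^ j * θ) * μ (closedBall 0 1) ≤
        μ ({x | 1 / 2 * (M⁻¹) ^ j < v x} ∩ closedBall 0 1) := by
    intro j
    induction j with
    | zero =>
      right
      simp only [pow_zero, one_mul, mul_one]
      refine hvθ.trans (measure_mono (inter_subset_inter_left _ fun x hx => ?_))
      have : (1 : ℝ) ≤ v x := hx
      show 1 / 2 < v x
      linarith
    | succ j ih =>
      have hstep : 1 / 2 * M⁻¹ ^ (j + 1) * M = 1 / 2 * M⁻¹ ^ j := by
        rw [pow_succ]; field_simp
      have hle : 1 / 2 * M⁻¹ ^ (j + 1) ≤ 1 / 2 * M⁻¹ ^ j := by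
        rw [← hstep]
        exact le_mul_of_one_le_right (by positivity) hM.le
      rcases ih with ih | ih
      · left
        exact fun x hx => hle.trans_lt (ih x hx)
      · rcases hD.growth hδ hδ1 hv hv0 (t := 1 / 2 * M⁻¹ ^ (j + 1)) (by positivity) hM with h | h
        · exact Or.inl h
        · right
          rw [hstep] at h
          refine le_trans ?_ h
          rw [show (1 + κ) ^ (j + 1) * θ = (1 + κ) * ((1 + κ) ^ j * θ) by ring,
            ENNReal.ofReal_mul (by positivity), mul_assoc]
          gcongr
  rcases hind k with h | h
  · exact h
  · exfalso
    have h1 : (1 : ℝ) < (1 + κ) ^ k * θ := by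
      rwa [div_lt_iff₀ hθ] at hk
    have h2 := h.trans (measure_mono inter_subset_right)
    have h3 : 1 * μ (closedBall (0 : E) 1) < ENNReal.ofReal ((1 + κ) ^ k * θ) * μ (closedBall 0 1) := by
      refine ENNReal.mul_lt_mul_left (measure_closedBall_pos μ _ one_pos).ne'
        measure_closedBall_lt_top.ne ?_
      rw [← ENNReal.ofReal_one]
      exact (ENNReal.ofReal_lt_ofReal_iff (by linarith)).2 h1
    rw [one_mul] at h3
    exact absurd h2 (not_le.2 h3)

end InkSpots

section Structure

variable {E : Type*} [NormedAddCommGroup E] [InnerProductSpace ℝ E]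

/-- A fully nonlinear operator `F`, elliptic with concave level sets on a closed set `P` of
symmetric forms where it is positive. -/
structure Elliptic (F : Bil E → ℝ) (P : Bil E → Prop) : Prop where
  contDiff : ContDiff ℝ 1 F
  isClosed : IsClosed {B | P B}
  symm : ∀ B, P B → Symm B
  mono : ∀ A B, P A → Symm B → NonNeg (B - A) → P B
  pos : ∀ A X, P A → 0 < F A → Symm X → NonNeg X → X ≠ 0 → 0 < fderiv ℝ F A X
  concave : ∀ A B, P A → P B → 0 < F A → F B = F A → 0 ≤ fderiv ℝ F A (B - A)
  exists_sub : ∀ A, P A → 0 < F A → ∃ ε > (0 : ℝ), P (A - ε • idForm E)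

variable {F : Bil E → ℝ} {P : Bil E → Prop}

theorem NonNeg.add {A B : Bil E} (hA : NonNeg A) (hB : NonNeg B) : NonNeg (A + B) :=
  fun x => by simpa using add_nonneg (hA x) (hB x)

theorem NonNeg.smul {A : Bil E} (hA : NonNeg A) {t : ℝ} (ht : 0 ≤ t) : NonNeg (t • A) :=
  fun x => by simpa using mul_nonneg ht (hA x)

theorem Elliptic.hasDerivAt (h : Elliptic F P) (A X : Bil E) (t : ℝ) :
    HasDerivAt (fun t : ℝ => F (A + t • X)) (fderiv ℝ F (A + t • X) X) t := by
  have h1 : HasDerivAt (fun t : ℝ => A + t • X) X t := by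
    simpa using ((hasDerivAt_id t).smul_const X).const_add A
  exact ((h.contDiff.differentiable one_ne_zero) (A + t • X)).hasFDerivAt.comp_hasDerivAt t h1

theorem Elliptic.le (h : Elliptic F P) {A B : Bil E} (hA : P A) (hF : 0 < F A) (hB : Symm B)
    (hAB : NonNeg (B - A)) : F A ≤ F B := by
  rcases eq_or_ne (B - A) 0 with h0 | h0
  · rw [sub_eq_zero.1 h0]
  set X := B - A with hX
  have hXs : Symm X := hB.sub (h.symm A hA)
  have key : ∀ ⦃t : ℝ⦄, t ∈ Icc (0 : ℝ) 1 → - F (A + t • X) ≤ - F A := by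
    refine image_le_of_deriv_right_lt_deriv_boundary (f' := fun t => - fderiv ℝ F (A + t • X) X)
      (B' := fun _ => 0) ?_ ?_ (by simp) (fun _ => hasDerivAt_const _ _) ?_
    · exact fun t _ => ((h.hasDerivAt A X t).neg).continuousAt.continuousWithinAt
    · exact fun t _ => (h.hasDerivAt A X t).neg.hasDerivWithinAt
    · intro t ht hft
      have hP : P (A + t • X) := h.mono A _ hA ((h.symm A hA).add (hXs.smul t))
        (by simpa using hAB.smul ht.1)
      simpa using h.pos _ X hP (by linarith) hXs hAB h0
  simpa [hX] using key (right_mem_Icc.2 zero_le_one)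

theorem Elliptic.eq_of_le (h : Elliptic F P) {A B : Bil E} (hA : P A) (hF : 0 < F A)
    (hB : Symm B) (hAB : NonNeg (B - A)) (hBA : F B ≤ F A) : B = A := by
  by_contra hne
  set X := B - A with hX
  have hXs : Symm X := hB.sub (h.symm A hA)
  have hd := (h.hasDerivAt A X 0)
  have hpos : 0 < fderiv ℝ F (A + (0 : ℝ) • X) X := by
    simpa using h.pos A X hA hF hXs hAB (sub_ne_zero.2 hne)
  have h1 : ∀ᶠ t in 𝓝[>] (0 : ℝ), F A < F (A + t • X) := by
    have := (hasDerivAt_iff_tendsto_slope.1 hd).mono_left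
      (nhdsWithin_mono (0 : ℝ) (fun t (ht : 0 < t) => ne_of_gt ht))
    filter_upwards [this.eventually (lt_mem_nhds hpos), self_mem_nhdsWithin] with t ht ht0
    have ht0 : (0 : ℝ) < t := ht0
    rw [slope_def_field] at ht
    simp only [sub_zero, zero_smul, add_zero] at ht
    have := (div_pos_iff_of_pos_right ht0).1 ht
    linarith
  obtain ⟨t, ht, ht0, ht1⟩ := (h1.and (Ioo_mem_nhdsGT (zero_lt_one (α := ℝ)))).exists
  have hP : P (A + t • X) := h.mono A _ hA ((h.symm A hA).add (hXs.smul t))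
    (by simpa using NonNeg.smul hAB ht0.le)
  have h2 : F (A + t • X) ≤ F B := by
    refine h.le hP (hF.trans ht) hB ?_
    have : B - (A + t • X) = (1 - t) • X := by rw [hX]; module
    rw [this]
    exact NonNeg.smul hAB (by linarith)
  linarith

theorem isClosed_symm : IsClosed {B : Bil E | Symm B} := by
  simp only [Symm, ofPred_forall]
  exact isClosed_iInter fun x => isClosed_iInter fun y =>
    isClosed_eq (by fun_prop) (by fun_prop)

theorem isClosed_nonNeg : IsClosed {B : Bil E | NonNeg B} := by
  simp only [NonNeg, ofPred_forall]
  exact isClosed_iInter fun x => isClosed_le (by fun_prop) (by fun_prop)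

theorem Elliptic.exists_ell [FiniteDimensional ℝ E] (h : Elliptic F P) (K : ℝ) {lam : ℝ}
    (hlam : 0 < lam) : ∃ c > 0, ∃ C > 0, ∀ A, P A → ‖A‖ ≤ K → lam ≤ F A →
      fderiv ℝ F A ∈ Ell c C := by
  set S : Set (Bil E) := {A | P A ∧ lam ≤ F A} ∩ closedBall 0 K with hS
  have hScl : IsClosed {A | P A ∧ lam ≤ F A} :=
    h.isClosed.inter (isClosed_le continuous_const h.contDiff.continuous)
  have hSc : IsCompact S := (isCompact_closedBall _ _).inter_left hScl
  set T : Set (Bil E) := {X | Symm X ∧ NonNeg X} ∩ sphere 0 1 with hT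
  have hTcl : IsClosed {X : Bil E | Symm X ∧ NonNeg X} := isClosed_symm.inter isClosed_nonNeg
  have hTc : IsCompact T := (isCompact_sphere _ _).inter_left hTcl
  have hcont : Continuous fun p : Bil E × Bil E => fderiv ℝ F p.1 p.2 :=
    ((h.contDiff.continuous_fderiv one_ne_zero).comp continuous_fst).clm_apply continuous_snd
  obtain ⟨C, hC⟩ := (hSc.prod hTc).exists_bound_of_continuousOn hcont.continuousOn
  have hc : ∃ c > 0, ∀ p ∈ S ×ˢ T, c ≤ fderiv ℝ F p.1 p.2 := by
    rcases (S ×ˢ T).eq_empty_or_nonempty with he | hne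
    · exact ⟨1, one_pos, by simp [he]⟩
    · obtain ⟨p, hp, hmin⟩ := (hSc.prod hTc).exists_isMinOn hne hcont.continuousOn
      refine ⟨_, h.pos p.1 p.2 hp.1.1.1 (hlam.trans_le hp.1.1.2) hp.2.1.1 hp.2.1.2 ?_, hmin⟩
      have := mem_sphere_zero_iff_norm.1 hp.2.2
      intro h0; rw [h0] at this; simp at this
  obtain ⟨c, hc0, hc⟩ := hc
  refine ⟨c, hc0, max C 1, by positivity, fun A hA hAK hAl X hX hXn => ?_⟩
  rcases eq_or_ne X 0 with rfl | hX0
  · simp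
  have hn : 0 < ‖X‖ := norm_pos_iff.2 hX0
  have hmem : (A, ‖X‖⁻¹ • X) ∈ S ×ˢ T := by
    refine ⟨⟨⟨hA, hAl⟩, by simpa using hAK⟩, ⟨hX.smul _, hXn.smul (by positivity)⟩, ?_⟩
    rw [mem_sphere_zero_iff_norm, norm_smul, norm_inv, norm_norm, inv_mul_cancel₀ hn.ne']
  have h1 := hc _ hmem
  have h2 := (le_abs_self _).trans (hC _ hmem)
  simp only [map_smul, smul_eq_mul] at h1 h2
  have h3 : fderiv ℝ F A X = ‖X‖ * (‖X‖⁻¹ * fderiv ℝ F A X) := by field_simp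
  constructor
  · rw [h3, mul_comm c]; gcongr
  · rw [h3, mul_comm _ ‖X‖]; gcongr; exact h2.trans (le_max_left _ _)

/-- A form that is almost bounded below and above by forms on a level set lies on the level set. -/
theorem Elliptic.mem_of_pinched [FiniteDimensional ℝ E] (h : Elliptic F P) {K f₀ : ℝ}
    (hf₀ : 0 < f₀) {Q : Bil E} (hQ : Symm Q)
    (hlow : ∀ ε > 0, ∃ B, P B ∧ ‖B‖ ≤ K ∧ |F B - f₀| ≤ ε ∧ NonNeg (Q + ε • idForm E - B))
    (hup : ∀ ε > 0, ∃ B, P B ∧ ‖B‖ ≤ K ∧ |F B - f₀| ≤ ε ∧ NonNeg (B - (Q - ε • idForm E))) :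
    P Q ∧ F Q = f₀ := by
  have hF := h.contDiff.continuous
  have lim : ∀ p : ℝ → Bil E → Prop, IsClosed {q : ℝ × Bil E | p q.1 q.2} →
      (∀ ε > 0, ∃ B, P B ∧ ‖B‖ ≤ K ∧ |F B - f₀| ≤ ε ∧ p ε B) → ∃ B, P B ∧ F B = f₀ ∧ p 0 B := by
    intro p hp hex
    have hu : ∀ n : ℕ, (0 : ℝ) < 1 / ((n : ℝ) + 1) := fun n => by positivity
    choose B hB1 hB2 hB3 hB4 using fun n : ℕ => hex _ (hu n)
    obtain ⟨B₀, _, φ, hφ, hlim⟩ := (isCompact_closedBall (0 : Bil E) K).tendsto_subseq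
      (x := B) (fun n => by simpa using hB2 n)
    have hε := (tendsto_one_div_add_atTop_nhds_zero_nat (𝕜 := ℝ)).comp hφ.tendsto_atTop
    refine ⟨B₀, h.isClosed.mem_of_tendsto hlim (.of_forall fun n => hB1 _), ?_, ?_⟩
    · have h1 : |F B₀ - f₀| ≤ 0 :=
        le_of_tendsto_of_tendsto' (((hF.tendsto B₀).comp hlim).sub_const f₀).abs hε
          fun n => hB3 _
      exact sub_eq_zero.1 (abs_nonpos_iff.1 h1)
    · exact hp.mem_of_tendsto (hε.prodMk_nhds hlim) (.of_forall fun n => hB4 _)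
  obtain ⟨B, hB1, hB2, hB3⟩ := lim (fun ε B => NonNeg (Q + ε • idForm E - B))
    (isClosed_nonNeg.preimage (by fun_prop)) hlow
  obtain ⟨B', hB1', hB2', hB3'⟩ := lim (fun ε B => NonNeg (B - (Q - ε • idForm E)))
    (isClosed_nonNeg.preimage (by fun_prop)) hup
  simp only [zero_smul, add_zero, sub_zero] at hB3 hB3'
  have hBB : NonNeg (B' - B) := by simpa using hB3'.add hB3
  have h1 : B' = B := h.eq_of_le hB1 (by linarith) (h.symm _ hB1') hBB (by linarith)
  have h2 : Q = B := by
    refine h.eq_of_le hB1 (by linarith) hQ hB3 ?_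
    have := h.le (h.mono _ _ hB1 hQ hB3)
      (lt_of_lt_of_le (by linarith) (h.le hB1 (by linarith) hQ hB3)) (h.symm _ hB1') hB3'
    linarith
  rw [h2]; exact ⟨hB1, hB2⟩

end Structure

section Solutions

variable {E : Type*} [NormedAddCommGroup E] [InnerProductSpace ℝ E] [MeasurableSpace E]

/-- `u` is a `C^{1,1}` solution of `F(D²u) = f` with `P(D²u)` almost everywhere on `s`. -/
structure Sol (μ : Measure E) (F : Bil E → ℝ) (P : Bil E → Prop) (f : E → ℝ) (K : ℝ≥0)
    (s : Set E) (u : E → ℝ) : Prop where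
  isOpen : IsOpen s
  c11 : C11 u K s
  ae : ∀ᵐ x ∂μ, x ∈ s → DifferentiableAt ℝ (fderiv ℝ u) x ∧ P (hess u x) ∧ F (hess u x) = f x

variable {μ : Measure E} {F : Bil E → ℝ} {P : Bil E → Prop} {f : E → ℝ} {K : ℝ≥0} {s : Set E}
  {u : E → ℝ}

theorem Sol.mono (h : Sol μ F P f K s u) {t : Set E} (ht : IsOpen t) (hts : t ⊆ s) :
    Sol μ F P f K t u :=
  ⟨ht, h.c11.mono hts, h.ae.mono fun _ hx hxt => hx (hts hxt)⟩

theorem C11.eventually_differentiableAt (h : C11 u K s) {x : E} (hs : s ∈ 𝓝 x) :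
    ∀ᶠ y in 𝓝 x, DifferentiableAt ℝ u y := by
  filter_upwards [hs] with y hy using h.diff y hy

/-- The normalized rescaling of `u` at `z` to scale `r`. -/
def blow (u : E → ℝ) (z : E) (r : ℝ) (x : E) : ℝ :=
  r⁻¹ ^ 2 * u (z + r • x) - (r⁻¹ ^ 2 * u z + r⁻¹ * fderiv ℝ u z x)

@[simp] theorem blow_zero (u : E → ℝ) (z : E) (r : ℝ) : blow u z r 0 = 0 := by simp [blow]

theorem hasFDerivAt_blow {z : E} {r : ℝ} (hr : r ≠ 0) {x : E}
    (hx : DifferentiableAt ℝ u (z + r • x)) :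
    HasFDerivAt (blow u z r) (r⁻¹ • (fderiv ℝ u (z + r • x) - fderiv ℝ u z)) x := by
  have h1 : DifferentiableAt ℝ (fun y => r⁻¹ ^ 2 * u (z + r • y)) x :=
    (differentiableAt_comp_affine hx).const_mul _
  have h2 := h1.hasFDerivAt
  rw [fderiv_comp_affine] at h2
  have h3 := h2.sub (((fderiv ℝ u z).hasFDerivAt (x := x)).const_mul r⁻¹ |>.const_add
    (r⁻¹ ^ 2 * u z))
  refine h3.congr_fderiv ?_
  rw [smul_sub]
  congr 2
  field_simp

theorem fderiv_blow {z : E} {r : ℝ} (hr : r ≠ 0) {x : E}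
    (hx : DifferentiableAt ℝ u (z + r • x)) :
    fderiv ℝ (blow u z r) x = r⁻¹ • (fderiv ℝ u (z + r • x) - fderiv ℝ u z) :=
  (hasFDerivAt_blow hr hx).fderiv

theorem C11.blow (h : C11 u K s) {r : ℝ} (hr : r ≠ 0) (z : E) :
    C11 (blow u z r) K ((fun y => z + r • y) ⁻¹' s) := by
  refine ⟨fun x hx => (hasFDerivAt_blow hr (h.diff _ hx)).differentiableAt, ?_⟩
  refine LipschitzOnWith.of_dist_le_mul fun x hx y hy => ?_
  rw [dist_eq_norm, fderiv_blow hr (h.diff _ hx), fderiv_blow hr (h.diff _ hy), ← smul_sub,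
    norm_smul, dist_eq_norm, sub_sub_sub_cancel_right, norm_inv]
  have := h.norm_sub_le hx hy
  rw [add_sub_add_left_eq_sub, ← smul_sub, norm_smul] at this
  have hr' : 0 < ‖r‖ := norm_pos_iff.2 hr
  rw [inv_mul_le_iff₀ hr']
  linarith

theorem hess_blow (h : C11 u K s) (hs : IsOpen s) {r : ℝ} (hr : r ≠ 0) {z x : E}
    (hx : z + r • x ∈ s) (hd : DifferentiableAt ℝ (fderiv ℝ u) (z + r • x)) :
    hess (EvansKrylov.blow u z r) x = hess u (z + r • x) ∧
      DifferentiableAt ℝ (fderiv ℝ (EvansKrylov.blow u z r)) x := by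
  have hev : fderiv ℝ (EvansKrylov.blow u z r) =ᶠ[𝓝 x]
      fun y => r⁻¹ • fderiv ℝ u (z + r • y) - r⁻¹ • fderiv ℝ u z := by
    have : ∀ᶠ y in 𝓝 x, z + r • y ∈ s :=
      (by fun_prop : ContinuousAt (fun y => z + r • y) x).eventually (hs.mem_nhds hx)
    filter_upwards [this] with y hy
    rw [fderiv_blow hr (h.diff _ hy), smul_sub]
  have hdd : DifferentiableAt ℝ (fun y => r⁻¹ • fderiv ℝ u (z + r • y)) x :=
    (differentiableAt_comp_affine hd).const_smul r⁻¹
  refine ⟨?_, (hdd.sub_const _).congr_of_eventuallyEq hev⟩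
  rw [hess, hev.fderiv_eq, fderiv_sub_const, fderiv_comp_affine', inv_mul_cancel₀ hr, one_smul,
    hess]

variable [BorelSpace E] [FiniteDimensional ℝ E] [μ.IsAddHaarMeasure]

theorem Sol.blow (h : Sol μ F P f K s u) {r : ℝ} (hr : r ≠ 0) (z : E) :
    Sol μ F P (fun x => f (z + r • x)) K ((fun y => z + r • y) ⁻¹' s) (blow u z r) := by
  refine ⟨h.isOpen.preimage (by fun_prop), h.c11.blow hr z, ?_⟩
  filter_upwards [ae_comp_affine μ h.ae hr z] with x hx hxs
  obtain ⟨h1, h2, h3⟩ := hx hxs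
  obtain ⟨h4, h5⟩ := hess_blow h.c11 h.isOpen hr hxs h1
  rw [h4]
  exact ⟨h5, h2, h3⟩

theorem ContDiff.symm_hess {φ : E → ℝ} (h : ContDiff ℝ 2 φ) (x : E) : Symm (hess φ x) := by
  obtain ⟨L, hL⟩ := ContDiff.exists_c11 h x 1
  exact hL.symm_hess (ball_mem_nhds x one_pos) (ContDiff.differentiable_fderiv h x)

theorem ContDiff.eventually_differentiableAt {φ : E → ℝ} (h : ContDiff ℝ 2 φ) (x : E) :
    ∀ᶠ y in 𝓝 x, DifferentiableAt ℝ φ y :=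
  .of_forall fun y => (h.differentiable two_ne_zero) y

theorem Sol.exists_touch_below (h : Sol μ F P f K s u) {φ : E → ℝ} (hφ : ContDiff ℝ 2 φ)
    {R a : ℝ} (hR : 0 < R) (hs : closedBall 0 R ⊆ s) (hb : ∀ x, ‖x‖ = R → a ≤ u x - φ x)
    {x₀ : E} (hx₀ : ‖x₀‖ < R) (ha : u x₀ - φ x₀ < a) :
    ∃ x ∈ ball (0 : E) R, P (hess u x) ∧ F (hess u x) = f x ∧ ‖hess u x‖ ≤ K ∧
      NonNeg (hess u x - hess φ x) := by
  obtain ⟨L, hL⟩ := ContDiff.exists_c11 hφ.neg (0 : E) R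
  have hbs : ball (0 : E) R ⊆ s := ball_subset_closedBall.trans hs
  have hw := (h.c11.mono hbs).add hL
  simp only [← sub_eq_add_neg] at hw
  have hsub : ∀ x ∈ ball (0 : E) R, DifferentiableAt ℝ (fderiv ℝ u) x →
      hess (fun y => u y - φ y) x = hess u x - hess φ x ∧
      DifferentiableAt ℝ (fderiv ℝ fun y => u y - φ y) x := fun x hx hd =>
    hess_sub (h.c11.eventually_differentiableAt (h.isOpen.mem_nhds (hbs hx)))
      (ContDiff.eventually_differentiableAt hφ x) hd (ContDiff.differentiable_fderiv hφ x)
  obtain ⟨x, hx, ⟨h1, h2, h3⟩, -, h4⟩ := exists_good_contact μ hR hw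
    ((h.c11.continuousOn.mono hs).sub hφ.continuous.continuousOn) hb hx₀ ha
    (h.ae.mono fun x hx hxb => hx (hbs hxb))
    (h.ae.mono fun x hx hxb => (hsub x hxb (hx (hbs hxb)).1).2)
  rw [(hsub x hx h1).1] at h4
  exact ⟨x, hx, h2, h3, h.c11.norm_hess_le (h.isOpen.mem_nhds (hbs hx)), h4⟩

theorem Sol.exists_touch_above (h : Sol μ F P f K s u) {φ : E → ℝ} (hφ : ContDiff ℝ 2 φ)
    {R a : ℝ} (hR : 0 < R) (hs : closedBall 0 R ⊆ s) (hb : ∀ x, ‖x‖ = R → a ≤ φ x - u x)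
    {x₀ : E} (hx₀ : ‖x₀‖ < R) (ha : φ x₀ - u x₀ < a) :
    ∃ x ∈ ball (0 : E) R, P (hess u x) ∧ F (hess u x) = f x ∧ ‖hess u x‖ ≤ K ∧
      NonNeg (hess φ x - hess u x) := by
  obtain ⟨L, hL⟩ := ContDiff.exists_c11 hφ (0 : E) R
  have hbs : ball (0 : E) R ⊆ s := ball_subset_closedBall.trans hs
  have hn : C11 (fun y => -u y) K (ball 0 R) := by
    refine ⟨fun x hx => (h.c11.diff x (hbs hx)).neg, ?_⟩
    have : fderiv ℝ (fun y => -u y) = fun y => -fderiv ℝ u y := by ext1 y; exact fderiv_fun_neg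
    rw [this]
    exact (h.c11.lip.mono hbs).neg
  have hw := hL.add hn
  simp only [← sub_eq_add_neg] at hw
  have hsub : ∀ x ∈ ball (0 : E) R, DifferentiableAt ℝ (fderiv ℝ u) x →
      hess (fun y => φ y - u y) x = hess φ x - hess u x ∧
      DifferentiableAt ℝ (fderiv ℝ fun y => φ y - u y) x := fun x hx hd =>
    hess_sub (ContDiff.eventually_differentiableAt hφ x)
      (h.c11.eventually_differentiableAt (h.isOpen.mem_nhds (hbs hx)))
      (ContDiff.differentiable_fderiv hφ x) hd
  obtain ⟨x, hx, ⟨h1, h2, h3⟩, -, h4⟩ := exists_good_contact μ hR hw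
    (hφ.continuous.continuousOn.sub (h.c11.continuousOn.mono hs)) hb hx₀ ha
    (h.ae.mono fun x hx hxb => hx (hbs hxb))
    (h.ae.mono fun x hx hxb => (hsub x hxb (hx (hbs hxb)).1).2)
  rw [(hsub x hx h1).1] at h4
  exact ⟨x, hx, h2, h3, h.c11.norm_hess_le (h.isOpen.mem_nhds (hbs hx)), h4⟩

end Solutions

section Compactness

variable {E : Type*} [NormedAddCommGroup E] [InnerProductSpace ℝ E]
  {K : ℝ≥0} {s : Set E} {u : E → ℝ}

theorem C11.abs_taylor_le (h : C11 u K s) (hs : Convex ℝ s) {x y : E} (hx : x ∈ s) (hy : y ∈ s) :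
    |u y - u x - fderiv ℝ u x (y - x)| ≤ K * ‖y - x‖ ^ 2 := by
  have hseg : segment ℝ x y ⊆ s := hs.segment_subset hx hy
  have := Convex.norm_image_sub_le_of_norm_hasFDerivWithin_le' (f := u) (f' := fderiv ℝ u)
    (φ := fderiv ℝ u x) (s := segment ℝ x y) (C := K * ‖y - x‖) (𝕜 := ℝ)
    (fun z hz => (h.diff z (hseg hz)).hasFDerivAt.hasFDerivWithinAt) (fun z hz => by
      refine (h.norm_sub_le (hseg hz) hx).trans ?_
      gcongr
      exact norm_sub_le_of_mem_segment hz) (convex_segment x y) (left_mem_segment ℝ x y)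
      (right_mem_segment ℝ x y)
  rw [Real.norm_eq_abs] at this
  linarith

theorem LipschitzOnWith.of_tendsto {ι F : Type*} [PseudoMetricSpace F] {l : Filter ι} [l.NeBot]
    {g : ι → E → F} {G : E → F} (hg : ∀ᶠ j in l, LipschitzOnWith K (g j) s)
    (hlim : ∀ x ∈ s, Tendsto (fun j => g j x) l (𝓝 (G x))) : LipschitzOnWith K G s :=
  LipschitzOnWith.of_dist_le_mul fun x hx y hy =>
    le_of_tendsto ((hlim x hx).dist (hlim y hy)) (hg.mono fun _ h => h.dist_le_mul x hx y hy)

theorem eventually_dist_le_of_lipschitzOnWith {ι F : Type*} [PseudoMetricSpace F] {l : Filter ι}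
    [l.NeBot] (hs : IsCompact s) {g : ι → E → F} {G : E → F}
    (hg : ∀ᶠ j in l, LipschitzOnWith K (g j) s)
    (hlim : ∀ x ∈ s, Tendsto (fun j => g j x) l (𝓝 (G x))) {ε : ℝ} (hε : 0 < ε) :
    ∀ᶠ j in l, ∀ x ∈ s, dist (g j x) (G x) ≤ ε := by
  have hG := LipschitzOnWith.of_tendsto hg hlim
  obtain ⟨t, hts, htf, hcov⟩ := hs.finite_cover_balls (e := ε / (3 * (K + 1))) (by positivity)
  have h1 : ∀ᶠ j in l, ∀ y ∈ t, dist (g j y) (G y) < ε / 3 :=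
    (eventually_all_finite htf).2 fun y hy =>
      (hlim y (hts hy)).eventually (ball_mem_nhds _ (by positivity))
  filter_upwards [hg, h1] with j hj h1 x hx
  obtain ⟨y, hy, hxy⟩ := mem_iUnion₂.1 (hcov hx)
  have hxy : dist x y ≤ ε / (3 * (K + 1)) := (mem_ball.1 hxy).le
  have hK : (K : ℝ) * dist x y ≤ ε / 3 := by
    calc (K : ℝ) * dist x y ≤ (K + 1) * (ε / (3 * (K + 1))) := by gcongr; linarith
      _ = ε / 3 := by field_simp
  have h2 := hj.dist_le_mul x hx y (hts hy)
  have h3 := hG.dist_le_mul x hx y (hts hy)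
  have h4 := dist_triangle4 (g j x) (g j y) (G y) (G x)
  have h5 := h1 y hy
  rw [dist_comm (G y)] at h4
  linarith

theorem Ultrafilter.exists_tendsto_of_bounded {ι F : Type*} [NormedAddCommGroup F] [ProperSpace F]
    (l : Ultrafilter ι) {g : ι → F} {C : ℝ} (hg : ∀ᶠ j in l, ‖g j‖ ≤ C) :
    ∃ a, ‖a‖ ≤ C ∧ Tendsto g l (𝓝 a) := by
  obtain ⟨a, ha, hla⟩ := (isCompact_closedBall (0 : F) C).ultrafilter_le_nhds (l.map g) (by
    rw [le_principal_iff]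
    exact hg.mono fun j hj => by simpa using hj)
  exact ⟨a, by simpa using ha, hla⟩

theorem C11.lipschitzOnWith {R : ℝ} (hR : 0 ≤ R) (h : C11 u K (ball 0 R)) {r : ℝ} (hr : r < R)
    (h1 : fderiv ℝ u 0 = 0) : LipschitzOnWith (K * R.toNNReal) u (closedBall 0 r) := by
  have hsub : closedBall (0 : E) r ⊆ ball 0 R := closedBall_subset_ball hr
  refine Convex.lipschitzOnWith_of_nnnorm_fderiv_le (𝕜 := ℝ) (fun x hx => h.diff x (hsub hx))
    (fun x hx => ?_) (convex_closedBall _ _)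
  have hx' := hsub hx
  have h0 : (0 : E) ∈ ball (0 : E) R := mem_ball_self ((norm_nonneg x).trans_lt
    (by simpa using hx'))
  have := h.norm_sub_le hx' h0
  rw [h1, sub_zero, sub_zero] at this
  rw [← NNReal.coe_le_coe]
  push_cast
  rw [Real.coe_toNNReal R hR]
  refine this.trans ?_
  gcongr
  exact (mem_ball_zero_iff.1 hx').le

theorem exists_limit [FiniteDimensional ℝ E] {ι : Type*} (l : Ultrafilter ι) {u : ι → E → ℝ}
    (h : ∀ R, ∀ᶠ j in l, C11 (u j) K (ball 0 R)) (h0 : ∀ j, u j 0 = 0)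
    (h1 : ∀ j, fderiv ℝ (u j) 0 = 0) :
    ∃ U : E → ℝ, C11 U K univ ∧ U 0 = 0 ∧ fderiv ℝ U 0 = 0 ∧
      ∀ R, ∀ ε > 0, ∀ᶠ j in l, ∀ x ∈ closedBall (0 : E) R,
        |u j x - U x| ≤ ε ∧ ‖fderiv ℝ (u j) x - fderiv ℝ U x‖ ≤ ε := by
  have hmem : ∀ x : E, x ∈ ball (0 : E) (‖x‖ + 1) := fun x => by simp
  have hmem0 : ∀ x : E, (0 : E) ∈ ball (0 : E) (‖x‖ + 1) := fun x => by
    simp; positivity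
  have hG : ∀ x : E, ∃ a : E →L[ℝ] ℝ, ‖a‖ ≤ K * ‖x‖ ∧
      Tendsto (fun j => fderiv ℝ (u j) x) l (𝓝 a) := fun x =>
    Ultrafilter.exists_tendsto_of_bounded l ((h (‖x‖ + 1)).mono fun j hj => by
      have := hj.norm_sub_le (hmem x) (hmem0 x)
      simpa [h1] using this)
  have hU : ∀ x : E, ∃ a : ℝ, ‖a‖ ≤ K * ‖x‖ ^ 2 ∧ Tendsto (fun j => u j x) l (𝓝 a) := fun x =>
    Ultrafilter.exists_tendsto_of_bounded l ((h (‖x‖ + 1)).mono fun j hj => by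
      have := hj.abs_taylor_le (convex_ball _ _) (hmem0 x) (hmem x)
      simpa [h0, h1] using this)
  choose G hG0 hG using hG
  choose U hU0 hU using hU
  have hGL : ∀ R, LipschitzOnWith K G (ball 0 R) := fun R =>
    LipschitzOnWith.of_tendsto ((h R).mono fun j hj => hj.lip) fun x _ => hG x
  have hT : ∀ x y, |U y - U x - G x (y - x)| ≤ K * ‖y - x‖ ^ 2 := fun x y => by
    refine le_of_tendsto (((hU y).sub (hU x)).sub
      (((ContinuousLinearMap.apply ℝ ℝ (y - x)).continuous.tendsto _).comp (hG x))).abs ?_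
    refine (h (max ‖x‖ ‖y‖ + 1)).mono fun j hj => ?_
    refine hj.abs_taylor_le (convex_ball _ _) ?_ ?_
    · simpa using (le_max_left ‖x‖ ‖y‖).trans_lt (lt_add_one _)
    · simpa using (le_max_right ‖x‖ ‖y‖).trans_lt (lt_add_one _)
  have hD : ∀ x, HasFDerivAt U (G x) x := fun x => by
    rw [hasFDerivAt_iff_isLittleO]
    refine Asymptotics.IsBigO.trans_isLittleO (g := fun y => ‖y - x‖ ^ 2)
      (Asymptotics.IsBigO.of_bound K (.of_forall fun y => ?_)) ?_
    · simpa using hT x y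
    · exact Asymptotics.isLittleO_pow_sub_sub x one_lt_two
  have hDG : fderiv ℝ U = G := funext fun x => (hD x).fderiv
  refine ⟨U, ⟨fun x _ => (hD x).differentiableAt, ?_⟩, ?_, ?_, ?_⟩
  · rw [hDG]
    refine LipschitzOnWith.of_dist_le_mul fun x _ y _ => ?_
    exact (hGL (max ‖x‖ ‖y‖ + 1)).dist_le_mul x
      (by simpa using (le_max_left ‖x‖ ‖y‖).trans_lt (lt_add_one _)) y
      (by simpa using (le_max_right ‖x‖ ‖y‖).trans_lt (lt_add_one _))
  · simpa using hU0 0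
  · rw [hDG]; simpa using hG0 0
  · intro R ε hε
    have e1 := eventually_dist_le_of_lipschitzOnWith (l := (l : Filter ι)) (G := G)
      (isCompact_closedBall (0 : E) R)
      ((h (R + 1)).mono fun j hj => hj.lip.mono (closedBall_subset_ball (lt_add_one R)))
      (fun x _ => hG x) hε
    have e2 := eventually_dist_le_of_lipschitzOnWith (l := (l : Filter ι)) (G := U)
      (isCompact_closedBall (0 : E) R)
      ((h (max R 0 + 1)).mono fun j hj => hj.lipschitzOnWith (by positivity)
        ((le_max_left R 0).trans_lt (lt_add_one _)) (h1 j))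
      (fun x _ => hU x) hε
    filter_upwards [e1, e2] with j e1 e2 x hx
    rw [hDG, ← Real.dist_eq, ← dist_eq_norm]
    exact ⟨e2 x hx, e1 x hx⟩

end Compactness

section Stability

variable {E : Type*} [NormedAddCommGroup E] [InnerProductSpace ℝ E]

/-- The quadratic polynomial with prescribed second order jet at the origin. -/
def quad (a : ℝ) (p : E →L[ℝ] ℝ) (Q : Bil E) (y : E) : ℝ := a + p y + 1 / 2 * Q y y

theorem hasFDerivAt_quad (a : ℝ) (p : E →L[ℝ] ℝ) {Q : Bil E} (hQ : Symm Q) (y : E) :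
    HasFDerivAt (quad a p Q) (p + Q y) y := by
  have h1 := ((Q.hasFDerivAt (x := y)).clm_apply (hasFDerivAt_id y)).const_mul (1 / 2 : ℝ)
  have h2 := ((p.hasFDerivAt (x := y)).const_add a).add h1
  refine h2.congr_fderiv ?_
  ext w
  simp [hQ w y]
  ring

theorem hess_quad (a : ℝ) (p : E →L[ℝ] ℝ) {Q : Bil E} (hQ : Symm Q) (y : E) :
    hess (quad a p Q) y = Q := by
  have : fderiv ℝ (quad a p Q) = fun y => p + Q y := funext fun y => (hasFDerivAt_quad a p hQ y).fderiv
  rw [hess, this, fderiv_const_add, Q.fderiv]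

theorem contDiff_quad (a : ℝ) (p : E →L[ℝ] ℝ) (Q : Bil E) {n : WithTop ℕ∞} :
    ContDiff ℝ n (quad a p Q) := by
  unfold quad
  exact (contDiff_const.add p.contDiff).add
    (contDiff_const.mul (Q.contDiff.clm_apply contDiff_id))

theorem exists_abs_sub_quad_le {U : E → ℝ} {K : ℝ≥0} {s : Set E} (hU : C11 U K s) (hs : s ∈ 𝓝 0)
    (hd : DifferentiableAt ℝ (fderiv ℝ U) 0) {ε : ℝ} (hε : 0 < ε) :
    ∃ r > 0, ∀ y ∈ closedBall (0 : E) r,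
      |U y - quad (U 0) (fderiv ℝ U 0) (hess U 0) y| ≤ ε * ‖y‖ ^ 2 := by
  have hsym := hU.symm_hess hs hd
  have h1 : ∀ᶠ y in 𝓝 (0 : E), ‖fderiv ℝ U y - fderiv ℝ U 0 - hess U 0 y‖ ≤ ε * ‖y‖ := by
    have := hd.hasFDerivAt.isLittleO.bound hε
    simpa [hess] using this
  obtain ⟨r, hr, hball⟩ := Metric.eventually_nhds_iff_ball.1 (h1.and hs)
  refine ⟨r / 2, by positivity, fun y hy => ?_⟩
  have hmem : ∀ z, ‖z‖ ≤ ‖y‖ → z ∈ ball (0 : E) r := fun z hz => by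
    simp at hy ⊢; linarith
  have hcl : ∀ z ∈ closedBall (0 : E) ‖y‖, HasFDerivWithinAt
      (fun z => U z - quad (U 0) (fderiv ℝ U 0) (hess U 0) z)
      (fderiv ℝ U z - (fderiv ℝ U 0 + hess U 0 z)) (closedBall 0 ‖y‖) z := fun z hz =>
    ((hU.diff z (hball z (hmem z (by simpa using hz))).2).hasFDerivAt.sub
      (hasFDerivAt_quad _ _ hsym z)).hasFDerivWithinAt
  have := Convex.norm_image_sub_le_of_norm_hasFDerivWithin_le (𝕜 := ℝ) (C := ε * ‖y‖) hcl
    (fun z hz => by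
      have hz' : ‖z‖ ≤ ‖y‖ := by simpa using hz
      rw [← sub_sub]
      refine (hball z (hmem z hz')).1.trans ?_
      gcongr) (convex_closedBall _ _) (mem_closedBall_self (norm_nonneg y))
    (y := y) (by simp)
  simp only [Real.norm_eq_abs, sub_zero] at this
  calc _ = |U y - quad (U 0) (fderiv ℝ U 0) (hess U 0) y -
        (U 0 - quad (U 0) (fderiv ℝ U 0) (hess U 0) 0)| := by simp [quad]
    _ ≤ _ := this
    _ = _ := by ring

theorem fderiv_comp_add (v : E → ℝ) (z : E) :
    fderiv ℝ (fun x => v (z + x)) = fun x => fderiv ℝ v (z + x) :=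
  funext fun _ => fderiv_comp_add_left z

theorem hess_comp_add (v : E → ℝ) (z x : E) :
    hess (fun x => v (z + x)) x = hess v (z + x) := by
  rw [hess, fderiv_comp_add, fderiv_comp_add_left, hess]

theorem differentiableAt_comp_add {G : Type*} [NormedAddCommGroup G] [NormedSpace ℝ G]
    {v : E → G} {z x : E} (h : DifferentiableAt ℝ v (z + x)) :
    DifferentiableAt ℝ (fun x => v (z + x)) x :=
  h.comp (f := fun y => z + y) x (by fun_prop)

theorem C11.comp_add {v : E → ℝ} {K : ℝ≥0} {s : Set E} (h : C11 v K s) (z : E) :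
    C11 (fun x => v (z + x)) K ((fun x => z + x) ⁻¹' s) := by
  refine ⟨fun x hx => differentiableAt_comp_add (h.diff _ hx), ?_⟩
  rw [fderiv_comp_add]
  exact LipschitzOnWith.of_dist_le_mul fun x hx y hy => by
    simpa using h.lip.dist_le_mul _ hx _ hy

variable [MeasurableSpace E] [BorelSpace E] [FiniteDimensional ℝ E] {μ : Measure E}
  [μ.IsAddHaarMeasure] {F : Bil E → ℝ} {P : Bil E → Prop} {K : ℝ≥0} {ι : Type*}

theorem quad_add_idForm (a : ℝ) (p : E →L[ℝ] ℝ) (Q : Bil E) (ε : ℝ) (y : E) :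
    quad a p (Q + ε • idForm E) y = quad a p Q y + ε / 2 * ‖y‖ ^ 2 := by
  simp [quad, idForm_apply]
  ring

theorem Elliptic.stability_zero (hE : Elliptic F P) {l : Filter ι} [l.NeBot] {u f : ι → E → ℝ}
    {f₀ R : ℝ} (hf₀ : 0 < f₀) (hR : 0 < R) (h : ∀ᶠ j in l, Sol μ F P (f j) K (ball 0 R) (u j))
    (hf : ∀ ε > 0, ∀ᶠ j in l, ∀ x ∈ ball 0 R, |f j x - f₀| ≤ ε) {U : E → ℝ}
    (hU : C11 U K (ball 0 R))
    (hlim : ∀ ε > 0, ∀ᶠ j in l, ∀ x ∈ ball (0 : E) R, |u j x - U x| ≤ ε)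
    (hd : DifferentiableAt ℝ (fderiv ℝ U) 0) : P (hess U 0) ∧ F (hess U 0) = f₀ := by
  have hn : ball (0 : E) R ∈ 𝓝 0 := ball_mem_nhds _ hR
  have hsym := hU.symm_hess hn hd
  set Q := hess U 0 with hQ
  have key : ∀ ε > 0, ∃ r > 0, r < R ∧ ∃ η > 0, η < ε * r ^ 2 / 15 ∧ ∃ j,
      Sol μ F P (f j) K (ball 0 R) (u j) ∧ (∀ x ∈ ball 0 R, |f j x - f₀| ≤ ε) ∧
      ∀ x ∈ closedBall (0 : E) r, |u j x - quad (U 0) (fderiv ℝ U 0) Q x| ≤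
        ε / 8 * ‖x‖ ^ 2 + η := by
    intro ε hε
    obtain ⟨r, hr, hTay⟩ := exists_abs_sub_quad_le hU hn hd (ε := ε / 8) (by positivity)
    set r' := min r (R / 2) with hr'
    have hr'0 : 0 < r' := by positivity
    have hr'R : r' < R := (min_le_right _ _).trans_lt (by linarith)
    obtain ⟨j, h1, h2, h3⟩ := (h.and ((hf ε hε).and
      (hlim (ε * r' ^ 2 / 16) (by positivity)))).exists
    refine ⟨r', hr'0, hr'R, ε * r' ^ 2 / 16, by positivity, ?_, j, h1, h2, fun x hx => ?_⟩
    · have : 0 < ε * r' ^ 2 := by positivity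
      linarith
    · have e1 := h3 x (closedBall_subset_ball hr'R hx)
      have e2 := hTay x (closedBall_subset_closedBall (min_le_left _ _) hx)
      have := abs_sub_le (u j x) (U x) (quad (U 0) (fderiv ℝ U 0) Q x)
      linarith
  refine hE.mem_of_pinched (K := K) hf₀ hsym (fun ε hε => ?_) (fun ε hε => ?_)
  · obtain ⟨r, hr, hrR, η, hη, hηr, j, hS, hfj, hu⟩ := key ε hε
    have hs' : Symm (Q + ε • idForm E) := hsym.add (symm_idForm.smul ε)
    obtain ⟨x, hx, h1, h2, h3, h4⟩ := hS.exists_touch_above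
      (φ := quad (U 0) (fderiv ℝ U 0) (Q + ε • idForm E)) (contDiff_quad _ _ _) hr
      (closedBall_subset_ball hrR) (a := 3 * ε * r ^ 2 / 10) (x₀ := 0) (fun x hx => by
        have := abs_le.1 (hu x (by simp [hx]))
        rw [quad_add_idForm, hx] at *
        nlinarith [this.1, this.2]) (by simpa using hr) (by
        have := abs_le.1 (hu 0 (by simp [hr.le]))
        rw [quad_add_idForm]
        simp only [norm_zero] at *
        nlinarith [this.1, this.2, mul_pos hε (pow_pos hr 2)])
    rw [hess_quad _ _ hs'] at h4
    exact ⟨_, h1, h3, by rw [h2]; exact hfj x (ball_subset_ball hrR.le hx), h4⟩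
  · obtain ⟨r, hr, hrR, η, hη, hηr, j, hS, hfj, hu⟩ := key ε hε
    have hs' : Symm (Q + (-ε) • idForm E) := hsym.add (symm_idForm.smul _)
    obtain ⟨x, hx, h1, h2, h3, h4⟩ := hS.exists_touch_below
      (φ := quad (U 0) (fderiv ℝ U 0) (Q + (-ε) • idForm E)) (contDiff_quad _ _ _) hr
      (closedBall_subset_ball hrR) (a := 3 * ε * r ^ 2 / 10) (x₀ := 0) (fun x hx => by
        have := abs_le.1 (hu x (by simp [hx]))
        rw [quad_add_idForm, hx] at *
        nlinarith [this.1, this.2]) (by simpa using hr) (by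
        have := abs_le.1 (hu 0 (by simp [hr.le]))
        rw [quad_add_idForm]
        simp only [norm_zero] at *
        nlinarith [this.1, this.2, mul_pos hε (pow_pos hr 2)])
    rw [hess_quad _ _ hs', neg_smul, ← sub_eq_add_neg] at h4
    exact ⟨_, h1, h3, by rw [h2]; exact hfj x (ball_subset_ball hrR.le hx), h4⟩

theorem Sol.comp_add {v f : E → ℝ} {s : Set E} (h : Sol μ F P f K s v) (z : E) :
    Sol μ F P (fun x => f (z + x)) K ((fun x => z + x) ⁻¹' s) (fun x => v (z + x)) := by
  refine ⟨h.isOpen.preimage (by fun_prop), h.c11.comp_add z, ?_⟩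
  filter_upwards [(quasiMeasurePreserving_add_left μ z).ae h.ae] with x hx hxs
  rw [hess_comp_add, fderiv_comp_add]
  exact ⟨differentiableAt_comp_add (hx hxs).1, (hx hxs).2⟩

theorem Elliptic.stability (hE : Elliptic F P) {l : Filter ι} [l.NeBot] {u f : ι → E → ℝ}
    {f₀ : ℝ} (hf₀ : 0 < f₀) (h : ∀ R, ∀ᶠ j in l, Sol μ F P (f j) K (ball 0 R) (u j))
    (hf : ∀ R, ∀ ε > 0, ∀ᶠ j in l, ∀ x ∈ ball 0 R, |f j x - f₀| ≤ ε) {U : E → ℝ}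
    (hU : C11 U K univ)
    (hlim : ∀ R, ∀ ε > 0, ∀ᶠ j in l, ∀ x ∈ closedBall (0 : E) R, |u j x - U x| ≤ ε) :
    Sol μ F P (fun _ => f₀) K univ U := by
  refine ⟨isOpen_univ, hU, ?_⟩
  have hL : LipschitzWith K (fderiv ℝ U) := lipschitzOnWith_univ.1 hU.lip
  filter_upwards [hL.ae_differentiableAt (μ := μ)] with z hz _
  refine ⟨hz, ?_⟩
  have hsub : ball (0 : E) 1 ⊆ (fun x => z + x) ⁻¹' ball 0 (‖z‖ + 1) := fun x hx => by
    have := norm_add_le z x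
    have := mem_ball_zero_iff.1 hx
    exact mem_ball_zero_iff.2 (by linarith)
  have := hE.stability_zero (μ := μ) (l := l) (u := fun j x => u j (z + x))
    (f := fun j x => f j (z + x)) (U := fun x => U (z + x)) hf₀ one_pos
    ((h (‖z‖ + 1)).mono fun j hj => (hj.comp_add z).mono isOpen_ball hsub)
    (fun ε hε => (hf (‖z‖ + 1) ε hε).mono fun j hj x hx => hj _ (hsub hx))
    ((hU.comp_add z).mono (by simp))
    (fun ε hε => (hlim (‖z‖ + 1) ε hε).mono fun j hj x hx => hj _
      (ball_subset_closedBall (hsub hx)))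
    (by rw [fderiv_comp_add]; exact differentiableAt_comp_add (by simpa using hz))
  simpa [hess_comp_add] using this

end Stability

section Rigidity

variable {E : Type*} [NormedAddCommGroup E] [InnerProductSpace ℝ E]
  [MeasurableSpace E] [BorelSpace E] [FiniteDimensional ℝ E] (μ : Measure E)
  [μ.IsAddHaarMeasure]

theorem LipschitzWith.eq_of_ae_fderiv_eq_zero {V : Type*} [NormedAddCommGroup V] [NormedSpace ℝ V]
    [FiniteDimensional ℝ V] {G : E → V} {K : ℝ≥0} (hG : LipschitzWith K G)
    (h : ∀ᵐ x ∂μ, fderiv ℝ G x = 0) (a b : E) : G a = G b := by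
  have hc := hG.continuous
  have hz : ∀ᵐ x ∂μ, HasFDerivAt G (0 : E →L[ℝ] V) x := by
    filter_upwards [h, hG.ae_differentiableAt (μ := μ)] with x h1 h2
    rw [← h1]; exact h2.hasFDerivAt
  have hconst : ∀ r : ℝ, ∫ y in ball (0 : E) r, G (a + y) ∂μ = ∫ y in ball (0 : E) r, G (b + y) ∂μ := by
    intro r
    have hint : ∀ x, IntegrableOn (fun y => G (x + y)) (ball 0 r) μ := fun x =>
      ((by fun_prop : Continuous fun y => G (x + y)).continuousOn.integrableOn_compact
        (isCompact_closedBall 0 r)).mono_set ball_subset_closedBall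
    have hD : ∀ x, HasFDerivAt (fun x => ∫ y in ball (0 : E) r, G (x + y) ∂μ)
        (0 : E →L[ℝ] V) x := fun x => by
      have := hasFDerivAt_integral_of_dominated_loc_of_lip (𝕜 := ℝ)
        (μ := μ.restrict (ball 0 r)) (F := fun x y => G (x + y)) (x₀ := x)
        (F' := fun _ => (0 : E →L[ℝ] V)) (bound := fun _ => (K : ℝ)) (s := univ) univ_mem
        (.of_forall fun x => (hint x).aestronglyMeasurable) (hint x)
        aestronglyMeasurable_const
        (.of_forall fun y => ?_) ?_ ?_
      · simpa using this.2
      · rw [lipschitzOnWith_univ]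
        refine LipschitzWith.of_dist_le_mul fun p q => ?_
        have := hG.dist_le_mul (p + y) (q + y)
        simpa using this
      · exact integrableOn_const (measure_ball_lt_top.ne)
      · refine ae_restrict_of_ae ?_
        filter_upwards [(quasiMeasurePreserving_add_left μ x).ae hz] with y hy
        have h1 : HasFDerivAt (fun x : E => x + y) (ContinuousLinearMap.id ℝ E) x :=
          (hasFDerivAt_id x).add_const y
        simpa [Function.comp_def] using HasFDerivAt.comp x hy h1
    exact is_const_of_fderiv_eq_zero (𝕜 := ℝ) (fun x => (hD x).differentiableAt)
      (fun x => (hD x).fderiv) a b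
  have hle : ∀ r > 0, ‖G a - G b‖ ≤ 2 * K * r := by
    intro r hr
    have hint : ∀ x, IntegrableOn (fun y => G (x + y)) (ball 0 r) μ := fun x =>
      ((by fun_prop : Continuous fun y => G (x + y)).continuousOn.integrableOn_compact
        (isCompact_closedBall 0 r)).mono_set ball_subset_closedBall
    have hic : ∀ v : V, IntegrableOn (fun _ : E => v) (ball 0 r) μ := fun v =>
      integrableOn_const (measure_ball_lt_top.ne)
    have e1 : ∫ y in ball (0 : E) r, ((G a - G (a + y)) - (G b - G (b + y))) ∂μ =
        μ.real (ball 0 r) • (G a - G b) := by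
      have ha : IntegrableOn (fun y => G a - G (a + y)) (ball 0 r) μ := (hic _).sub (hint a)
      have hb : IntegrableOn (fun y => G b - G (b + y)) (ball 0 r) μ := (hic _).sub (hint b)
      rw [integral_sub ha hb, integral_sub (hic _) (hint a), integral_sub (hic _) (hint b),
        hconst r]
      simp [smul_sub]
    have e2 : ‖∫ y in ball (0 : E) r, ((G a - G (a + y)) - (G b - G (b + y))) ∂μ‖ ≤
        2 * K * r * μ.real (ball 0 r) := by
      refine norm_setIntegral_le_of_norm_le_const measure_ball_lt_top fun y hy => ?_
      have hy' : ‖y‖ ≤ r := (mem_ball_zero_iff.1 hy).le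
      have h1 := hG.dist_le_mul a (a + y)
      have h2 := hG.dist_le_mul b (b + y)
      rw [dist_eq_norm, dist_self_add_right] at h1 h2
      have h3 : (K : ℝ) * ‖y‖ ≤ K * r := by gcongr
      calc _ ≤ ‖G a - G (a + y)‖ + ‖G b - G (b + y)‖ := norm_sub_le _ _
        _ ≤ _ := by linarith
    have hpos : 0 < μ.real (ball (0 : E) r) :=
      ENNReal.toReal_pos (measure_ball_pos μ 0 hr).ne' measure_ball_lt_top.ne
    rw [e1, norm_smul, Real.norm_of_nonneg hpos.le, mul_comm] at e2
    exact le_of_mul_le_mul_right e2 hpos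
  refine sub_eq_zero.1 (norm_le_zero_iff.1 (le_of_forall_pos_le_add fun ε hε => ?_))
  have := hle (ε / (2 * K + 1)) (by positivity)
  refine this.trans ?_
  rw [zero_add, mul_div_assoc', div_le_iff₀ (by positivity)]
  nlinarith

end Rigidity

section SecondDifference

variable {E : Type*} [NormedAddCommGroup E] [InnerProductSpace ℝ E]

/-- Symmetric second difference. -/
def sd (U : E → ℝ) (e x : E) : ℝ := U (x + e) + U (x - e) - 2 * U x

theorem sd_two_mul (U : E → ℝ) (e x : E) :
    sd U ((2 : ℝ) • e) x = sd U e (x + e) + sd U e (x - e) + 2 * sd U e x := by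
  simp only [sd, two_smul, add_sub_cancel_right, sub_add_cancel, ← add_assoc, sub_sub]
  ring

theorem C11.abs_sd_le {U : E → ℝ} {K : ℝ≥0} (hU : C11 U K univ) (e x : E) :
    |sd U e x| ≤ 2 * K * ‖e‖ ^ 2 := by
  have h1 := abs_le.1 (hU.abs_taylor_le convex_univ (mem_univ x) (mem_univ (x + e)))
  have h2 := abs_le.1 (hU.abs_taylor_le convex_univ (mem_univ x) (mem_univ (x - e)))
  simp only [add_sub_cancel_left, sub_sub_cancel_left, norm_neg, map_neg] at h1 h2
  rw [sd, abs_le]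
  constructor <;> linarith [h1.1, h1.2, h2.1, h2.2]

theorem exists_abs_sd_sub_le {U : E → ℝ} {K : ℝ≥0} {s : Set E} (hU : C11 U K s) {x : E} (hs : s ∈ 𝓝 x)
    (hd : DifferentiableAt ℝ (fderiv ℝ U) x) (e : E) {ε : ℝ} (hε : 0 < ε) :
    ∃ r > 0, ∀ t, 0 < t → t ≤ r → |sd U (t • e) x - t ^ 2 * hess U x e e| ≤ ε * t ^ 2 := by
  obtain ⟨r, hr, h⟩ := exists_abs_sub_quad_le (ε := ε / (2 * (‖e‖ ^ 2 + 1)))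
    (hU.comp_add x) ((continuous_const_add x).continuousAt.preimage_mem_nhds (by simpa using hs))
    (by rw [fderiv_comp_add]; exact differentiableAt_comp_add (by simpa using hd)) (by positivity)
  refine ⟨r / (‖e‖ + 1), by positivity, fun t ht htr => ?_⟩
  have hte : ‖t • e‖ ≤ r := by
    rw [norm_smul, Real.norm_of_nonneg ht.le]
    rw [le_div_iff₀ (by positivity)] at htr
    nlinarith
  have h1 := abs_le.1 (h (t • e) (by simpa using hte))
  have h2 := abs_le.1 (h (-(t • e)) (by simpa using hte))
  have hn : ε / (2 * (‖e‖ ^ 2 + 1)) * ‖t • e‖ ^ 2 ≤ ε / 2 * t ^ 2 := by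
    rw [norm_smul, Real.norm_of_nonneg ht.le, mul_pow, div_mul_eq_mul_div,
      div_le_iff₀ (by positivity)]
    nlinarith [mul_pos hε (pow_pos ht 2)]
  simp only [quad, hess_comp_add, add_zero, norm_neg, map_neg, map_smul, smul_eq_mul,
    ← sub_eq_add_neg, neg_apply, smul_apply] at h1 h2
  rw [sd, abs_le]
  constructor <;> linarith [h1.1, h1.2, h2.1, h2.2]

end SecondDifference

section Liouville

variable {E : Type*} [NormedAddCommGroup E] [InnerProductSpace ℝ E]
  [MeasurableSpace E] [BorelSpace E] [FiniteDimensional ℝ E] {μ : Measure E}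
  [μ.IsAddHaarMeasure] {F : Bil E → ℝ} {P : Bil E → Prop} {K : ℝ≥0}

theorem Super.exists_density [Nontrivial E] {c C : ℝ} (hc : 0 < c) (hC : 0 < C) {v : E → ℝ}
    (hv : Super μ c C v) (h0 : ∀ x, 0 ≤ v x) (hinf : ∀ ε > 0, ∃ x, v x < ε) {η θ : ℝ}
    (hη : 0 < η) (hθ : 0 < θ) : ∃ R₀ > 0, ∀ R ≥ R₀,
      μ ({x | η ≤ v x} ∩ closedBall 0 R) ≤ ENNReal.ofReal θ * μ (closedBall 0 R) := by
  obtain ⟨η', hη', hWH⟩ := exists_weakHarnack μ hc hC hθ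
  obtain ⟨x₀, hx₀⟩ := hinf (η * η') (by positivity)
  refine ⟨max ‖x₀‖ 1, by positivity, fun R hR => ?_⟩
  have hR1 : 0 < R := lt_of_lt_of_le (by positivity) hR
  by_contra! hcon
  have key := hWH (fun y => η⁻¹ * v (0 + R • y))
    (hv.comp_affine (by positivity) hR1.ne' 0) (fun x => mul_nonneg (by positivity) (h0 _)) (by
      have e1 : closedBall (0 : E) 1 = (fun y => (0 : E) + R • y) ⁻¹' closedBall 0 R := by
        have := preimage_affine_closedBall hR1 (0 : E) 1
        rw [← this, mul_one]
      have e2 : {x | 1 ≤ η⁻¹ * v (0 + R • x)} = (fun y => (0 : E) + R • y) ⁻¹' {x | η ≤ v x} := by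
        ext x
        simp only [mem_ofPred_eq, mem_preimage]
        rw [inv_mul_eq_div, one_le_div hη]
      rw [e1, e2, ← preimage_inter, measure_preimage_affine μ hR1, measure_preimage_affine μ hR1,
        mul_left_comm]
      gcongr)
  have := key (R⁻¹ • x₀) (by
    rw [mem_closedBall_zero_iff, norm_smul, norm_inv, Real.norm_of_nonneg hR1.le,
      inv_mul_le_iff₀ hR1, mul_one]
    exact (le_max_left _ _).trans hR)
  rw [zero_add, smul_inv_smul₀ hR1.ne', inv_mul_eq_div, lt_div_iff₀ hη] at this
  linarith

theorem Super.exists_lintegral_le [Nontrivial E] {c C : ℝ} (hc : 0 < c) (hC : 0 < C) {v : E → ℝ}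
    (hv : Super μ c C v) (h0 : ∀ x, 0 ≤ v x) (hinf : ∀ ε > 0, ∃ x, v x < ε) {M : ℝ}
    (hM : ∀ x, v x ≤ M) {ε : ℝ} (hε : 0 < ε) : ∃ R₀ > 0, ∀ R ≥ R₀,
      ∫⁻ x in closedBall 0 R, ENNReal.ofReal (v x) ∂μ ≤ ENNReal.ofReal ε * μ (closedBall 0 R) := by
  have hM0 : 0 ≤ M := (h0 0).trans (hM 0)
  obtain ⟨R₀, hR₀, h⟩ := hv.exists_density hc hC h0 hinf (η := ε / 2) (θ := ε / (2 * (M + 1)))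
    (by positivity) (by positivity)
  refine ⟨R₀, hR₀, fun R hR => ?_⟩
  have hm : MeasurableSet {x | ε / 2 ≤ v x} :=
    measurableSet_le measurable_const hv.continuous.measurable
  calc ∫⁻ x in closedBall 0 R, ENNReal.ofReal (v x) ∂μ
      ≤ ∫⁻ x in closedBall 0 R, (ENNReal.ofReal (ε / 2) +
          {x | ε / 2 ≤ v x}.indicator (fun _ => ENNReal.ofReal M) x) ∂μ := by
        refine lintegral_mono fun x => ?_
        by_cases hx : ε / 2 ≤ v x
        · rw [indicator_of_mem (show x ∈ {x | ε / 2 ≤ v x} from hx)]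
          exact (ENNReal.ofReal_le_ofReal (hM x)).trans le_add_self
        · exact (ENNReal.ofReal_le_ofReal (not_le.1 hx).le).trans le_self_add
    _ = ENNReal.ofReal (ε / 2) * μ (closedBall 0 R) +
          ENNReal.ofReal M * μ ({x | ε / 2 ≤ v x} ∩ closedBall 0 R) := by
        rw [lintegral_add_left measurable_const, setLIntegral_const, lintegral_indicator_const hm,
          Measure.restrict_apply hm]
    _ ≤ ENNReal.ofReal (ε / 2) * μ (closedBall 0 R) +
          ENNReal.ofReal M * (ENNReal.ofReal (ε / (2 * (M + 1))) * μ (closedBall 0 R)) := by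
        gcongr; exact h R hR
    _ ≤ _ := by
        rw [← mul_assoc, ← ENNReal.ofReal_mul hM0, ← add_mul,
          ← ENNReal.ofReal_add (by positivity) (by positivity)]
        gcongr
        rw [mul_div_assoc', ← le_sub_iff_add_le', div_le_iff₀ (by positivity)]
        nlinarith

theorem setLIntegral_comp_add_le (g : E → ℝ≥0∞) (h : E) (ρ : ℝ) :
    ∫⁻ x in closedBall 0 ρ, g (x + h) ∂μ ≤ ∫⁻ x in closedBall 0 (ρ + ‖h‖), g x ∂μ := by
  rw [← lintegral_indicator isClosed_closedBall.measurableSet,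
    ← lintegral_indicator isClosed_closedBall.measurableSet,
    ← lintegral_add_right_eq_self ((closedBall 0 (ρ + ‖h‖)).indicator g) h]
  refine lintegral_mono fun x => ?_
  by_cases hx : x ∈ closedBall (0 : E) ρ
  · rw [indicator_of_mem hx, indicator_of_mem]
    rw [mem_closedBall_zero_iff] at *
    exact (norm_add_le _ _).trans (by linarith)
  · rw [indicator_of_notMem hx]; exact zero_le

theorem setLIntegral_sd_le {U : E → ℝ} (hU : Continuous U) {e : E} {q : ℝ}
    (h0 : ∀ x, sd U e x ≤ q) (k : ℕ) :
    (∀ x, sd U ((2 : ℝ) ^ k • e) x ≤ 4 ^ k * q) ∧ ∀ ρ,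
    ∫⁻ x in closedBall 0 ρ, ENNReal.ofReal (q - sd U ((2 : ℝ) ^ k • e) x / 4 ^ k) ∂μ ≤
      ∫⁻ x in closedBall 0 (ρ + 2 ^ k * ‖e‖), ENNReal.ofReal (q - sd U e x) ∂μ := by
  induction k with
  | zero =>
    refine ⟨by simpa using h0, fun ρ => ?_⟩
    simp only [pow_zero, one_smul, div_one, one_mul]
    exact lintegral_mono_set (closedBall_subset_closedBall (by linarith [norm_nonneg e]))
  | succ k ih =>
    set e' := (2 : ℝ) ^ k • e with he'
    have hrec : ∀ x, sd U ((2 : ℝ) ^ (k + 1) • e) x =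
        sd U e' (x + e') + sd U e' (x - e') + 2 * sd U e' x := fun x => by
      rw [pow_succ', mul_smul, sd_two_mul]
    refine ⟨fun x => ?_, fun ρ => ?_⟩
    · rw [hrec, pow_succ]
      linarith [ih.1 (x + e'), ih.1 (x - e'), ih.1 x]
    have hne : ‖e'‖ = 2 ^ k * ‖e‖ := by rw [he', norm_smul]; simp
    set g : E → ℝ≥0∞ := fun x => ENNReal.ofReal (q - sd U e' x / 4 ^ k) with hg
    have hgm : Measurable g := by
      have : Continuous fun x => sd U e' x := by unfold sd; fun_prop
      exact ENNReal.measurable_ofReal.comp (by fun_prop)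
    have hpt : ∀ x, ENNReal.ofReal (q - sd U ((2 : ℝ) ^ (k + 1) • e) x / 4 ^ (k + 1)) ≤
        ENNReal.ofReal (1 / 4) * (g (x + e') + g (x + -e') + 2 * g x) := fun x => by
      have hn : ∀ y, 0 ≤ q - sd U e' y / 4 ^ k := fun y => by
        rw [sub_nonneg, div_le_iff₀ (by positivity)]; linarith [ih.1 y]
      have h2 : (2 : ℝ≥0∞) = ENNReal.ofReal 2 := by simp
      rw [hg, h2, ← ENNReal.ofReal_mul (by norm_num), ← ENNReal.ofReal_add (hn _) (hn _),
        ← ENNReal.ofReal_add (add_nonneg (hn _) (hn _)) (mul_nonneg zero_le_two (hn _)),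
        ← ENNReal.ofReal_mul (by norm_num)]
      refine ENNReal.ofReal_le_ofReal (le_of_eq ?_)
      rw [hrec, pow_succ, ← sub_eq_add_neg]
      field_simp
      ring
    set T := ∫⁻ x in closedBall 0 (ρ + 2 ^ (k + 1) * ‖e‖), ENNReal.ofReal (q - sd U e x) ∂μ
      with hT
    have hb : ∀ h : E, ‖h‖ ≤ 2 ^ k * ‖e‖ → ∫⁻ x in closedBall 0 ρ, g (x + h) ∂μ ≤ T :=
      fun h hh => by
      refine (setLIntegral_comp_add_le g h ρ).trans ((ih.2 _).trans (lintegral_mono_set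
        (closedBall_subset_closedBall ?_)))
      rw [pow_succ]; linarith
    have hb0 := hb 0 (by simp)
    simp only [add_zero] at hb0
    calc _ ≤ ∫⁻ x in closedBall 0 ρ, ENNReal.ofReal (1 / 4) *
            (g (x + e') + g (x + -e') + 2 * g x) ∂μ := lintegral_mono hpt
      _ = ENNReal.ofReal (1 / 4) * (∫⁻ x in closedBall 0 ρ, g (x + e') ∂μ +
            ∫⁻ x in closedBall 0 ρ, g (x + -e') ∂μ + 2 * ∫⁻ x in closedBall 0 ρ, g x ∂μ) := by
          rw [lintegral_const_mul _ (by fun_prop), lintegral_add_left (by fun_prop),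
            lintegral_add_left (by fun_prop), lintegral_const_mul _ (by fun_prop)]
      _ ≤ ENNReal.ofReal (1 / 4) * (T + T + 2 * T) := by
          gcongr
          · exact hb e' hne.le
          · exact hb (-e') (by rw [norm_neg, hne])
      _ = T := by
          have : T + T + 2 * T = ENNReal.ofReal 4 * T := by
            rw [show ENNReal.ofReal 4 = 4 by simp]; ring
          rw [this, ← mul_assoc, ← ENNReal.ofReal_mul (by norm_num)]
          norm_num

theorem Sol.super_sd {f₀ c C : ℝ} (hE : Elliptic F P) (hf₀ : 0 < f₀)
    {U : E → ℝ} (hU : Sol μ F P (fun _ => f₀) K univ U)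
    (hell : ∀ A, P A → ‖A‖ ≤ K → f₀ ≤ F A → fderiv ℝ F A ∈ Ell c C) (e : E) (q : ℝ) :
    Super μ c C (fun x => q - sd U e x) := by
  set v : E → ℝ := fun x => q - sd U e x with hv
  have hd : ∀ x, HasFDerivAt v (-(fderiv ℝ U (x + e) + fderiv ℝ U (x + -e) -
      (2 : ℝ) • fderiv ℝ U x)) x := fun x => by
    have h1 : ∀ h : E, HasFDerivAt (fun x => U (x + h)) (fderiv ℝ U (x + h)) x := fun h => by
      have := (hU.c11.diff (x + h) (mem_univ _)).hasFDerivAt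
      have h2 : HasFDerivAt (fun x : E => x + h) (ContinuousLinearMap.id ℝ E) x :=
        (hasFDerivAt_id x).add_const h
      simpa [Function.comp_def] using HasFDerivAt.comp x this h2
    have h0 := (hU.c11.diff x (mem_univ _)).hasFDerivAt
    have := (((h1 e).add (h1 (-e))).sub (h0.const_mul 2)).const_sub q
    refine this.congr_of_eventuallyEq (.of_forall fun y => ?_)
    simp [hv, sd, sub_eq_add_neg]
  have hfd : fderiv ℝ v = fun x => -(fderiv ℝ U (x + e) + fderiv ℝ U (x + -e) -
      (2 : ℝ) • fderiv ℝ U x) := funext fun x => (hd x).fderiv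
  have hlip : LipschitzWith K (fderiv ℝ U) := lipschitzOnWith_univ.1 hU.c11.lip
  have hsh : ∀ h : E, LipschitzWith K fun x => fderiv ℝ U (x + h) := fun h =>
    LipschitzWith.of_dist_le_mul fun x y => by simpa using hlip.dist_le_mul (x + h) (y + h)
  refine ⟨⟨K + K + ‖(2 : ℝ)‖₊ * K, fun x _ => (hd x).differentiableAt, ?_⟩, ?_⟩
  · rw [hfd, lipschitzOnWith_univ]
    refine LipschitzWith.neg (((hsh e).add (hsh (-e))).sub ?_)
    refine LipschitzWith.of_dist_le_mul fun x y => ?_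
    rw [dist_smul₀, NNReal.coe_mul, mul_assoc]
    gcongr
    · simp
    · exact hlip.dist_le_mul x y
  · have hae : ∀ᵐ x ∂μ, DifferentiableAt ℝ (fderiv ℝ U) x ∧ P (hess U x) ∧ F (hess U x) = f₀ :=
      hU.ae.mono fun x hx => hx (mem_univ x)
    have hsha : ∀ h : E, ∀ᵐ x ∂μ, DifferentiableAt ℝ (fderiv ℝ U) (x + h) ∧ P (hess U (x + h)) ∧
        F (hess U (x + h)) = f₀ := fun h => (quasiMeasurePreserving_add_right μ h).ae hae
    filter_upwards [hae, hsha e, hsha (-e)] with x h1 h2 h3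
    have hh : ∀ h : E, DifferentiableAt ℝ (fderiv ℝ U) (x + h) →
        HasFDerivAt (fun x => fderiv ℝ U (x + h)) (hess U (x + h)) x := fun h hd => by
      have h2 : HasFDerivAt (fun x : E => x + h) (ContinuousLinearMap.id ℝ E) x :=
        (hasFDerivAt_id x).add_const h
      have := HasFDerivAt.comp x hd.hasFDerivAt h2
      rw [ContinuousLinearMap.comp_id] at this
      exact this
    have hdd := (((hh e h2.1).add (hh (-e) h3.1)).sub (h1.1.hasFDerivAt.const_smul (2 : ℝ))).neg
    have hdd' : HasFDerivAt (fderiv ℝ v) (-(hess U (x + e) + hess U (x + -e) -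
        (2 : ℝ) • hess U x)) x := by rw [hfd]; exact hdd
    refine ⟨hdd'.differentiableAt, fderiv ℝ F (hess U x),
      hell _ h1.2.1 (hU.c11.norm_hess_le univ_mem) h1.2.2.ge, ?_⟩
    have c1 := hE.concave _ _ h1.2.1 h2.2.1 (by rw [h1.2.2]; exact hf₀) (by rw [h1.2.2, h2.2.2])
    have c2 := hE.concave _ _ h1.2.1 h3.2.1 (by rw [h1.2.2]; exact hf₀) (by rw [h1.2.2, h3.2.2])
    have hv' : hess v x = _ := hdd'.fderiv
    rw [hv']
    simp only [map_neg, map_add, map_sub, map_smul, smul_eq_mul] at c1 c2 ⊢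
    linarith

end Liouville

section Liouville

variable {E : Type*} [NormedAddCommGroup E] [InnerProductSpace ℝ E]
  [MeasurableSpace E] [BorelSpace E] [FiniteDimensional ℝ E] {μ : Measure E}
  [μ.IsAddHaarMeasure] {F : Bil E → ℝ} {P : Bil E → Prop} {K : ℝ≥0}

theorem sd_blow {U : E → ℝ} (h0 : U 0 = 0) (h1 : fderiv ℝ U 0 = 0) (r : ℝ) (e x : E) :
    sd (blow U 0 r) e x = r⁻¹ ^ 2 * sd U (r • e) (r • x) := by
  simp only [sd, blow, h0, h1, zero_add, smul_add, smul_sub]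
  simp
  ring

theorem sd_eq_of_blow_limit [Nontrivial E] {U W : E → ℝ} {c C q M : ℝ} {e : E} (hc : 0 < c)
    (hC : 0 < C) (hU : Continuous U) (h0 : U 0 = 0) (h1 : fderiv ℝ U 0 = 0)
    (hsup : Super μ c C (fun x => q - sd U e x)) (hq : ∀ x, sd U e x ≤ q)
    (hinf : ∀ ε > 0, ∃ x, q - sd U e x < ε) (hM : ∀ x, q - sd U e x ≤ M) (hW : Continuous W)
    {l : Filter ℕ} [l.NeBot] (hl : l ≤ atTop)
    (hlim : ∀ R, ∀ ε > 0, ∀ᶠ k in l, ∀ x ∈ closedBall (0 : E) R,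
      |blow U 0 ((2 : ℝ) ^ k) x - W x| ≤ ε) (x : E) : sd W e x = q := by
  have hsd : ∀ (k : ℕ) y, sd (blow U 0 ((2 : ℝ) ^ k)) e y =
      sd U ((2 : ℝ) ^ k • e) ((2 : ℝ) ^ k • y) / 4 ^ k := fun k y => by
    rw [sd_blow h0 h1, inv_pow, ← pow_mul, mul_comm k 2, pow_mul]
    norm_num
    ring
  have hclose : ∀ R, ∀ ε > 0, ∀ᶠ k in l, ∀ y ∈ closedBall (0 : E) R,
      |sd (blow U 0 ((2 : ℝ) ^ k)) e y - sd W e y| ≤ 4 * ε := fun R ε hε => by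
    filter_upwards [hlim (R + ‖e‖) ε hε] with k hk y hy
    rw [mem_closedBall_zero_iff] at hy
    have a1 := abs_le.1 (hk (y + e) (by
      rw [mem_closedBall_zero_iff]; exact (norm_add_le _ _).trans (by linarith)))
    have a2 := abs_le.1 (hk (y - e) (by
      rw [mem_closedBall_zero_iff]; exact (norm_sub_le _ _).trans (by linarith)))
    have a3 := abs_le.1 (hk y (by
      rw [mem_closedBall_zero_iff]; linarith [norm_nonneg e]))
    simp only [sd]
    rw [abs_le]
    constructor <;> linarith
  have hle : ∀ (k : ℕ) y, sd (blow U 0 ((2 : ℝ) ^ k)) e y ≤ q := fun k y => by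
    rw [hsd, div_le_iff₀ (by positivity), mul_comm]
    exact (setLIntegral_sd_le (μ := μ) hU hq k).1 _
  refine le_antisymm (le_of_forall_pos_le_add fun ε hε => ?_) ?_
  · obtain ⟨k, hk⟩ := (hclose ‖x‖ (ε / 4) (by positivity)).exists
    have := abs_le.1 (hk x (by simp))
    linarith [hle k x]
  by_contra! hlt
  set ε := (q - sd W e x) / 7 with hε
  have hε0 : 0 < ε := by rw [hε]; linarith
  have hcont : Continuous fun y => sd W e y := by unfold sd; fun_prop
  obtain ⟨r, hr, hball⟩ := Metric.eventually_nhds_iff_ball.1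
    ((hcont.tendsto x).eventually_lt_const (show sd W e x < q - 6 * ε by linarith))
  set n := Module.finrank ℝ E
  set ρ := ‖x‖ + r with hρ
  have hρ0 : 0 < ρ := by positivity
  have hρe : 0 < ρ + ‖e‖ := by positivity
  obtain ⟨R₀, hR₀, hint⟩ := hsup.exists_lintegral_le hc hC (fun y => sub_nonneg.2 (hq y)) hinf hM
    (ε := ε * (r / 2) ^ n / (2 * (ρ + ‖e‖) ^ n)) (by positivity)
  have hlarge : ∀ᶠ k : ℕ in l, R₀ ≤ (2 : ℝ) ^ k * (ρ + ‖e‖) :=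
    hl (((tendsto_pow_atTop_atTop_of_one_lt (one_lt_two)).atTop_mul_const hρe).eventually_ge_atTop _)
  obtain ⟨k, hk1, hk2⟩ := (hlarge.and (hclose ρ ε hε0)).exists
  have h2k : (0 : ℝ) < 2 ^ k := by positivity
  have A := (setLIntegral_sd_le (μ := μ) hU hq k).2 ((2 : ℝ) ^ k * ρ)
  rw [← mul_add] at A
  have B := A.trans (hint _ hk1)
  have hsub : closedBall ((2 : ℝ) ^ k • x) ((2 : ℝ) ^ k * (r / 2)) ⊆
      closedBall 0 ((2 : ℝ) ^ k * ρ) := by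
    refine closedBall_subset_closedBall' ?_
    rw [dist_zero_right, norm_smul, Real.norm_of_nonneg h2k.le, ← mul_add, hρ]
    exact mul_le_mul_of_nonneg_left (by linarith) h2k.le
  have D : ENNReal.ofReal ε * μ (closedBall ((2 : ℝ) ^ k • x) ((2 : ℝ) ^ k * (r / 2))) ≤
      ∫⁻ y in closedBall 0 ((2 : ℝ) ^ k * ρ),
        ENNReal.ofReal (q - sd U ((2 : ℝ) ^ k • e) y / 4 ^ k) ∂μ := by
    rw [← setLIntegral_const]
    refine (setLIntegral_mono' isClosed_closedBall.measurableSet fun y hy =>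
      ENNReal.ofReal_le_ofReal ?_).trans (lintegral_mono_set hsub)
    set y' := ((2 : ℝ) ^ k)⁻¹ • y with hy'
    have hyy : y = (2 : ℝ) ^ k • y' := by rw [hy', smul_inv_smul₀ h2k.ne']
    have hyx : dist y' x ≤ r / 2 := by
      rw [mem_closedBall, hyy, dist_smul₀, Real.norm_of_nonneg h2k.le] at hy
      exact le_of_mul_le_mul_left hy h2k
    have hyρ : y' ∈ closedBall (0 : E) ρ := by
      rw [mem_closedBall_zero_iff]
      have := norm_le_norm_add_norm_sub' y' x
      rw [← dist_eq_norm] at this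
      linarith
    rw [hyy, ← hsd]
    have b1 := hball y' (by rw [mem_ball]; linarith)
    have b2 := abs_le.1 (hk2 y' hyρ)
    linarith
  have H := D.trans B
  rw [Measure.addHaar_closedBall _ _ (by positivity), Measure.addHaar_closedBall _ _ (by positivity),
    ← mul_assoc, ← mul_assoc, ← ENNReal.ofReal_mul (by positivity),
    ← ENNReal.ofReal_mul (by positivity), ENNReal.mul_le_mul_iff_left
      (measure_ball_pos μ _ one_pos).ne' measure_ball_lt_top.ne,
    ENNReal.ofReal_le_ofReal_iff (by positivity), mul_pow, mul_pow] at H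
  have : ε * (r / 2) ^ n / (2 * (ρ + ‖e‖) ^ n) * (((2 : ℝ) ^ k) ^ n * (ρ + ‖e‖) ^ n) =
      ε * (((2 : ℝ) ^ k) ^ n * (r / 2) ^ n) / 2 := by
    field_simp
  rw [this] at H
  have : 0 < ε * (((2 : ℝ) ^ k) ^ n * (r / 2) ^ n) := by positivity
  linarith

theorem Elliptic.liouville [Nontrivial E] (hE : Elliptic F P) {f₀ : ℝ} (hf₀ : 0 < f₀) {U : E → ℝ}
    (hU : Sol μ F P (fun _ => f₀) K univ U) (h0 : U 0 = 0) (h1 : fderiv ℝ U 0 = 0) :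
    ∃ B, P B ∧ F B = f₀ ∧ ‖B‖ ≤ K ∧ ∀ x, fderiv ℝ U x = B x := by
  obtain ⟨c, hc, C, hC, hell⟩ := hE.exists_ell K hf₀
  obtain ⟨W, hW, -, -, hlim⟩ := exists_limit (hyperfilter ℕ) (K := K)
    (u := fun k => blow U 0 ((2 : ℝ) ^ k))
    (fun R => .of_forall fun k => (hU.c11.blow (by positivity) 0).mono (subset_univ _))
    (fun k => by simp) (fun k => by rw [fderiv_blow (by positivity) (hU.c11.diff _ (mem_univ _))]; simp)
  have hlim' : ∀ R, ∀ ε > 0, ∀ᶠ k in (hyperfilter ℕ : Filter ℕ), ∀ x ∈ closedBall (0 : E) R,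
      |blow U 0 ((2 : ℝ) ^ k) x - W x| ≤ ε := fun R ε hε =>
    (hlim R ε hε).mono fun k hk x hx => (hk x hx).1
  have hWs : Sol μ F P (fun _ => f₀) K univ W :=
    hE.stability hf₀ (fun R => .of_forall fun k =>
      (hU.blow (r := (2 : ℝ) ^ k) (by positivity) 0).mono isOpen_ball (subset_univ _))
      (fun R ε hε => .of_forall fun k x _ => by simpa using hε.le) hW hlim'
  have hUc : Continuous U := continuous_iff_continuousAt.2 fun x =>
    (hU.c11.diff x (mem_univ _)).continuousAt
  have hWc : Continuous W := continuous_iff_continuousAt.2 fun x =>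
    (hW.diff x (mem_univ _)).continuousAt
  have hbdd : ∀ e, BddAbove (range fun x => sd U e x) := fun e =>
    ⟨2 * K * ‖e‖ ^ 2, by rintro _ ⟨x, rfl⟩; exact (le_abs_self _).trans (hU.c11.abs_sd_le e x)⟩
  have hle : ∀ e x, sd U e x ≤ ⨆ y, sd U e y := fun e x => le_ciSup (hbdd e) x
  have hWsd : ∀ e x, sd W e x = ⨆ y, sd U e y := fun e x =>
    sd_eq_of_blow_limit (μ := μ) (M := (⨆ y, sd U e y) + 2 * K * ‖e‖ ^ 2) hc hC hUc h0 h1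
      (Sol.super_sd hE hf₀ hU hell e _) (hle e)
      (fun ε hε => by
        obtain ⟨x, hx⟩ := exists_lt_of_lt_ciSup (sub_lt_self (⨆ y, sd U e y) hε)
        exact ⟨x, by linarith⟩)
      (fun x => by linarith [abs_le.1 (hU.c11.abs_sd_le e x)]) hWc (Nat.hyperfilter_le_atTop) hlim' x
  obtain ⟨x₀, hx₀⟩ := hWs.ae.exists
  obtain ⟨hd₀, hP₀, hF₀⟩ := hx₀ (mem_univ _)
  set B := hess W x₀ with hB
  have hess_le : ∀ x, DifferentiableAt ℝ (fderiv ℝ U) x → NonNeg (B - hess U x) := by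
    intro x hx e
    simp only [sub_apply]
    rw [sub_nonneg]
    refine le_of_forall_pos_le_add fun ε hε => ?_
    obtain ⟨r, hr, h⟩ := exists_abs_sd_sub_le hU.c11 univ_mem hx e (half_pos hε)
    obtain ⟨r', hr', h'⟩ := exists_abs_sd_sub_le hW univ_mem hd₀ e (half_pos hε)
    have ht : 0 < min r r' := lt_min hr hr'
    have k1 := abs_le.1 (h _ ht (min_le_left _ _))
    have k2 := abs_le.1 (h' _ ht (min_le_right _ _))
    rw [hWsd] at k2
    have k3 := hle (min r r' • e) x
    have k4 : min r r' ^ 2 * hess U x e e ≤ min r r' ^ 2 * (B e e + ε) := by linarith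
    exact le_of_mul_le_mul_left k4 (by positivity)
  refine ⟨B, hP₀, hF₀, hW.norm_hess_le univ_mem, fun x => ?_⟩
  have hlip : LipschitzWith (K + ‖B‖₊) fun x => fderiv ℝ U x - B x :=
    (lipschitzOnWith_univ.1 hU.c11.lip).sub B.lipschitz
  have := LipschitzWith.eq_of_ae_fderiv_eq_zero (μ := μ) hlip (by
    filter_upwards [hU.ae] with y hy
    obtain ⟨y1, y2, y3⟩ := hy (mem_univ _)
    have : B = hess U y := hE.eq_of_le y2 (by rw [y3]; exact hf₀) (hE.symm _ hP₀) (hess_le y y1)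
      (by rw [y3, hF₀])
    have hs : fderiv ℝ (fun x => fderiv ℝ U x - B x) y = _ :=
      (y1.hasFDerivAt.sub B.hasFDerivAt).fderiv
    rw [hs, this]
    exact sub_self _) x 0
  simpa [h1, sub_eq_zero] using this

end Liouville

section Polynomials

variable {E : Type*} [NormedAddCommGroup E] [InnerProductSpace ℝ E]

variable (E) in
/-- Affine functions on `E`. -/
def affineFun : Submodule ℝ (E → ℝ) :=
  LinearMap.range ({ toFun := fun q x => q.1 + q.2 x
                     map_add' := fun q q' => by ext x; simp; ring
                     map_smul' := fun r q => by ext x; simp; ring } :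
    (ℝ × (E →L[ℝ] ℝ)) →ₗ[ℝ] (E → ℝ))

theorem mem_affineFun {g : E → ℝ} :
    g ∈ affineFun E ↔ ∃ (a : ℝ) (p : E →L[ℝ] ℝ), g = fun x => a + p x := by
  constructor
  · rintro ⟨⟨a, p⟩, rfl⟩; exact ⟨a, p, rfl⟩
  · rintro ⟨a, p, rfl⟩; exact ⟨(a, p), rfl⟩

theorem one_le_affineFun : 1 ≤ affineFun E := by
  rw [Submodule.one_le]
  exact mem_affineFun.2 ⟨1, 0, by ext; simp⟩

variable (E) in
/-- Polynomial functions of degree at most `k` on `E`. -/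
def polyFun (k : ℕ) : Submodule ℝ (E → ℝ) := affineFun E ^ k

instance [FiniteDimensional ℝ E] (k : ℕ) : FiniteDimensional ℝ (polyFun E k) :=
  Module.Finite.iff_fg.2 ((Module.Finite.iff_fg.1 (Module.Finite.range _)).pow k)

theorem polyFun_mono {k m : ℕ} (h : k ≤ m) : polyFun E k ≤ polyFun E m :=
  pow_le_pow_right' one_le_affineFun h

theorem mul_mem_polyFun {k m : ℕ} {f g : E → ℝ} (hf : f ∈ polyFun E k) (hg : g ∈ polyFun E m) :
    f * g ∈ polyFun E (k + m) := by
  rw [polyFun, pow_add]; exact Submodule.mul_mem_mul hf hg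

theorem affine_mem_polyFun (a : ℝ) (p : E →L[ℝ] ℝ) : (fun x => a + p x) ∈ polyFun E 1 := by
  rw [polyFun, pow_one]; exact mem_affineFun.2 ⟨a, p, rfl⟩

theorem const_mem_polyFun (a : ℝ) (k : ℕ) : (fun _ => a) ∈ polyFun E k := by
  refine polyFun_mono (Nat.zero_le k) ?_
  rw [polyFun, pow_zero, Submodule.mem_one]
  exact ⟨a, rfl⟩

theorem contDiff_of_mem_polyFun {k : ℕ} : ∀ {g : E → ℝ}, g ∈ polyFun E k → ContDiff ℝ ⊤ g := by
  induction k with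
  | zero =>
    intro g hg
    rw [polyFun, pow_zero, Submodule.mem_one] at hg
    obtain ⟨a, rfl⟩ := hg
    exact contDiff_const (c := a)
  | succ k ih =>
    intro g hg
    rw [polyFun, pow_succ] at hg
    induction hg using Submodule.mul_induction_on' with
    | mem_mul_mem f hf g hg =>
      obtain ⟨a, p, rfl⟩ := mem_affineFun.1 hg
      exact (ih hf).mul (contDiff_const.add p.contDiff)
    | add f _ g _ hf hg => exact hf.add hg

theorem differentiable_of_mem_polyFun {k : ℕ} {g : E → ℝ} (hg : g ∈ polyFun E k) :
    Differentiable ℝ g :=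
  (contDiff_of_mem_polyFun hg).differentiable (by simp)

theorem fderiv_mem_polyFun {k : ℕ} (v : E) :
    ∀ {g : E → ℝ}, g ∈ polyFun E (k + 1) → (fun x => fderiv ℝ g x v) ∈ polyFun E k := by
  have haff : ∀ {g : E → ℝ}, g ∈ affineFun E → ∃ c : ℝ, ∀ x, fderiv ℝ g x v = c := by
    intro g hg
    obtain ⟨a, p, rfl⟩ := mem_affineFun.1 hg
    exact ⟨p v, fun x => by rw [(p.hasFDerivAt.const_add a).fderiv]⟩
  induction k with
  | zero =>
    intro g hg
    rw [polyFun, zero_add, pow_one] at hg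
    obtain ⟨c, hc⟩ := haff hg
    simp only [hc]
    exact const_mem_polyFun c 0
  | succ k ih =>
    intro g hg
    rw [polyFun, pow_succ] at hg
    induction hg using Submodule.mul_induction_on' with
    | mem_mul_mem f hf g hg =>
      obtain ⟨c, hc⟩ := haff hg
      have hg1 : g ∈ polyFun E 1 := by rwa [polyFun, pow_one]
      have h1 := mul_mem_polyFun (ih hf) hg1
      have h2 := (polyFun E (k + 1)).smul_mem c hf
      convert (polyFun E (k + 1)).add_mem h1 h2 using 1
      ext x
      have h3 := ((differentiable_of_mem_polyFun hf) x).hasFDerivAt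
      have h4 := ((differentiable_of_mem_polyFun hg1) x).hasFDerivAt
      rw [(h3.mul h4).fderiv]
      simp [hc]
      ring
    | add f hf' g hg' hf hg =>
      convert (polyFun E (k + 1)).add_mem hf hg using 1
      ext x
      have h3 := ((differentiable_of_mem_polyFun (k := k + 1 + 1) hf') x).hasFDerivAt
      have h4 := ((differentiable_of_mem_polyFun (k := k + 1 + 1) hg') x).hasFDerivAt
      rw [(h3.add h4).fderiv]
      simp

theorem fderiv_fderiv_apply {g : E → ℝ} {x : E} (hd : DifferentiableAt ℝ (fderiv ℝ g) x) (v w : E) :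
    fderiv ℝ (fun y => fderiv ℝ g y w) x v = hess g x v w := by
  rw [fderiv_clm_apply hd (differentiableAt_const w)]
  simp [hess]

variable [FiniteDimensional ℝ E] [MeasurableSpace E] [BorelSpace E]

theorem bil_eq_sum {ι : Type*} [Fintype ι] (b : OrthonormalBasis ι ℝ E) (B : Bil E) :
    B = ∑ i, ∑ j, B (b i) (b j) • (innerSL ℝ (b i)).smulRight (innerSL ℝ (b j)) := by
  ext x y
  conv_lhs => rw [← b.sum_repr' x, ← b.sum_repr' y]
  simp only [map_sum, map_smul, sum_apply, smul_apply,
    ContinuousLinearMap.smulRight_apply, innerSL_apply_apply, smul_eq_mul]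
  rw [Finset.sum_comm]
  refine Finset.sum_congr rfl fun i _ => ?_
  rw [Finset.mul_sum]
  exact Finset.sum_congr rfl fun j _ => by ring

theorem apply_hess_mem_polyFun {k : ℕ} {g : E → ℝ} (hg : g ∈ polyFun E (k + 2))
    (ℓ : Bil E →L[ℝ] ℝ) : (fun x => ℓ (hess g x)) ∈ polyFun E k := by
  have hd := ContDiff.differentiable_fderiv ((contDiff_of_mem_polyFun hg).of_le le_top)
  let b := stdOrthonormalBasis ℝ E
  have : (fun x => ℓ (hess g x)) = ∑ i, ∑ j, ℓ ((innerSL ℝ (b i)).smulRight (innerSL ℝ (b j))) •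
      fun x => fderiv ℝ (fun y => fderiv ℝ g y (b j)) x (b i) := by
    ext x
    conv_lhs => rw [bil_eq_sum b (hess g x)]
    simp [fderiv_fderiv_apply (hd x), mul_comm]
  rw [this]
  exact Submodule.sum_mem _ fun i _ => Submodule.sum_mem _ fun j _ =>
    Submodule.smul_mem _ _ (fderiv_mem_polyFun _ (fderiv_mem_polyFun _ hg))

theorem one_sub_norm_sq_mem_polyFun : (fun x : E => 1 - ‖x‖ ^ 2) ∈ polyFun E 2 := by
  let b := stdOrthonormalBasis ℝ E
  have : (fun x : E => 1 - ‖x‖ ^ 2) = (fun _ => 1) -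
      ∑ i, (fun x => 0 + innerSL ℝ (b i) x) * (fun x => 0 + innerSL ℝ (b i) x) := by
    ext x
    simp [← b.sum_sq_norm_inner_right x, sq]
  rw [this]
  exact Submodule.sub_mem _ (const_mem_polyFun 1 2) (Submodule.sum_mem _ fun i _ =>
    mul_mem_polyFun (affine_mem_polyFun _ _) (affine_mem_polyFun _ _))

end Polynomials

section Dirichlet

variable {E : Type*} [NormedAddCommGroup E] [InnerProductSpace ℝ E]
  [MeasurableSpace E] [BorelSpace E] [FiniteDimensional ℝ E] {c C : ℝ} {ℓ : Bil E →L[ℝ] ℝ}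

theorem Ell.le_idForm [Nontrivial E] (hc : 0 < c) (hℓ : ℓ ∈ Ell c C) : c ≤ ℓ (idForm E) := by
  obtain ⟨x, hx⟩ := exists_norm_eq E zero_le_one
  have h := (hℓ _ symm_idForm nonNeg_idForm).1
  have : 1 ≤ ‖idForm E‖ := by
    have := (idForm E).le_opNorm₂ x x
    simpa [hx] using this
  nlinarith

theorem Ell.nonneg_apply (hc : 0 ≤ c) (hℓ : ℓ ∈ Ell c C) {B : Bil E} (hs : Symm B) (hB : NonNeg B) :
    0 ≤ ℓ B := (mul_nonneg hc (norm_nonneg _)).trans (hℓ B hs hB).1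

/-- The weak maximum principle on the unit ball. -/
theorem Ell.le_of_le_sphere [Nontrivial E] (hc : 0 < c) (hℓ : ℓ ∈ Ell c C) {g : E → ℝ} {m : ℝ}
    (hg : ContDiff ℝ 2 g) (h0 : ∀ x, 0 ≤ ℓ (hess g x)) (hm : ∀ x, ‖x‖ = 1 → g x ≤ m) {x : E}
    (hx : ‖x‖ ≤ 1) : g x ≤ m := by
  by_contra! hlt
  set ε := (g x - m) / 2 with hε
  have hε0 : 0 < ε := by rw [hε]; linarith
  set Q : Bil E := (-(2 * ε)) • idForm E with hQ
  have hQs : Symm Q := symm_idForm.smul _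
  set φ : E → ℝ := fun y => quad 0 0 Q y - g y with hφ
  have hq : ∀ y, quad 0 0 Q y = -(ε * ‖y‖ ^ 2) := fun y => by
    simp [quad, hQ]; ring
  have hφc : Continuous φ := ((contDiff_quad 0 0 Q (n := 2)).continuous).sub hg.continuous
  obtain ⟨z, hz, hmin⟩ := (isCompact_closedBall (0 : E) 1).exists_isMinOn ⟨x, by simpa using hx⟩
    hφc.continuousOn
  rw [mem_closedBall_zero_iff] at hz
  have h1 : φ z ≤ φ x := hmin (by simpa using hx)
  have hz1 : ‖z‖ < 1 := by
    refine lt_of_le_of_ne hz fun h => ?_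
    simp only [hφ, hq, h] at h1
    nlinarith [hm z h, mul_nonneg hε0.le (sq_nonneg ‖x‖)]
  have hloc : IsLocalMin φ z := hmin.isLocalMin (by
    rw [← mem_interior_iff_mem_nhds, interior_closedBall _ one_ne_zero]; simpa using hz1)
  have hqd : ContDiff ℝ 2 (quad 0 0 Q) := contDiff_quad _ _ _
  obtain ⟨e1, e2⟩ := hess_sub (ContDiff.eventually_differentiableAt hqd z)
    (ContDiff.eventually_differentiableAt hg z)
    (ContDiff.differentiable_fderiv hqd z) (ContDiff.differentiable_fderiv hg z)
  have hnn := hess_nonneg_of_isLocalMin (w := φ)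
    (.of_forall fun y => (hqd.differentiable two_ne_zero y).sub (hg.differentiable two_ne_zero y))
    e2 hloc
  rw [e1, hess_quad _ _ hQs] at hnn
  have := Ell.nonneg_apply hc.le hℓ (hQs.sub (ContDiff.symm_hess hg z)) hnn
  rw [map_sub, hQ, map_smul, smul_eq_mul] at this
  nlinarith [Ell.le_idForm hc hℓ, h0 z]

theorem Ell.exists_poly_apply_eq [Nontrivial E] (hc : 0 < c) (hℓ : ℓ ∈ Ell c C) {k : ℕ} {r : E → ℝ}
    (hr : r ∈ polyFun E k) :
    ∃ q ∈ polyFun E k, ∀ x, ℓ (hess (fun y => (1 - ‖y‖ ^ 2) * q y) x) = r x := by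
  have hmem : ∀ q ∈ polyFun E k, (fun y : E => (1 - ‖y‖ ^ 2) * q y) ∈ polyFun E (k + 2) :=
    fun q hq => by
      rw [add_comm]; exact mul_mem_polyFun one_sub_norm_sq_mem_polyFun hq
  have hd : ∀ q ∈ polyFun E k, ContDiff ℝ 2 (fun y : E => (1 - ‖y‖ ^ 2) * q y) := fun q hq =>
    (contDiff_of_mem_polyFun (hmem q hq)).of_le le_top
  let T : polyFun E k →ₗ[ℝ] polyFun E k :=
    { toFun := fun q => ⟨_, apply_hess_mem_polyFun (hmem q.1 q.2) ℓ⟩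
      map_add' := fun p q => by
        ext x
        have := (hess_add (ContDiff.eventually_differentiableAt (hd _ p.2) x)
          (ContDiff.eventually_differentiableAt (hd _ q.2) x)
          (ContDiff.differentiable_fderiv (hd _ p.2) x)
          (ContDiff.differentiable_fderiv (hd _ q.2) x)).1
        simp only [← mul_add] at this
        simp [this]
      map_smul' := fun a q => by
        ext x
        have := (hess_const_mul (ContDiff.eventually_differentiableAt (hd _ q.2) x)
          (ContDiff.differentiable_fderiv (hd _ q.2) x) a).1
        simp only [mul_left_comm a] at this
        simp [this] }
  have hinj : Function.Injective T := by
    rw [injective_iff_map_eq_zero]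
    intro q hq
    have h0 : ∀ x, ℓ (hess (fun y => (1 - ‖y‖ ^ 2) * q.1 y) x) = 0 := fun x =>
      congrFun (congrArg Subtype.val hq) x
    have hneg : ∀ x, ℓ (hess (fun y => -1 * ((1 - ‖y‖ ^ 2) * q.1 y)) x) = 0 := fun x => by
      rw [(hess_const_mul (ContDiff.eventually_differentiableAt (hd _ q.2) x)
          (ContDiff.differentiable_fderiv (hd _ q.2) x) _).1, map_smul, h0, smul_zero]
    have hz : ∀ x ∈ ball (0 : E) 1, q.1 x = 0 := fun x hx => by
      rw [mem_ball_zero_iff] at hx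
      have a1 := Ell.le_of_le_sphere hc hℓ (hd _ q.2) (fun x => (h0 x).ge) (m := 0)
        (fun x hx => by simp [hx]) hx.le
      have a2 := Ell.le_of_le_sphere hc hℓ (contDiff_const.mul (hd _ q.2)) (fun x => (hneg x).ge)
        (m := 0) (fun x hx => by simp [hx]) hx.le
      have h1 : 0 < 1 - ‖x‖ ^ 2 := by nlinarith [norm_nonneg x]
      have : (1 - ‖x‖ ^ 2) * q.1 x = 0 := by linarith
      exact (mul_eq_zero.1 this).resolve_left h1.ne'
    have := AnalyticOnNhd.eq_of_eventuallyEq (contDiff_of_mem_polyFun q.2).analyticOnNhd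
      (g := fun _ => 0) analyticOnNhd_const (z₀ := 0)
      (eventually_of_mem (ball_mem_nhds _ one_pos) hz)
    exact Subtype.ext this
  obtain ⟨q, hq⟩ := LinearMap.injective_iff_surjective.1 hinj ⟨r, hr⟩
  exact ⟨q.1, q.2, fun x => congrFun (congrArg Subtype.val hq) x⟩

theorem exists_polyFun_near {V : E → ℝ} (hV : ContinuousOn V (sphere 0 1)) {η : ℝ} (hη : 0 < η) :
    ∃ k, ∃ p ∈ polyFun E k, ∀ x ∈ sphere (0 : E) 1, |p x - V x| ≤ η := by
  set S := sphere (0 : E) 1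
  let coord : E → C(S, ℝ) := fun v => ⟨fun x => inner ℝ v (x : E), by fun_prop⟩
  have hsep : (Algebra.adjoin ℝ (range coord)).SeparatesPoints := by
    intro x y hxy
    refine ⟨_, ⟨coord (x - y), Algebra.subset_adjoin ⟨_, rfl⟩, rfl⟩, fun h => hxy ?_⟩
    have h' : inner ℝ (x - y : E) (x : E) = inner ℝ (x - y : E) (y : E) := h
    rw [← sub_eq_zero, ← inner_sub_right, inner_self_eq_zero, sub_eq_zero] at h'
    exact Subtype.ext h'
  obtain ⟨⟨g, hg⟩, hgV⟩ := ContinuousMap.exists_mem_subalgebra_near_continuous_of_separatesPoints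
    _ hsep (fun x : S => V x) (continuousOn_iff_continuous_domRestrict.1 hV) η hη
  have key : ∃ k, ∃ p ∈ polyFun E k, ∀ x : S, g x = p x := by
    clear hgV
    induction hg using Algebra.adjoin_induction with
    | mem g hg =>
      obtain ⟨v, rfl⟩ := hg
      exact ⟨1, _, affine_mem_polyFun 0 (innerSL ℝ v), fun x => by simp [coord]⟩
    | algebraMap a => exact ⟨0, _, const_mem_polyFun a 0, fun x => rfl⟩
    | add f g _ _ hf hg =>
      obtain ⟨k, p, hp, hfp⟩ := hf
      obtain ⟨m, q, hq, hgq⟩ := hg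
      exact ⟨k + m, p + q, Submodule.add_mem _ (polyFun_mono (Nat.le_add_right _ _) hp)
        (polyFun_mono (Nat.le_add_left _ _) hq), fun x => by simp [hfp, hgq]⟩
    | mul f g _ _ hf hg =>
      obtain ⟨k, p, hp, hfp⟩ := hf
      obtain ⟨m, q, hq, hgq⟩ := hg
      exact ⟨k + m, p * q, mul_mem_polyFun hp hq, fun x => by simp [hfp, hgq]⟩
  obtain ⟨k, p, hp, hgp⟩ := key
  refine ⟨k, p, hp, fun x hx => ?_⟩
  have := hgV ⟨x, hx⟩
  rw [Real.norm_eq_abs] at this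
  rw [← hgp ⟨x, hx⟩]
  exact this.le

/-- Approximate solvability of the Dirichlet problem for constant coefficient equations. -/
theorem Ell.exists_approx_dirichlet [Nontrivial E] (hc : 0 < c) (hℓ : ℓ ∈ Ell c C) {V : E → ℝ}
    (hV : ContinuousOn V (sphere 0 1)) (κ : ℝ) {η : ℝ} (hη : 0 < η) :
    ∃ h : E → ℝ, ContDiff ℝ ⊤ h ∧ (∀ x, ℓ (hess h x) = κ) ∧ ∀ x, ‖x‖ = 1 → |h x - V x| ≤ η := by
  obtain ⟨k, p, hp, hpV⟩ := exists_polyFun_near hV hη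
  have hp2 : p ∈ polyFun E (k + 2) := polyFun_mono (Nat.le_add_right _ _) hp
  obtain ⟨q, hq, hqr⟩ := Ell.exists_poly_apply_eq hc hℓ
    (Submodule.sub_mem _ (apply_hess_mem_polyFun hp2 ℓ) (const_mem_polyFun κ k))
  have hmem : (fun y : E => (1 - ‖y‖ ^ 2) * q y) ∈ polyFun E (2 + k) :=
    mul_mem_polyFun one_sub_norm_sq_mem_polyFun hq
  have d1 := contDiff_of_mem_polyFun hp
  have d2 := contDiff_of_mem_polyFun hmem
  have d1' : ContDiff ℝ 2 p := d1.of_le le_top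
  have d2' : ContDiff ℝ 2 (fun y : E => (1 - ‖y‖ ^ 2) * q y) := d2.of_le le_top
  refine ⟨fun y => p y - (1 - ‖y‖ ^ 2) * q y, d1.sub d2, fun x => ?_, fun x hx => ?_⟩
  · rw [(hess_sub (ContDiff.eventually_differentiableAt d1' x) (ContDiff.eventually_differentiableAt d2' x)
      (ContDiff.differentiable_fderiv d1' x) (ContDiff.differentiable_fderiv d2' x)).1, map_sub, hqr]
    simp
  · simpa [hx] using hpV x (by simpa using hx)

end Dirichlet

section DerivativeEstimates

variable {E : Type*} [NormedAddCommGroup E] [InnerProductSpace ℝ E]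
  [MeasurableSpace E] [BorelSpace E] [FiniteDimensional ℝ E] {c C : ℝ} {ℓ : Bil E →L[ℝ] ℝ}

theorem ContDiff.exists_abs_sd_sub_le {g : E → ℝ} (hg : ContDiff ℝ 2 g) (x e : E) {ε : ℝ}
    (hε : 0 < ε) :
    ∃ r > 0, ∀ t, 0 < t → t ≤ r → |sd g (t • e) x - t ^ 2 * hess g x e e| ≤ ε * t ^ 2 := by
  obtain ⟨K, hK⟩ := ContDiff.exists_c11 hg x 1
  exact EvansKrylov.exists_abs_sd_sub_le hK (ball_mem_nhds x one_pos)
    (ContDiff.differentiable_fderiv hg x) e hε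

set_option maxHeartbeats 800000 in
/-- Interior difference bound, by the maximum principle for the doubled variables. -/
theorem Ell.sub_le_of_abs_le (hc : 0 < c) (hℓ : ℓ ∈ Ell c C) (hC : 0 ≤ C) {g : E → ℝ}
    (hg : ContDiff ℝ 2 g) (h0 : ∀ x, ‖x‖ ≤ 1 → ℓ (hess g x) = 0) {m : ℝ} (hm : 0 < m)
    (hgm : ∀ x, ‖x‖ ≤ 1 → |g x| ≤ m) {e : E} (he : ‖e‖ = 1) {t : ℝ} (ht : t ∈ Icc (0 : ℝ) (1 / 2)) :
    g (t • e) - g (-(t • e)) ≤ 8 * m * (C / c + 1) * t := by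
  set A := 8 * m with hA
  set B := A * (C / c + 1) with hB
  have hA0 : 0 < A := by positivity
  have hAB : A ≤ B := le_mul_of_one_le_right hA0.le (by linarith [div_nonneg hC hc.le])
  have hcB : c * B = A * (C + c) := by rw [hB]; field_simp
  set Ψ : E × ℝ → ℝ := fun p => g (p.1 + p.2 • e) - g (p.1 - p.2 • e) - A * ‖p.1‖ ^ 2
    - B * (p.2 - p.2 ^ 2) with hΨ
  have hgc := hg.continuous
  have hΨc : Continuous Ψ := by fun_prop
  suffices h : ∀ p ∈ closedBall (0 : E) (1 / 2) ×ˢ Icc (0 : ℝ) (1 / 2), Ψ p ≤ 0 by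
    have := h (0, t) ⟨by simp, ht⟩
    simp only [hΨ, zero_add, zero_sub, norm_zero] at this
    nlinarith [mul_nonneg (hA0.le.trans hAB) (sq_nonneg t)]
  by_contra! hcon
  obtain ⟨p, hp, hp0⟩ := hcon
  obtain ⟨⟨x, s⟩, ⟨hx, hs⟩, hmax⟩ :=
    ((isCompact_closedBall (0 : E) (1 / 2)).prod isCompact_Icc).exists_isMaxOn ⟨p, hp⟩ hΨc.continuousOn
  have hpos : 0 < Ψ (x, s) := hp0.trans_le (hmax hp)
  replace hs : s ∈ Icc (0 : ℝ) (1 / 2) := hs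
  replace hx : ‖x‖ ≤ 1 / 2 := by simpa using hx
  have hse : ‖s • e‖ = s := by rw [norm_smul, he, mul_one, Real.norm_of_nonneg hs.1]
  have hn1 : ‖x + s • e‖ ≤ 1 := (norm_add_le _ _).trans (by rw [hse]; linarith [hs.2])
  have hn2 : ‖x - s • e‖ ≤ 1 := (norm_sub_le _ _).trans (by rw [hse]; linarith [hs.2])
  have h1 := abs_le.1 (hgm _ hn1)
  have h2 := abs_le.1 (hgm _ hn2)
  have hs2 : s ^ 2 ≤ s / 2 := by nlinarith [hs.1, hs.2]
  simp only [hΨ] at hpos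
  have hx' : ‖x‖ < 1 / 2 := by
    refine hx.lt_of_ne fun hx => ?_
    rw [hx] at hpos
    nlinarith [mul_nonneg (hA0.le.trans hAB) (by linarith [hs.1] : 0 ≤ s - s ^ 2)]
  have hs0 : 0 < s := by
    refine hs.1.lt_of_ne fun hs0 => ?_
    rw [← hs0] at hpos
    simp only [zero_smul, add_zero, sub_zero, sub_self] at hpos
    nlinarith [mul_nonneg hA0.le (sq_nonneg ‖x‖)]
  have hs1 : s < 1 / 2 := by
    refine hs.2.lt_of_ne fun hs1 => ?_
    rw [hs1] at hpos h1 h2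
    nlinarith [mul_nonneg hA0.le (sq_nonneg ‖x‖)]
  set X := hess g (x - s • e) - hess g (x + s • e) with hX
  set Q : Bil E := (2 * A) • idForm E with hQ
  have hQs : Symm Q := symm_idForm.smul _
  have hcd1 : ContDiff ℝ 2 fun y => g (-(s • e) + y) := hg.comp (contDiff_const.add contDiff_id)
  have hcd2 : ContDiff ℝ 2 fun y => g (s • e + y) := hg.comp (contDiff_const.add contDiff_id)
  have hqd : ContDiff ℝ 2 (quad 0 0 Q) := contDiff_quad _ _ _
  obtain ⟨e1, d1⟩ := hess_add (ContDiff.eventually_differentiableAt hqd x)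
    (ContDiff.eventually_differentiableAt hcd1 x) (ContDiff.differentiable_fderiv hqd x)
    (ContDiff.differentiable_fderiv hcd1 x)
  obtain ⟨e2, d2⟩ := hess_sub (ContDiff.eventually_differentiableAt (hqd.add hcd1) x)
    (ContDiff.eventually_differentiableAt hcd2 x) d1 (ContDiff.differentiable_fderiv hcd2 x)
  rw [e1, hess_quad _ _ hQs, hess_comp_add, hess_comp_add, add_sub_assoc, ← sub_eq_neg_add,
    add_comm (s • e) x] at e2
  have hloc : IsLocalMin (fun y => quad 0 0 Q y + g (-(s • e) + y) - g (s • e + y)) x := by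
    have : ball (0 : E) (1 / 2) ∈ 𝓝 x := isOpen_ball.mem_nhds (by simpa using hx')
    filter_upwards [this] with y hy
    have := hmax (show (y, s) ∈ _ from ⟨ball_subset_closedBall hy, hs⟩)
    simp only [hΨ, mem_ofPred_eq] at this
    simp only [quad, hQ, smul_apply, idForm_apply, real_inner_self_eq_norm_sq, zero_apply,
      smul_eq_mul, ← sub_eq_neg_add, add_comm (s • e)]
    linarith
  have hnn := hess_nonneg_of_isLocalMin
    (ContDiff.eventually_differentiableAt ((hqd.add hcd1).sub hcd2) x) d2 hloc
  rw [e2] at hnn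
  obtain ⟨r1, hr1, k1⟩ := ContDiff.exists_abs_sd_sub_le hg (x + s • e) e (half_pos hA0)
  obtain ⟨r2, hr2, k2⟩ := ContDiff.exists_abs_sd_sub_le hg (x - s • e) e (half_pos hA0)
  obtain ⟨τ, hτ0, hτ⟩ : ∃ τ, 0 < τ ∧ τ ≤ min (min r1 r2) (min s (1 / 2 - s)) :=
    ⟨_, by simp only [lt_min_iff, sub_pos]; exact ⟨⟨hr1, hr2⟩, hs0, hs1⟩, le_rfl⟩
  simp only [le_min_iff] at hτ
  obtain ⟨⟨t1, t2⟩, t3, t4⟩ := hτ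
  have k1 := abs_le.1 (k1 τ hτ0 t1)
  have k2 := abs_le.1 (k2 τ hτ0 t2)
  have m1 := hmax (show (x, s + τ) ∈ _ from
    ⟨by simpa using hx, by constructor <;> simp only <;> linarith⟩)
  have m2 := hmax (show (x, s - τ) ∈ _ from
    ⟨by simpa using hx, by constructor <;> simp only <;> linarith⟩)
  simp only [hΨ, mem_ofPred_eq] at m1 m2
  simp only [sd] at k1 k2
  rw [show x + s • e + τ • e = x + (s + τ) • e by module,
    show x + s • e - τ • e = x + (s - τ) • e by module] at k1
  rw [show x - s • e + τ • e = x - (s - τ) • e by module,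
    show x - s • e - τ • e = x - (s + τ) • e by module] at k2
  have hXe : 2 * B - A ≤ X e e := by
    have : 0 < τ ^ 2 := by positivity
    simp only [hX, sub_apply]
    by_contra! hlt
    have h3 := mul_lt_mul_of_pos_left hlt this
    linarith [k1.1, k1.2, k2.1, k2.2]
  have hsy : Symm (Q + X) :=
    hQs.add ((ContDiff.symm_hess hg _).sub (ContDiff.symm_hess hg _))
  have hfin := (hℓ _ hsy hnn).1
  have hid := (hℓ _ symm_idForm nonNeg_idForm).2
  have hval : ℓ (Q + X) = 2 * A * ℓ (idForm E) := by
    rw [hQ, hX, map_add, map_sub, h0 _ hn1, h0 _ hn2, map_smul, smul_eq_mul]; ring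
  have hnorm : 2 * A + (2 * B - A) ≤ ‖Q + X‖ := by
    have h3 := (le_abs_self _).trans ((Q + X).le_opNorm₂ e e)
    simp only [add_apply, hQ, smul_apply, idForm_apply, real_inner_self_eq_norm_sq, he,
      smul_eq_mul] at h3
    linarith
  rw [hval] at hfin
  clear_value A B
  have hid' : ℓ (idForm E) ≤ C :=
    hid.trans (mul_le_of_le_one_right hC norm_idForm_le)
  nlinarith [mul_le_mul_of_nonneg_left hnorm hc.le, mul_le_mul_of_nonneg_left hid' hA0.le,
    mul_pos hc hA0]

end DerivativeEstimates

section DerivativeEstimates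

variable {E : Type*} [NormedAddCommGroup E] [InnerProductSpace ℝ E]
  [MeasurableSpace E] [BorelSpace E] [FiniteDimensional ℝ E] {c C : ℝ} {ℓ : Bil E →L[ℝ] ℝ}

theorem Ell.norm_fderiv_zero_le (hc : 0 < c) (hℓ : ℓ ∈ Ell c C) (hC : 0 ≤ C) {g : E → ℝ}
    (hg : ContDiff ℝ 2 g) (h0 : ∀ x, ℓ (hess g x) = 0) {m : ℝ} (hm : 0 < m)
    (hgm : ∀ x, ‖x‖ ≤ 1 → |g x| ≤ m) : ‖fderiv ℝ g 0‖ ≤ 4 * m * (C / c + 1) := by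
  have key : ∀ e : E, ‖e‖ = 1 → fderiv ℝ g 0 e ≤ 4 * m * (C / c + 1) := fun e he => by
    have hd : HasFDerivAt g (fderiv ℝ g 0) 0 := (hg.differentiable two_ne_zero 0).hasFDerivAt
    have hl : ∀ a : E, HasDerivAt (fun t : ℝ => g (t • a)) (fderiv ℝ g 0 a) 0 := fun a => by
      have h1 : HasDerivAt (fun t : ℝ => t • a) a 0 := by
        simpa using (hasDerivAt_id (0 : ℝ)).smul_const a
      exact HasFDerivAt.comp_hasDerivAt (f := fun t : ℝ => t • a) 0 (by simpa using hd) h1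
    have h2 := ((hl e).sub (hl (-e))).tendsto_slope_zero_right
    refine le_of_mul_le_mul_left (?_ : (2 : ℝ) * _ ≤ 2 * _) two_pos
    refine le_trans (le_of_eq ?_) (le_of_tendsto h2 (b := 8 * m * (C / c + 1)) ?_) |>.trans
      (le_of_eq (by ring))
    · simp; ring
    · filter_upwards [Ioc_mem_nhdsGT (show (0 : ℝ) < 1 / 2 by norm_num)] with t ht
      have := Ell.sub_le_of_abs_le hc hℓ hC hg (fun x _ => h0 x) hm hgm he ⟨ht.1.le, ht.2⟩
      simp only [zero_add, Pi.sub_apply, smul_neg, zero_smul, neg_zero, sub_self, sub_zero,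
        smul_eq_mul]
      rw [inv_mul_le_iff₀ ht.1]
      linarith
  refine ContinuousLinearMap.opNorm_le_of_unit_norm (by positivity) fun e he => ?_
  rw [Real.norm_eq_abs, abs_le]
  have := key (-e) (by rwa [norm_neg])
  rw [map_neg] at this
  exact ⟨by linarith, key e he⟩

/-- The interior gradient estimate. -/
theorem Ell.norm_fderiv_le (hc : 0 < c) (hℓ : ℓ ∈ Ell c C) (hC : 0 ≤ C) {g : E → ℝ}
    (hg : ContDiff ℝ 2 g) (h0 : ∀ x, ℓ (hess g x) = 0) {m r : ℝ} (hm : 0 < m) (hr : 0 < r) {z : E}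
    (hgm : ∀ x ∈ closedBall z r, |g x| ≤ m) : ‖fderiv ℝ g z‖ ≤ 4 * (C / c + 1) / r * m := by
  have h := Ell.norm_fderiv_zero_le hc hℓ hC (g := fun y => 1 * g (z + r • y))
    (contDiff_const.mul (hg.comp (contDiff_const.add (contDiff_const.smul contDiff_id))))
    (fun x => by rw [hess_comp_affine, map_smul, h0, smul_zero]) hm fun x hx => by
      rw [one_mul]
      refine hgm _ ?_
      rw [mem_closedBall_iff_norm, add_sub_cancel_left, norm_smul, Real.norm_of_nonneg hr.le]
      exact mul_le_of_le_one_right hr.le hx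
  rw [fderiv_comp_affine, smul_zero, add_zero, one_mul, norm_smul, Real.norm_of_nonneg hr.le] at h
  rw [div_mul_eq_mul_div, le_div_iff₀ hr]
  linarith

theorem ContDiff.fderiv_apply_const {g : E → ℝ} (hg : ContDiff ℝ ⊤ g) (v : E) :
    ContDiff ℝ ⊤ fun x => fderiv ℝ g x v :=
  (hg.fderiv_right (m := ⊤) (by simp)).clm_apply contDiff_const

theorem ContDiff.apply_hess_fderiv {g : E → ℝ} (hg : ContDiff ℝ ⊤ g) {κ : ℝ}
    (h0 : ∀ x, ℓ (hess g x) = κ) (v x : E) : ℓ (hess (fun y => fderiv ℝ g y v) x) = 0 := by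
  have hg2 : ContDiff ℝ 2 g := hg.of_le le_top
  have hG : ContDiff ℝ ⊤ (fderiv ℝ g) := hg.fderiv_right (m := ⊤) (by simp)
  have hH : ContDiff ℝ ⊤ (hess g) := hG.fderiv_right (m := ⊤) (by simp)
  have h1 : (fderiv ℝ fun y => fderiv ℝ g y v) = fun y => hess g y v := by
    funext y
    ext w
    rw [fderiv_fderiv_apply (ContDiff.differentiable_fderiv hg2 y)]
    exact ContDiff.symm_hess hg2 y w v
  have hHd : DifferentiableAt ℝ (hess g) x := hH.differentiable (by simp) x
  have h2 : hess (fun y => fderiv ℝ g y v) x = fderiv ℝ (hess g) x v := by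
    ext a b
    have h3 : fderiv ℝ (fun y => hess g y v) x a = fderiv ℝ (hess g) x a v := by
      rw [(hHd.hasFDerivAt.clm_apply (hasFDerivAt_const v x)).fderiv]
      simp
    rw [hess, h1, h3]
    exact congrArg (fun p : E →L[ℝ] ℝ => p b)
      ((hG.contDiffAt (x := x)).isSymmSndFDerivAt (by simp) a v)
  rw [h2]
  have h4 : fderiv ℝ (fun y => ℓ (hess g y)) x v = ℓ (fderiv ℝ (hess g) x v) := by
    have h5 : fderiv ℝ (fun y => ℓ (hess g y)) x = _ :=
      (ℓ.hasFDerivAt.comp x hHd.hasFDerivAt).fderiv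
    rw [h5]
    rfl
  rw [← h4]
  simp [h0]

theorem Ell.norm_taylor_le_of_kernel (hc : 0 < c) (hℓ : ℓ ∈ Ell c C) (hC : 0 ≤ C) {g : E → ℝ}
    (hg : ContDiff ℝ ⊤ g) (h0 : ∀ x, ℓ (hess g x) = 0) {m : ℝ} (hm : 0 < m)
    (hgm : ∀ x, ‖x‖ ≤ 1 → |g x| ≤ m) {x y : E} (hx : ‖x‖ ≤ 1 / 4) (hy : ‖y‖ ≤ 1 / 4) :
    ‖fderiv ℝ g x - fderiv ℝ g y - hess g y (x - y)‖
      ≤ (16 * (C / c + 1)) ^ 3 * m * ‖x - y‖ ^ 2 := by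
  set A := 16 * (C / c + 1) with hA
  have hA0 : 0 < A := by positivity
  have step : ∀ {f : E → ℝ} {M ρ : ℝ}, ContDiff ℝ ⊤ f → (∀ x, ℓ (hess f x) = 0) → 0 < M →
      (∀ x, ‖x‖ ≤ ρ + 1 / 4 → |f x| ≤ M) → ∀ x, ‖x‖ ≤ ρ → ‖fderiv ℝ f x‖ ≤ A * M :=
    fun {f M ρ} hf h0 hM hb x hx => by
      have := Ell.norm_fderiv_le hc hℓ hC (hf.of_le le_top) h0 hM (show (0 : ℝ) < 1 / 4 by norm_num)
        (z := x) fun y hy => hb y (by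
          rw [mem_closedBall_iff_norm] at hy
          linarith [norm_le_norm_add_norm_sub' y x])
      exact this.trans_eq (by rw [hA]; ring)
  have app : ∀ {f : E → ℝ} {M : ℝ} {x v : E}, ‖v‖ = 1 → ‖fderiv ℝ f x‖ ≤ M →
      |fderiv ℝ f x v| ≤ M := fun {f M x v} hv h => by
    simpa [hv] using (fderiv ℝ f x).le_of_opNorm_le h v
  have s1 := step (ρ := 3 / 4) hg h0 hm (by norm_num; exact hgm)
  refine ContinuousLinearMap.opNorm_le_of_unit_norm (by positivity) fun v hv => ?_
  have hv1 := ContDiff.fderiv_apply_const hg v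
  have hv0 := ContDiff.apply_hess_fderiv hg h0 v
  have s2 := step (ρ := 1 / 2) hv1 hv0 (mul_pos hA0 hm) (by norm_num; exact fun x hx => app hv (s1 x hx))
  have hbd : ∀ x, ‖x‖ ≤ 1 / 4 → ‖hess (fun y => fderiv ℝ g y v) x‖ ≤ A ^ 3 * m := fun x hx => by
    refine ContinuousLinearMap.opNorm_le_bound _ (by positivity) fun a => ?_
    refine ContinuousLinearMap.opNorm_le_of_unit_norm (by positivity) fun b hb => ?_
    rw [← fderiv_fderiv_apply (ContDiff.differentiable_fderiv (hv1.of_le le_top) x)]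
    refine ContinuousLinearMap.le_of_opNorm_le _ ?_ a
    refine (step (ρ := 1 / 4) (ContDiff.fderiv_apply_const hv1 b)
      (ContDiff.apply_hess_fderiv hv1 hv0 b) (mul_pos hA0 (mul_pos hA0 hm))
      (by norm_num; exact fun x hx => app hb (s2 x hx)) x hx).trans_eq (by ring)
  have hc11 : C11 (fun y => fderiv ℝ g y v) (A ^ 3 * m).toNNReal (closedBall 0 (1 / 4)) := by
    refine ⟨fun x _ => hv1.differentiable (by simp) x, ?_⟩
    refine (convex_closedBall _ _).lipschitzOnWith_of_nnnorm_fderiv_le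
      (fun x _ => ContDiff.differentiable_fderiv (hv1.of_le le_top) x) fun x hx => ?_
    rw [← NNReal.coe_le_coe, Real.coe_toNNReal _ (by positivity)]
    exact hbd x (by simpa using hx)
  have := hc11.abs_taylor_le (convex_closedBall _ _) (x := y) (y := x) (by simpa using hy)
    (by simpa using hx)
  rw [Real.coe_toNNReal _ (by positivity),
    fderiv_fderiv_apply (ContDiff.differentiable_fderiv (hg.of_le le_top) y)] at this
  simpa using this

/-- Uniform second order Taylor estimate for the gradient of a solution of a constant coefficient
equation. -/
theorem Ell.norm_taylor_le [Nontrivial E] (hc : 0 < c) (hℓ : ℓ ∈ Ell c C) (hC : 0 ≤ C) {h : E → ℝ}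
    (hh : ContDiff ℝ ⊤ h) {κ : ℝ} (h0 : ∀ x, ℓ (hess h x) = κ) {m : ℝ} (hm : 0 < m)
    (hhm : ∀ x, ‖x‖ = 1 → |h x| ≤ m) (hκ : |κ| ≤ m) {x y : E} (hx : ‖x‖ ≤ 1 / 4)
    (hy : ‖y‖ ≤ 1 / 4) :
    ‖fderiv ℝ h x - fderiv ℝ h y - hess h y (x - y)‖
      ≤ (16 * (C / c + 1)) ^ 3 * (m * (1 + 1 / c)) * ‖x - y‖ ^ 2 := by
  have hid := Ell.le_idForm hc hℓ
  set a := κ / ℓ (idForm E) with ha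
  have haℓ : a * ℓ (idForm E) = κ := div_mul_cancel₀ _ (hc.trans_le hid).ne'
  have ham : |a| ≤ m / c := by
    rw [ha, abs_div, abs_of_pos (hc.trans_le hid)]
    gcongr
  have hQs : Symm (a • idForm E) := symm_idForm.smul a
  have hq : ContDiff ℝ ⊤ (quad 0 0 (a • idForm E)) := contDiff_quad _ _ _
  have hq2 : ContDiff ℝ 2 (quad 0 0 (a • idForm E)) := contDiff_quad _ _ _
  have hh2 : ContDiff ℝ 2 h := hh.of_le le_top
  have hg : ContDiff ℝ ⊤ fun y => h y - quad 0 0 (a • idForm E) y := hh.sub hq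
  have hgh : ∀ x, hess (fun y => h y - quad 0 0 (a • idForm E) y) x = hess h x - a • idForm E :=
    fun x => by
      rw [(hess_sub (ContDiff.eventually_differentiableAt hh2 x)
        (ContDiff.eventually_differentiableAt hq2 x) (ContDiff.differentiable_fderiv hh2 x)
        (ContDiff.differentiable_fderiv hq2 x)).1, hess_quad _ _ hQs]
  have hgf : ∀ x, fderiv ℝ (fun y => h y - quad 0 0 (a • idForm E) y) x
      = fderiv ℝ h x - a • idForm E x := fun x => by
    have : fderiv ℝ (fun y => h y - quad 0 0 (a • idForm E) y) x = _ :=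
      ((hh2.differentiable two_ne_zero x).hasFDerivAt.sub (hasFDerivAt_quad 0 0 hQs x)).fderiv
    rw [this]; simp
  have hg0 : ∀ x, ℓ (hess (fun y => h y - quad 0 0 (a • idForm E) y) x) = 0 := fun x => by
    rw [hgh, map_sub, h0, map_smul, smul_eq_mul, haℓ, sub_self]
  have hbs : ∀ x : E, ‖x‖ = 1 → |h x - quad 0 0 (a • idForm E) x| ≤ m * (1 + 1 / c) := fun x hx => by
    have h1 : quad 0 0 (a • idForm E) x = a / 2 := by
      simp [quad, hx]; ring
    have h2 := abs_le.1 (hhm x hx)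
    have h3 := abs_le.1 ham
    have h4 : 0 < m / c := by positivity
    have h5 : m * (1 + 1 / c) = m + m / c := by ring
    rw [h1, h5, abs_le]
    constructor <;> linarith [h2.1, h2.2, h3.1, h3.2]
  have hb : ∀ x : E, ‖x‖ ≤ 1 → |h x - quad 0 0 (a • idForm E) x| ≤ m * (1 + 1 / c) := fun x hx => by
    have h1 := Ell.le_of_le_sphere hc hℓ (hg.of_le le_top) (fun x => (hg0 x).ge)
      (fun x hx => (abs_le.1 (hbs x hx)).2) hx
    have h2 := Ell.le_of_le_sphere hc hℓ (g := fun x => -1 * (h x - quad 0 0 (a • idForm E) x))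
      (contDiff_const.mul (hg.of_le le_top)) (fun x => by
        rw [(hess_const_mul (ContDiff.eventually_differentiableAt (hg.of_le le_top) x)
          (ContDiff.differentiable_fderiv (hg.of_le le_top) x) _).1, map_smul, hg0, smul_zero])
      (m := m * (1 + 1 / c)) (fun x hx => by linarith [(abs_le.1 (hbs x hx)).1]) hx
    rw [abs_le]
    constructor <;> linarith
  have := Ell.norm_taylor_le_of_kernel hc hℓ hC hg hg0 (by positivity) hb hx hy
  rw [hgf, hgf, hgh] at this
  refine le_of_eq_of_le (congrArg _ ?_) this
  simp only [sub_apply, smul_apply, map_sub]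
  abel

end DerivativeEstimates

section Improvement

variable {E : Type*} [NormedAddCommGroup E] [InnerProductSpace ℝ E]

theorem norm_fderiv_le_of_abs_le {w : E → ℝ} {A : Bil E} {x : E} {ρ τ η : ℝ} (hρ : 0 < ρ)
    (hd : ∀ y ∈ closedBall x ρ, DifferentiableAt ℝ w y)
    (hA : ∀ y ∈ closedBall x ρ, ‖fderiv ℝ w y - fderiv ℝ w x - A (y - x)‖ ≤ τ)
    (hw : ∀ y ∈ closedBall x ρ, |w y| ≤ η) : ‖fderiv ℝ w x‖ ≤ η / ρ + τ := by
  have hx : x ∈ closedBall x ρ := mem_closedBall_self hρ.le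
  have hη : 0 ≤ η := (abs_nonneg _).trans (hw x hx)
  have hτ : 0 ≤ τ := (norm_nonneg _).trans (hA x hx)
  have key : ∀ e : E, ‖e‖ = 1 → fderiv ℝ w x e ≤ η / ρ + τ := fun e he => by
    have hmem : ∀ s : ℝ, |s| ≤ ρ → x + s • e ∈ closedBall x ρ := fun s hs => by
      rw [mem_closedBall_iff_norm, add_sub_cancel_left, norm_smul, he, mul_one]
      exact hs
    have hl : ∀ s : ℝ, |s| ≤ ρ →
        HasDerivAt (fun t : ℝ => w (x + t • e)) (fderiv ℝ w (x + s • e) e) s := fun s hs => by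
      have h1 : HasDerivAt (fun t : ℝ => x + t • e) e s := by
        simpa using ((hasDerivAt_id s).smul_const e).const_add x
      exact (hd _ (hmem s hs)).hasFDerivAt.comp_hasDerivAt s h1
    have hψ : ∀ s ∈ Icc (0 : ℝ) ρ, HasDerivAt (fun t : ℝ => w (x + t • e) - w (x + (-t) • e))
        (fderiv ℝ w (x + s • e) e + fderiv ℝ w (x + (-s) • e) e) s := fun s hs => by
      have hs' : |s| ≤ ρ := by rw [abs_of_nonneg hs.1]; exact hs.2
      have := (hl s hs').sub ((hl (-s) (by rwa [abs_neg])).scomp s (hasDerivAt_neg s))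
      exact HasDerivAt.congr_deriv this (by simp)
    obtain ⟨s, hs, hsl⟩ := exists_hasDerivAt_eq_slope _ _ hρ
      (fun s hs => (hψ s hs).continuousAt.continuousWithinAt)
      (fun s hs => hψ s ⟨hs.1.le, hs.2.le⟩)
    have hs' : |s| ≤ ρ := by rw [abs_of_pos hs.1]; exact hs.2.le
    have e1 := ContinuousLinearMap.le_of_opNorm_le _ (hA _ (hmem s hs')) e
    have e2 := ContinuousLinearMap.le_of_opNorm_le _ (hA _ (hmem (-s) (by rwa [abs_neg]))) e
    have b1 := abs_le.1 (hw _ (hmem ρ (abs_of_pos hρ).le))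
    have b2 := abs_le.1 (hw _ (hmem (-ρ) (by rw [abs_neg]; exact (abs_of_pos hρ).le)))
    rw [he, mul_one, Real.norm_eq_abs, abs_le] at e1 e2
    simp only [add_sub_cancel_left, sub_apply, map_smul, smul_apply, smul_eq_mul] at e1 e2
    rw [eq_div_iff (by linarith)] at hsl
    simp only [zero_smul, neg_zero, add_zero, sub_self, sub_zero] at hsl
    have h3 : fderiv ℝ w x e - τ ≤ η / ρ := by
      rw [le_div_iff₀ hρ]
      have h4 : 2 * (fderiv ℝ w x e - τ)
          ≤ fderiv ℝ w (x + s • e) e + fderiv ℝ w (x + (-s) • e) e := by linarith [e1.1, e2.1]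
      have := mul_le_mul_of_nonneg_right h4 hρ.le
      linarith [b1.2, b2.1]
    linarith
  refine ContinuousLinearMap.opNorm_le_of_unit_norm (by positivity) fun e he => ?_
  rw [Real.norm_eq_abs, abs_le]
  have := key (-e) (by rwa [norm_neg])
  rw [map_neg] at this
  exact ⟨by linarith, key e he⟩

/-- The gradient of `u` is within `δ * ρ` of an affine map on the ball of radius `ρ` at `z`. -/
def Close (u : E → ℝ) (z : E) (ρ δ : ℝ) : Prop :=
  ∃ B : Bil E, Symm B ∧ ∀ y ∈ closedBall z ρ, ‖fderiv ℝ u y - fderiv ℝ u z - B (y - z)‖ ≤ δ * ρ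

theorem nonNeg_of_norm_le {X : Bil E} {ε : ℝ} (h : ‖X‖ ≤ ε) : NonNeg (ε • idForm E + X) :=
  fun x => by
    have h1 := neg_abs_le (X x x)
    have h2 := X.le_of_opNorm₂_le_of_le h (le_refl ‖x‖) (le_refl ‖x‖)
    rw [Real.norm_eq_abs] at h2
    simp only [add_apply, smul_apply, idForm_apply, real_inner_self_eq_norm_sq, smul_eq_mul]
    nlinarith

variable {F : Bil E → ℝ} {P : Bil E → Prop}

theorem Elliptic.exists_expansion (hE : Elliptic F P) {Q : Bil E} (hQ : P Q) (hFQ : 0 < F Q) {ε : ℝ}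
    (hε : 0 < ε) : ∃ r > 0, ∀ B X : Bil E, Symm B → Symm X → ‖B - Q‖ ≤ r → ‖X‖ ≤ r →
      P (B + X) ∧ |F (B + X) - F B - fderiv ℝ F Q X| ≤ ε * ‖X‖ := by
  have hstr : HasStrictFDerivAt F (fderiv ℝ F Q) Q :=
    hE.contDiff.contDiffAt.hasStrictFDerivAt one_ne_zero
  have h1 := hstr.isLittleO.bound hε
  obtain ⟨r, hr, hball⟩ := Metric.eventually_nhds_iff_ball.1 h1
  obtain ⟨ε₀, hε₀, hP⟩ := hE.exists_sub Q hQ hFQ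
  refine ⟨min (r / 3) (ε₀ / 2), by positivity, fun B X hB hX hBr hXr => ?_⟩
  have b1 := hBr.trans (min_le_left _ _)
  have b2 := hXr.trans (min_le_left _ _)
  have b3 := hBr.trans (min_le_right _ _)
  have b4 := hXr.trans (min_le_right _ _)
  have h2 : ‖B + X - Q‖ ≤ ‖B - Q‖ + ‖X‖ := by
    rw [add_sub_right_comm]; exact norm_add_le _ _
  constructor
  · refine hE.mono _ _ hP (hB.add hX) ?_
    have : B + X - (Q - ε₀ • idForm E) = ε₀ • idForm E + (B + X - Q) := by abel
    rw [this]
    exact nonNeg_of_norm_le (by linarith)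
  · have := hball (B + X, B) (by
      rw [mem_ball, Prod.dist_eq, max_lt_iff, dist_eq_norm, dist_eq_norm]
      constructor <;> simp only <;> linarith)
    simpa using this

variable [MeasurableSpace E] [BorelSpace E] [FiniteDimensional ℝ E] {μ : Measure E}
  [μ.IsAddHaarMeasure] {K : ℝ≥0} {s : Set E} {u f : E → ℝ}

/-- The normalized deviation of `u` from the quadratic form `B`. -/
def dev (u : E → ℝ) (B : Bil E) (δ : ℝ) (x : E) : ℝ := δ⁻¹ * (u x - quad 0 0 B x)

theorem Sol.exists_dev_touch_below (h : Sol μ F P f K s u) {φ : E → ℝ} (hφ : ContDiff ℝ 2 φ)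
    {B : Bil E} (hB : Symm B) {δ : ℝ} (hδ : 0 < δ) {a : ℝ} (hs : closedBall 0 1 ⊆ s)
    (hb : ∀ x, ‖x‖ = 1 → a ≤ dev u B δ x - φ x) {x₀ : E} (hx₀ : ‖x₀‖ < 1)
    (ha : dev u B δ x₀ - φ x₀ < a) :
    ∃ x ∈ ball (0 : E) 1, P (hess u x) ∧ F (hess u x) = f x ∧ ‖hess u x‖ ≤ K ∧
      NonNeg (hess u x - (B + δ • hess φ x)) := by
  have hq : ContDiff ℝ 2 (quad 0 0 B) := contDiff_quad _ _ _
  have hdev : ∀ x, u x - (quad 0 0 B x + δ * φ x) = δ * (dev u B δ x - φ x) := fun x => by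
    rw [dev]; field_simp; ring
  obtain ⟨x, hx, h1, h2, h3, h4⟩ := h.exists_touch_below (φ := fun x => quad 0 0 B x + δ * φ x)
    (hq.add (contDiff_const.mul hφ)) one_pos hs (a := δ * a) (fun x hx => by
      rw [hdev]; exact mul_le_mul_of_nonneg_left (hb x hx) hδ.le) hx₀
      (by rw [hdev]; exact mul_lt_mul_of_pos_left ha hδ)
  refine ⟨x, hx, h1, h2, h3, ?_⟩
  obtain ⟨e1, d1⟩ := hess_const_mul (ContDiff.eventually_differentiableAt hφ x)
    (ContDiff.differentiable_fderiv hφ x) δ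
  rwa [(hess_add (ContDiff.eventually_differentiableAt hq x)
    (ContDiff.eventually_differentiableAt (contDiff_const.mul hφ) x)
    (ContDiff.differentiable_fderiv hq x) d1).1, e1, hess_quad _ _ hB] at h4

theorem Sol.exists_dev_touch_above (h : Sol μ F P f K s u) {φ : E → ℝ} (hφ : ContDiff ℝ 2 φ)
    {B : Bil E} (hB : Symm B) {δ : ℝ} (hδ : 0 < δ) {a : ℝ} (hs : closedBall 0 1 ⊆ s)
    (hb : ∀ x, ‖x‖ = 1 → a ≤ φ x - dev u B δ x) {x₀ : E} (hx₀ : ‖x₀‖ < 1)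
    (ha : φ x₀ - dev u B δ x₀ < a) :
    ∃ x ∈ ball (0 : E) 1, P (hess u x) ∧ F (hess u x) = f x ∧ ‖hess u x‖ ≤ K ∧
      NonNeg (B + δ • hess φ x - hess u x) := by
  have hq : ContDiff ℝ 2 (quad 0 0 B) := contDiff_quad _ _ _
  have hdev : ∀ x, quad 0 0 B x + δ * φ x - u x = δ * (φ x - dev u B δ x) := fun x => by
    rw [dev]; field_simp; ring
  obtain ⟨x, hx, h1, h2, h3, h4⟩ := h.exists_touch_above (φ := fun x => quad 0 0 B x + δ * φ x)
    (hq.add (contDiff_const.mul hφ)) one_pos hs (a := δ * a) (fun x hx => by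
      rw [hdev]; exact mul_le_mul_of_nonneg_left (hb x hx) hδ.le) hx₀
      (by rw [hdev]; exact mul_lt_mul_of_pos_left ha hδ)
  refine ⟨x, hx, h1, h2, h3, ?_⟩
  obtain ⟨e1, d1⟩ := hess_const_mul (ContDiff.eventually_differentiableAt hφ x)
    (ContDiff.differentiable_fderiv hφ x) δ
  rwa [(hess_add (ContDiff.eventually_differentiableAt hq x)
    (ContDiff.eventually_differentiableAt (contDiff_const.mul hφ) x)
    (ContDiff.differentiable_fderiv hq x) d1).1, e1, hess_quad _ _ hB] at h4

theorem Sol.exists_apply_hess_le (hE : Elliptic F P) (h : Sol μ F P f K s u) {Q : Bil E} {ε r : ℝ}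
    (hε : 0 ≤ ε)
    (hexp : ∀ B X : Bil E, Symm B → Symm X → ‖B - Q‖ ≤ r → ‖X‖ ≤ r →
      P (B + X) ∧ |F (B + X) - F B - fderiv ℝ F Q X| ≤ ε * ‖X‖)
    {φ : E → ℝ} (hφ : ContDiff ℝ 2 φ) {M : ℝ} (hM : ∀ x ∈ ball (0 : E) 1, ‖hess φ x‖ ≤ M)
    {B : Bil E} (hB : Symm B) (hBr : ‖B - Q‖ ≤ r) {δ τ : ℝ} (hδ : 0 < δ) (hδM : δ * M ≤ r)
    (hs : closedBall 0 1 ⊆ s) (hf0 : ∀ x ∈ ball (0 : E) 1, 0 < f x)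
    (hfτ : ∀ x ∈ ball (0 : E) 1, |f x - f 0| ≤ τ * δ) {a : ℝ}
    (hb : ∀ x, ‖x‖ = 1 → a ≤ dev u B δ x - φ x) {x₀ : E} (hx₀ : ‖x₀‖ < 1)
    (ha : dev u B δ x₀ - φ x₀ < a) :
    ∃ x ∈ ball (0 : E) 1, (F B - f 0) / δ + fderiv ℝ F Q (hess φ x) ≤ τ + ε * M := by
  obtain ⟨x, hx, h1, h2, h3, h4⟩ := h.exists_dev_touch_below hφ hB hδ hs hb hx₀ ha
  refine ⟨x, hx, ?_⟩
  have hn : ‖δ • hess φ x‖ ≤ δ * M := by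
    rw [norm_smul, Real.norm_of_nonneg hδ.le]; exact mul_le_mul_of_nonneg_left (hM x hx) hδ.le
  obtain ⟨k1, k2⟩ := hexp B (δ • hess φ x) hB ((ContDiff.symm_hess hφ x).smul δ) hBr
    (hn.trans hδM)
  have k3 : F (B + δ • hess φ x) ≤ f x := by
    rcases le_or_gt (F (B + δ • hess φ x)) 0 with h0 | h0
    · exact h0.trans (hf0 x hx).le
    · exact (hE.le k1 h0 (hE.symm _ h1) h4).trans_eq h2
  have k4 := (abs_le.1 (hfτ x hx)).2
  have k5 := (abs_le.1 k2).1
  have k6 := mul_le_mul_of_nonneg_left hn hε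
  rw [map_smul, smul_eq_mul] at k5
  rw [div_add' _ _ _ hδ.ne', div_le_iff₀ hδ]
  linarith

theorem Sol.exists_le_apply_hess (hE : Elliptic F P) (h : Sol μ F P f K s u) {Q : Bil E} {ε r : ℝ}
    (hε : 0 ≤ ε)
    (hexp : ∀ B X : Bil E, Symm B → Symm X → ‖B - Q‖ ≤ r → ‖X‖ ≤ r →
      P (B + X) ∧ |F (B + X) - F B - fderiv ℝ F Q X| ≤ ε * ‖X‖)
    {φ : E → ℝ} (hφ : ContDiff ℝ 2 φ) {M : ℝ} (hM : ∀ x ∈ ball (0 : E) 1, ‖hess φ x‖ ≤ M)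
    {B : Bil E} (hB : Symm B) (hBr : ‖B - Q‖ ≤ r) {δ τ : ℝ} (hδ : 0 < δ) (hδM : δ * M ≤ r)
    (hs : closedBall 0 1 ⊆ s) (hf0 : ∀ x ∈ ball (0 : E) 1, 0 < f x)
    (hfτ : ∀ x ∈ ball (0 : E) 1, |f x - f 0| ≤ τ * δ) {a : ℝ}
    (hb : ∀ x, ‖x‖ = 1 → a ≤ φ x - dev u B δ x) {x₀ : E} (hx₀ : ‖x₀‖ < 1)
    (ha : φ x₀ - dev u B δ x₀ < a) :
    ∃ x ∈ ball (0 : E) 1, -(τ + ε * M) ≤ (F B - f 0) / δ + fderiv ℝ F Q (hess φ x) := by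
  obtain ⟨x, hx, h1, h2, h3, h4⟩ := h.exists_dev_touch_above hφ hB hδ hs hb hx₀ ha
  refine ⟨x, hx, ?_⟩
  have hn : ‖δ • hess φ x‖ ≤ δ * M := by
    rw [norm_smul, Real.norm_of_nonneg hδ.le]; exact mul_le_mul_of_nonneg_left (hM x hx) hδ.le
  have hXs := (ContDiff.symm_hess hφ x).smul δ
  obtain ⟨k1, k2⟩ := hexp B (δ • hess φ x) hB hXs hBr (hn.trans hδM)
  have k3 : f x ≤ F (B + δ • hess φ x) :=
    h2.symm.trans_le (hE.le h1 (h2 ▸ hf0 x hx) (hB.add hXs) h4)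
  have k4 := (abs_le.1 (hfτ x hx)).1
  have k5 := (abs_le.1 k2).2
  have k6 := mul_le_mul_of_nonneg_left hn hε
  rw [map_smul, smul_eq_mul] at k5
  rw [div_add' _ _ _ hδ.ne', le_div_iff₀ hδ]
  linarith

end Improvement

section Improvement

variable {E : Type*} [NormedAddCommGroup E] [InnerProductSpace ℝ E]
  {F : Bil E → ℝ} {P : Bil E → Prop} [MeasurableSpace E] [BorelSpace E] [FiniteDimensional ℝ E]
  {μ : Measure E} [μ.IsAddHaarMeasure] {K : ℝ≥0} {s : Set E} {u f : E → ℝ}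

theorem hess_add_quad {h : E → ℝ} (hh : ContDiff ℝ 2 h) (t : ℝ) (x : E) :
    hess (fun y => h y + quad 0 0 (t • idForm E) y) x = hess h x + t • idForm E := by
  have hq : ContDiff ℝ 2 (quad 0 0 (t • idForm E)) := contDiff_quad _ _ _
  rw [(hess_add (ContDiff.eventually_differentiableAt hh x)
    (ContDiff.eventually_differentiableAt hq x) (ContDiff.differentiable_fderiv hh x)
    (ContDiff.differentiable_fderiv hq x)).1, hess_quad _ _ ((symm_idForm).smul t)]

theorem quad_smul_idForm (t : ℝ) (x : E) : quad 0 0 (t • idForm E) x = t / 2 * ‖x‖ ^ 2 := by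
  simp only [quad, smul_apply, idForm_apply, real_inner_self_eq_norm_sq, smul_eq_mul]
  simp only [zero_apply]
  ring

theorem Sol.abs_div_le [Nontrivial E] (hE : Elliptic F P) (h : Sol μ F P f K s u) {Q : Bil E}
    {ε r c C : ℝ} (hε : 0 ≤ ε)
    (hexp : ∀ B X : Bil E, Symm B → Symm X → ‖B - Q‖ ≤ r → ‖X‖ ≤ r →
      P (B + X) ∧ |F (B + X) - F B - fderiv ℝ F Q X| ≤ ε * ‖X‖)
    (hC : 0 ≤ C) (hℓ : fderiv ℝ F Q ∈ Ell c C)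
    {B : Bil E} (hB : Symm B) (hBr : ‖B - Q‖ ≤ r) {δ τ : ℝ} (hδ : 0 < δ) (hδr : δ * 4 ≤ r)
    (hs : closedBall 0 1 ⊆ s) (hf0 : ∀ x ∈ ball (0 : E) 1, 0 < f x)
    (hfτ : ∀ x ∈ ball (0 : E) 1, |f x - f 0| ≤ τ * δ) (h0 : u 0 = 0)
    (hdev : ∀ x, ‖x‖ = 1 → |dev u B δ x| ≤ 1) :
    |(F B - f 0) / δ| ≤ 4 * C + (τ + ε * 4) := by
  have hd0 : dev u B δ 0 = 0 := by simp [dev, quad, h0]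
  have hid : fderiv ℝ F Q (idForm E) ≤ C := by
    have := (hℓ _ symm_idForm nonNeg_idForm).2
    nlinarith [norm_idForm_le (E := E)]
  have hM : ∀ t : ℝ, |t| = 4 → ∀ x ∈ ball (0 : E) 1,
      ‖hess (quad 0 0 (t • idForm E)) x‖ ≤ 4 := fun t ht x _ => by
    rw [hess_quad _ _ (symm_idForm.smul t), norm_smul, Real.norm_eq_abs, ht]
    nlinarith [norm_idForm_le (E := E)]
  rw [abs_le]
  constructor
  · obtain ⟨x, -, hx⟩ := h.exists_le_apply_hess hE hε hexp (contDiff_quad 0 0 ((4 : ℝ) • idForm E))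
      (hM 4 (by norm_num)) hB hBr hδ hδr hs hf0 hfτ (a := 1)
      (fun x hx => by
        rw [quad_smul_idForm, hx]
        linarith [(abs_le.1 (hdev x hx)).2]) (x₀ := 0) (by simp)
      (by rw [quad_smul_idForm, hd0]; simp)
    rw [hess_quad _ _ (symm_idForm.smul _), map_smul, smul_eq_mul] at hx
    linarith
  · obtain ⟨x, -, hx⟩ := h.exists_apply_hess_le hE hε hexp
      (contDiff_quad 0 0 ((-4 : ℝ) • idForm E))
      (hM (-4) (by norm_num)) hB hBr hδ hδr hs hf0 hfτ (a := 1)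
      (fun x hx => by
        rw [quad_smul_idForm, hx]
        linarith [(abs_le.1 (hdev x hx)).1]) (x₀ := 0) (by simp)
      (by rw [quad_smul_idForm, hd0]; simp)
    rw [hess_quad _ _ (symm_idForm.smul _), map_smul, smul_eq_mul] at hx
    linarith

theorem Sol.abs_dev_sub_le [Nontrivial E] (hE : Elliptic F P) (h : Sol μ F P f K s u) {Q : Bil E}
    {ε r c C : ℝ} (hε : 0 ≤ ε)
    (hexp : ∀ B X : Bil E, Symm B → Symm X → ‖B - Q‖ ≤ r → ‖X‖ ≤ r →
      P (B + X) ∧ |F (B + X) - F B - fderiv ℝ F Q X| ≤ ε * ‖X‖)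
    (hc : 0 < c) (hℓ : fderiv ℝ F Q ∈ Ell c C)
    {B : Bil E} (hB : Symm B) (hBr : ‖B - Q‖ ≤ r) {δ τ M : ℝ} (hδ : 0 < δ)
    (hs : closedBall 0 1 ⊆ s) (hf0 : ∀ x ∈ ball (0 : E) 1, 0 < f x)
    (hfτ : ∀ x ∈ ball (0 : E) 1, |f x - f 0| ≤ τ * δ)
    {φ : E → ℝ} (hφ : ContDiff ℝ 2 φ) {κ η : ℝ} (hη : 0 < η)
    (hφκ : ∀ x, fderiv ℝ F Q (hess φ x) = -κ)
    (hM : ∀ x ∈ ball (0 : E) 1, ‖hess φ x‖ ≤ M) (hδM : δ * (M + 2 * η) ≤ r)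
    (hsmall : |(F B - f 0) / δ - κ| + τ + ε * (M + 2 * η) < 2 * η * c)
    (hdev : ∀ x, ‖x‖ = 1 → |dev u B δ x - φ x| ≤ η) :
    ∀ x ∈ closedBall (0 : E) 1, |dev u B δ x - φ x| ≤ 2 * η := by
  have hid : c ≤ fderiv ℝ F Q (idForm E) := Ell.le_idForm hc hℓ
  have hM' : ∀ t : ℝ, |t| = 2 * η → ∀ x ∈ ball (0 : E) 1,
      ‖hess (fun y => φ y + quad 0 0 (t • idForm E) y) x‖ ≤ M + 2 * η := fun t ht x hx => by
    rw [hess_add_quad hφ]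
    refine (norm_add_le _ _).trans (add_le_add (hM x hx) ?_)
    rw [norm_smul, Real.norm_eq_abs, ht]
    nlinarith [norm_idForm_le (E := E)]
  have hcd : ∀ t : ℝ, ContDiff ℝ 2 (fun y => φ y + quad 0 0 (t • idForm E) y) := fun t =>
    hφ.add (contDiff_quad _ _ _)
  intro x hx
  rcases (mem_closedBall_zero_iff.1 hx).eq_or_lt with hx1 | hx1
  · linarith [hdev x hx1]
  have hxsq : 0 ≤ η * ‖x‖ ^ 2 := by positivity
  rw [abs_le]
  constructor
  · by_contra! hlt
    obtain ⟨y, -, hy⟩ := h.exists_apply_hess_le hE hε hexp (hcd (2 * η))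
      (hM' (2 * η) (abs_of_pos (by positivity))) hB hBr hδ hδM hs hf0 hfτ (a := -(2 * η))
      (fun x hx => by
        rw [quad_smul_idForm, hx]
        linarith [(abs_le.1 (hdev x hx)).1]) hx1
      (by rw [quad_smul_idForm]; linarith)
    rw [hess_add_quad hφ, map_add, map_smul, smul_eq_mul, hφκ] at hy
    have := neg_abs_le ((F B - f 0) / δ - κ)
    nlinarith
  · by_contra! hlt
    obtain ⟨y, -, hy⟩ := h.exists_le_apply_hess hE hε hexp (hcd (-(2 * η)))
      (hM' (-(2 * η)) (by rw [abs_neg]; exact abs_of_pos (by positivity))) hB hBr hδ hδM hs hf0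
      hfτ (a := -(2 * η))
      (fun x hx => by
        rw [quad_smul_idForm, hx]
        linarith [(abs_le.1 (hdev x hx)).2]) hx1
      (by rw [quad_smul_idForm]; linarith)
    rw [hess_add_quad hφ, map_add, map_smul, smul_eq_mul, hφκ] at hy
    have := le_abs_self ((F B - f 0) / δ - κ)
    nlinarith

theorem C11.hasFDerivAt_dev (h : C11 u K s) {B : Bil E} (hB : Symm B) (δ : ℝ) {x : E} (hx : x ∈ s) :
    HasFDerivAt (dev u B δ) (δ⁻¹ • (fderiv ℝ u x - B x)) x := by
  have := ((h.diff x hx).hasFDerivAt.sub (hasFDerivAt_quad 0 0 hB x)).const_mul δ⁻¹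
  rwa [zero_add] at this

theorem close_of_abs_dev_sub_le (h : C11 u K s) {B : Bil E} (hB : Symm B) {δ θ ρ L η ω : ℝ}
    (hδ : 0 < δ) (hs : ball 0 1 ⊆ s) (h1 : fderiv ℝ u 0 = 0)
    {φ : E → ℝ} (hφ : ContDiff ℝ 2 φ)
    (hT : ∀ x y : E, ‖x‖ ≤ 1 / 4 → ‖y‖ ≤ 1 / 4 →
      ‖fderiv ℝ φ x - fderiv ℝ φ y - hess φ y (x - y)‖ ≤ L * ‖x - y‖ ^ 2) (hL : 0 ≤ L)
    (hdev : ∀ x ∈ closedBall (0 : E) 1, |dev u B δ x - φ x| ≤ η)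
    (hclose : ∀ y ∈ ball (0 : E) (1 / 2), Close u y ρ δ)
    (hθ : 0 < θ) (hθ' : θ ≤ 1 / 8) (hρ : 0 < ρ) (hρ' : ρ ≤ 1 / 8)
    (hsmall : 2 * (η / ρ + (ρ + L * ρ ^ 2)) + L * θ ^ 2 ≤ ω * θ) : Close u 0 θ (ω * δ) := by
  have hmem : ∀ {x : E}, ‖x‖ ≤ 1 / 4 → x ∈ s := fun hx => hs (mem_ball_zero_iff.2 (by linarith))
  have hw : ∀ {x : E}, ‖x‖ ≤ 1 / 4 → HasFDerivAt (fun y => dev u B δ y - φ y)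
      (δ⁻¹ • (fderiv ℝ u x - B x) - fderiv ℝ φ x) x := fun hx =>
    (h.hasFDerivAt_dev hB δ (hmem hx)).sub (hφ.differentiable two_ne_zero _).hasFDerivAt
  have key : ∀ x : E, ‖x‖ ≤ 1 / 8 →
      ‖δ⁻¹ • (fderiv ℝ u x - B x) - fderiv ℝ φ x‖ ≤ η / ρ + (ρ + L * ρ ^ 2) := fun x hx => by
    have hsub : ∀ y ∈ closedBall x ρ, ‖y‖ ≤ 1 / 4 := fun y hy => by
      have := norm_le_norm_add_norm_sub' y x
      rw [mem_closedBall_iff_norm] at hy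
      linarith
    obtain ⟨B', hB', hB'c⟩ := hclose x (mem_ball_zero_iff.2 (by linarith))
    rw [← (hw (by linarith)).fderiv]
    refine norm_fderiv_le_of_abs_le (A := δ⁻¹ • (B' - B) - hess φ x) hρ
      (fun y hy => (hw (hsub y hy)).differentiableAt) (fun y hy => ?_)
      fun y hy => hdev y (mem_closedBall_zero_iff.2 (by linarith [hsub y hy]))
    rw [(hw (hsub y hy)).fderiv, (hw (by linarith)).fderiv]
    have e : δ⁻¹ • (fderiv ℝ u y - B y) - fderiv ℝ φ y - (δ⁻¹ • (fderiv ℝ u x - B x) - fderiv ℝ φ x)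
        - (δ⁻¹ • (B' - B) - hess φ x) (y - x)
        = δ⁻¹ • (fderiv ℝ u y - fderiv ℝ u x - B' (y - x))
          - (fderiv ℝ φ y - fderiv ℝ φ x - hess φ x (y - x)) := by
      simp only [sub_apply, smul_apply, map_sub]
      module
    rw [e]
    refine (norm_sub_le _ _).trans (add_le_add ?_ ?_)
    · rw [norm_smul, norm_inv, Real.norm_of_nonneg hδ.le, inv_mul_le_iff₀ hδ]
      exact hB'c y hy
    · refine (hT y x (hsub y hy) (by linarith)).trans ?_
      have := mem_closedBall_iff_norm.1 hy
      gcongr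
  refine ⟨B + δ • hess φ 0, hB.add ((ContDiff.symm_hess hφ 0).smul δ), fun x hx => ?_⟩
  rw [mem_closedBall_zero_iff] at hx
  have k0 := key 0 (by simp)
  have k1 := key x (by linarith)
  have k2 := hT x 0 (by linarith) (by simp)
  rw [h1, map_zero, sub_self, smul_zero, zero_sub, norm_neg] at k0
  rw [sub_zero] at k2
  have e : fderiv ℝ u x - fderiv ℝ u 0 - (B + δ • hess φ 0) (x - 0)
      = δ • ((δ⁻¹ • (fderiv ℝ u x - B x) - fderiv ℝ φ x)
        + (fderiv ℝ φ x - fderiv ℝ φ 0 - hess φ 0 x) + fderiv ℝ φ 0) := by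
    simp only [smul_add, smul_sub, smul_inv_smul₀ hδ.ne', h1, add_apply, smul_apply, sub_zero]
    module
  rw [e, norm_smul, Real.norm_of_nonneg hδ.le, mul_comm ω, mul_assoc]
  refine mul_le_mul_of_nonneg_left ?_ hδ.le
  have k3 : L * ‖x‖ ^ 2 ≤ L * θ ^ 2 := by gcongr
  exact (norm_add₃_le).trans (by linarith)

end Improvement

section Improvement

variable {E : Type*} [NormedAddCommGroup E] [InnerProductSpace ℝ E]
  {F : Bil E → ℝ} {P : Bil E → Prop} [MeasurableSpace E] [BorelSpace E] [FiniteDimensional ℝ E]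
  {μ : Measure E} [μ.IsAddHaarMeasure] {K : ℝ≥0} {s : Set E} {u f : E → ℝ}

theorem C11.lipschitzOnWith_dev (h : C11 u K s) (hs : closedBall 0 1 ⊆ s) {B : Bil E} (hB : Symm B)
    {δ : ℝ} (hδ : 0 < δ) (hBδ : ∀ y ∈ closedBall (0 : E) 1, ‖fderiv ℝ u y - B y‖ ≤ δ) :
    LipschitzOnWith 1 (dev u B δ) (closedBall 0 1) :=
  (convex_closedBall 0 1).lipschitzOnWith_of_nnnorm_hasFDerivWithin_le
    (fun x hx => (h.hasFDerivAt_dev hB δ (hs hx)).hasFDerivWithinAt) fun x hx => by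
      rw [← NNReal.coe_le_coe, coe_nnnorm, norm_smul, norm_inv, Real.norm_of_nonneg hδ.le,
        inv_mul_le_iff₀ hδ, NNReal.coe_one, mul_one]
      exact hBδ x hx

theorem C11.norm_le_of_norm_sub_le [Nontrivial E] (h : C11 u K s) (hs : closedBall 0 1 ⊆ s)
    (h1 : fderiv ℝ u 0 = 0) {B : Bil E} {δ : ℝ}
    (hBδ : ∀ y ∈ closedBall (0 : E) 1, ‖fderiv ℝ u y - B y‖ ≤ δ) : ‖B‖ ≤ K + δ := by
  have hδ := (norm_nonneg _).trans (hBδ 0 (by simp))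
  refine B.opNorm_le_of_unit_norm (by positivity) fun x hx => ?_
  have hx1 : x ∈ closedBall (0 : E) 1 := by simp [hx]
  have e1 := h.norm_sub_le (hs hx1) (hs (by simp : (0 : E) ∈ closedBall 0 1))
  rw [h1, sub_zero, sub_zero, hx, mul_one] at e1
  have e2 := norm_sub_norm_le (B x) (fderiv ℝ u x)
  rw [norm_sub_rev] at e2
  linarith [hBδ x hx1]

theorem Sol.exists_pinching (h : Sol μ F P f K s u) {B : Bil E} (hB : Symm B) {δ τ : ℝ}
    (hδ : 0 < δ) (hs : closedBall 0 1 ⊆ s) (hfτ : ∀ x ∈ ball (0 : E) 1, |f x - f 0| ≤ τ)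
    (h0 : u 0 = 0) (hdev : ∀ x, ‖x‖ = 1 → |dev u B δ x| ≤ 1) :
    (∃ A, P A ∧ ‖A‖ ≤ K ∧ |F A - f 0| ≤ τ ∧ NonNeg (B + (4 * δ) • idForm E - A)) ∧
      ∃ A, P A ∧ ‖A‖ ≤ K ∧ |F A - f 0| ≤ τ ∧ NonNeg (A - (B - (4 * δ) • idForm E)) := by
  have hd0 : dev u B δ 0 = 0 := by simp [dev, quad, h0]
  constructor
  · obtain ⟨x, hx, h1, h2, h3, h4⟩ := h.exists_dev_touch_above
      (contDiff_quad 0 0 ((4 : ℝ) • idForm E)) hB hδ hs (a := 1) (fun x hx => by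
        rw [quad_smul_idForm, hx]
        linarith [(abs_le.1 (hdev x hx)).2]) (x₀ := 0) (by simp)
      (by rw [quad_smul_idForm, hd0]; simp)
    rw [hess_quad _ _ (symm_idForm.smul _), smul_smul, mul_comm δ] at h4
    exact ⟨_, h1, h3, h2 ▸ hfτ x hx, h4⟩
  · obtain ⟨x, hx, h1, h2, h3, h4⟩ := h.exists_dev_touch_below
      (contDiff_quad 0 0 ((-4 : ℝ) • idForm E)) hB hδ hs (a := 1) (fun x hx => by
        rw [quad_smul_idForm, hx]
        linarith [(abs_le.1 (hdev x hx)).1]) (x₀ := 0) (by simp)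
      (by rw [quad_smul_idForm, hd0]; simp)
    rw [hess_quad _ _ (symm_idForm.smul _), smul_smul, mul_comm δ, neg_mul, neg_smul,
      ← sub_eq_add_neg] at h4
    exact ⟨_, h1, h3, h2 ▸ hfτ x hx, h4⟩

theorem Elliptic.mem_of_tendsto (hE : Elliptic F P) {ι : Type*} {l : Filter ι} [l.NeBot]
    {u f : ι → E → ℝ} {B : ι → Bil E} {δ τ : ι → ℝ} (hsol : ∀ j, Sol μ F P (f j) K s (u j))
    (hB : ∀ j, Symm (B j)) (hδ : ∀ j, 0 < δ j) (hδ0 : Tendsto δ l (𝓝 0)) (hτ0 : Tendsto τ l (𝓝 0))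
    (hs : closedBall 0 1 ⊆ s) (hfτ : ∀ j, ∀ x ∈ ball (0 : E) 1, |f j x - f j 0| ≤ τ j)
    (h0 : ∀ j, u j 0 = 0) (hdev : ∀ j x, ‖x‖ = 1 → |dev (u j) (B j) (δ j) x| ≤ 1)
    {Q : Bil E} (hQ : Tendsto B l (𝓝 Q)) {f₀ : ℝ} (hf₀ : 0 < f₀)
    (hf : Tendsto (fun j => f j 0) l (𝓝 f₀)) : P Q ∧ F Q = f₀ := by
  have hev : ∀ ε > (0 : ℝ), ∀ᶠ j in l, ‖B j - Q‖ ≤ ε / 2 ∧ 4 * δ j ≤ ε / 2 ∧ τ j ≤ ε / 2 ∧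
      |f j 0 - f₀| ≤ ε / 2 := fun ε hε => by
    filter_upwards [(tendsto_iff_norm_sub_tendsto_zero.1 hQ).eventually (ge_mem_nhds (half_pos hε)),
      hδ0.eventually (ge_mem_nhds (by positivity : (0 : ℝ) < ε / 8)),
      hτ0.eventually (ge_mem_nhds (half_pos hε)),
      (tendsto_iff_norm_sub_tendsto_zero.1 hf).eventually (ge_mem_nhds (half_pos hε))]
      with j h1 h2 h3 h4
    exact ⟨h1, by linarith, h3, h4⟩
  have hid : ∀ t : ℝ, 0 ≤ t → NonNeg (t • idForm E) := fun t ht => nonNeg_idForm.smul ht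
  refine hE.mem_of_pinched (K := K) hf₀
    (isClosed_symm.mem_of_tendsto hQ (Eventually.of_forall hB)) ?_ ?_ <;> intro ε hε
  · obtain ⟨j, h1, h2, h3, h4⟩ := (hev ε hε).exists
    obtain ⟨A, k1, k2, k3, k4⟩ :=
      ((hsol j).exists_pinching (hB j) (hδ j) hs (hfτ j) (h0 j) (hdev j)).1
    refine ⟨A, k1, k2, (abs_sub_le _ (f j 0) _).trans (by linarith), ?_⟩
    have e : Q + ε • idForm E - A = ((ε / 2) • idForm E + (Q - B j)) +
        ((ε / 2 - 4 * δ j) • idForm E + (B j + (4 * δ j) • idForm E - A)) := by module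
    rw [e]
    exact (nonNeg_of_norm_le (by rwa [norm_sub_rev])).add ((hid _ (by linarith)).add k4)
  · obtain ⟨j, h1, h2, h3, h4⟩ := (hev ε hε).exists
    obtain ⟨A, k1, k2, k3, k4⟩ :=
      ((hsol j).exists_pinching (hB j) (hδ j) hs (hfτ j) (h0 j) (hdev j)).2
    refine ⟨A, k1, k2, (abs_sub_le _ (f j 0) _).trans (by linarith), ?_⟩
    have e : A - (Q - ε • idForm E) = ((ε / 2) • idForm E + (B j - Q)) +
        ((ε / 2 - 4 * δ j) • idForm E + (A - (B j - (4 * δ j) • idForm E))) := by module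
    rw [e]
    exact (nonNeg_of_norm_le h1).add ((hid _ (by linarith)).add k4)

end Improvement

section Improvement

variable {E : Type*} [NormedAddCommGroup E] [InnerProductSpace ℝ E]
  {F : Bil E → ℝ} {P : Bil E → Prop} [MeasurableSpace E] [BorelSpace E] [FiniteDimensional ℝ E]
  {μ : Measure E} [μ.IsAddHaarMeasure] {K : ℝ≥0} {s : Set E} {u f : E → ℝ}

theorem Elliptic.exists_close [Nontrivial E] (hE : Elliptic F P) {lam c C : ℝ} (hlam : 0 < lam)
    (hc : 0 < c) (hC : 0 < C)
    (hell : ∀ A, P A → ‖A‖ ≤ K + 1 → lam ≤ F A → fderiv ℝ F A ∈ Ell c C)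
    {θ ρ η ω : ℝ} (hθ : 0 < θ) (hθ' : θ ≤ 1 / 8) (hρ : 0 < ρ) (hρ' : ρ ≤ 1 / 8) (hη : 0 < η)
    (hη' : η ≤ 1)
    (hsmall : 2 * (2 * η / ρ + (ρ + (16 * (C / c + 1)) ^ 3 * ((4 * C + 2) * (1 + 1 / c)) * ρ ^ 2))
      + (16 * (C / c + 1)) ^ 3 * ((4 * C + 2) * (1 + 1 / c)) * θ ^ 2 ≤ ω * θ)
    {ι : Type*} (l : Ultrafilter ι) {u f : ι → E → ℝ} {δ σ : ι → ℝ} (hδ : ∀ j, 0 < δ j)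
    (hδ0 : Tendsto δ l (𝓝 0)) (hσ0 : Tendsto σ l (𝓝 0))
    (hsol : ∀ j, Sol μ F P (f j) K s (u j)) (hs : closedBall 0 1 ⊆ s)
    (h0 : ∀ j, u j 0 = 0) (h1 : ∀ j, fderiv ℝ (u j) 0 = 0)
    (hlamf : ∀ j, ∀ x ∈ ball (0 : E) 1, lam ≤ f j x)
    (hfσ : ∀ j, ∀ x ∈ ball (0 : E) 1, |f j x - f j 0| ≤ σ j * δ j)
    (hcl0 : ∀ j, Close (u j) 0 1 (δ j))
    (hcl : ∀ j, ∀ y ∈ ball (0 : E) (1 / 2), Close (u j) y ρ (δ j)) :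
    ∃ j, Close (u j) 0 θ (ω * δ j) := by
  set L := (16 * (C / c + 1)) ^ 3 * ((4 * C + 2) * (1 + 1 / c)) with hLdef
  have hL : 0 ≤ L := by positivity
  choose B hB hBδ' using hcl0
  have hBδ : ∀ j, ∀ y ∈ closedBall (0 : E) 1, ‖fderiv ℝ (u j) y - B j y‖ ≤ δ j := fun j y hy => by
    simpa [h1 j] using hBδ' j y hy
  have hlip : ∀ j, LipschitzOnWith 1 (dev (u j) (B j) (δ j)) (closedBall 0 1) := fun j =>
    (hsol j).c11.lipschitzOnWith_dev hs (hB j) (hδ j) (hBδ j)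
  have hdev : ∀ j, ∀ x ∈ closedBall (0 : E) 1, ‖dev (u j) (B j) (δ j) x‖ ≤ 1 := fun j x hx => by
    have := (hlip j).norm_sub_le hx (by simp : (0 : E) ∈ closedBall 0 1)
    have hd0 : dev (u j) (B j) (δ j) 0 = 0 := by simp [dev, quad, h0 j]
    rw [hd0, sub_zero, sub_zero, NNReal.coe_one, one_mul] at this
    exact this.trans (mem_closedBall_zero_iff.1 hx)
  have hdevs : ∀ j x, ‖x‖ = 1 → |dev (u j) (B j) (δ j) x| ≤ 1 := fun j x hx =>
    hdev j x (by simp [hx])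
  have hτ0 : Tendsto (fun j => σ j * δ j) l (𝓝 0) := by simpa using hσ0.mul hδ0
  have hδ1 : ∀ᶠ j in l, δ j ≤ 1 := hδ0.eventually (ge_mem_nhds one_pos)
  obtain ⟨Q, hQn, hQ⟩ := Ultrafilter.exists_tendsto_of_bounded l (g := B) (C := K + 1)
    (hδ1.mono fun j hj => ((hsol j).c11.norm_le_of_norm_sub_le hs (h1 j) (hBδ j)).trans
      (by linarith))
  obtain ⟨M₀, hM₀⟩ := (isCompact_closedBall (0 : Bil E) K).exists_bound_of_continuousOn
    hE.contDiff.continuous.continuousOn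
  obtain ⟨f₀, -, hf₀⟩ := Ultrafilter.exists_tendsto_of_bounded l (g := fun j => f j 0)
    (C := M₀ + 1) ((hτ0.eventually (ge_mem_nhds one_pos)).mono fun j hj => by
      obtain ⟨A, -, k2, k3, -⟩ := ((hsol j).exists_pinching (hB j) (hδ j) hs (hfσ j) (h0 j)
        (hdevs j)).1
      have := norm_sub_norm_le (f j 0) (F A)
      rw [norm_sub_rev, Real.norm_eq_abs (F A - f j 0)] at this
      linarith [hM₀ A (by simpa using k2)])
  have hlamf₀ : lam ≤ f₀ := ge_of_tendsto' hf₀ fun j => hlamf j 0 (by simp)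
  have hpos : ∀ j, ∀ x ∈ ball (0 : E) 1, 0 < f j x := fun j x hx => hlam.trans_le (hlamf j x hx)
  obtain ⟨hPQ, hFQ⟩ := hE.mem_of_tendsto hsol hB hδ hδ0 hτ0 hs hfσ h0 hdevs hQ
    (hlam.trans_le hlamf₀) hf₀
  have hFQ0 : 0 < F Q := by rw [hFQ]; linarith
  have hℓ := hell Q hPQ hQn (by rw [hFQ]; exact hlamf₀)
  have hBQ : ∀ r > 0, ∀ᶠ j in l, ‖B j - Q‖ ≤ r := fun r hr =>
    (tendsto_iff_norm_sub_tendsto_zero.1 hQ).eventually (ge_mem_nhds hr)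
  have hδr : ∀ m r : ℝ, 0 < r → ∀ᶠ j in l, δ j * m ≤ r := fun m r hr => by
    have : Tendsto (fun j => δ j * m) l (𝓝 0) := by simpa using hδ0.mul_const m
    exact this.eventually (ge_mem_nhds hr)
  obtain ⟨r₁, hr₁, hexp₁⟩ := hE.exists_expansion hPQ hFQ0 (ε := 1 / 8) (by norm_num)
  obtain ⟨κ, hκb, hκ⟩ := Ultrafilter.exists_tendsto_of_bounded l
    (g := fun j => (F (B j) - f j 0) / δ j) (C := 4 * C + 2) (by
      filter_upwards [hBQ r₁ hr₁, hδr 4 r₁ hr₁, hσ0.eventually (ge_mem_nhds one_pos)]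
        with j j1 j2 j3
      have := (hsol j).abs_div_le hE (by norm_num) hexp₁ hC.le hℓ (hB j) j1 (hδ j) j2 hs (hpos j)
        (hfσ j) (h0 j) (hdevs j)
      rw [Real.norm_eq_abs]
      linarith)
  have hVex : ∀ x : E, ∃ a, x ∈ closedBall (0 : E) 1 →
      |a| ≤ 1 ∧ Tendsto (fun j => dev (u j) (B j) (δ j) x) l (𝓝 a) := fun x => by
    by_cases hx : x ∈ closedBall (0 : E) 1
    · obtain ⟨a, ha, hla⟩ := Ultrafilter.exists_tendsto_of_bounded l
        (g := fun j => dev (u j) (B j) (δ j) x) (Eventually.of_forall fun j => hdev j x hx)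
      exact ⟨a, fun _ => ⟨ha, hla⟩⟩
    · exact ⟨0, fun h => absurd h hx⟩
  choose V hV using hVex
  have hVlim := eventually_dist_le_of_lipschitzOnWith (isCompact_closedBall (0 : E) 1)
    (Eventually.of_forall hlip) (fun x hx => (hV x hx).2) (half_pos hη)
  have hVc : ContinuousOn V (sphere 0 1) := (LipschitzOnWith.of_tendsto (Eventually.of_forall hlip)
    fun x hx => (hV x hx).2).continuousOn.mono sphere_subset_closedBall
  obtain ⟨h, hh, hhκ, hhV⟩ := Ell.exists_approx_dirichlet hc hℓ hVc (-κ) (half_pos hη)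
  have hh2 : ContDiff ℝ 2 h := hh.of_le le_top
  have hhm : ∀ x : E, ‖x‖ = 1 → |h x| ≤ 4 * C + 2 := fun x hx => by
    have e1 := abs_le.1 (hV x (by simp [hx])).1
    have e2 := abs_le.1 (hhV x hx)
    rw [abs_le]
    constructor <;> linarith [e1.1, e1.2, e2.1, e2.2]
  have hT : ∀ x y : E, ‖x‖ ≤ 1 / 4 → ‖y‖ ≤ 1 / 4 →
      ‖fderiv ℝ h x - fderiv ℝ h y - hess h y (x - y)‖ ≤ L * ‖x - y‖ ^ 2 := fun x y hx hy =>
    Ell.norm_taylor_le hc hℓ hC.le hh hhκ (by positivity) hhm (by rw [abs_neg]; exact hκb) hx hy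
  have hhc : Continuous (hess h) :=
    (hh2.fderiv_right (m := 1) (by norm_num)).continuous_fderiv one_ne_zero
  obtain ⟨M, hM⟩ := (isCompact_closedBall (0 : E) 1).exists_bound_of_continuousOn
    hhc.continuousOn
  have hM0 : 0 ≤ M := (norm_nonneg _).trans (hM 0 (by simp))
  obtain ⟨r₂, hr₂, hexp₂⟩ := hE.exists_expansion hPQ hFQ0 (ε := η * c / (2 * (M + 2 * η)))
    (by positivity)
  have hηc : 0 < η * c / 2 := by positivity
  obtain ⟨j, j1, j2, j3, j4, j5⟩ := ((hBQ r₂ hr₂).and ((hδr (M + 2 * η) r₂ hr₂).and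
    (((tendsto_iff_norm_sub_tendsto_zero.1 hκ).eventually (gt_mem_nhds hηc)).and
    ((hσ0.eventually (gt_mem_nhds hηc)).and hVlim)))).exists
  refine ⟨j, close_of_abs_dev_sub_le (hsol j).c11 (hB j) (hδ j) (ball_subset_closedBall.trans hs)
    (h1 j) hh2 hT hL ?_ (hcl j) hθ hθ' hρ hρ' hsmall⟩
  refine (hsol j).abs_dev_sub_le hE (by positivity) hexp₂ hc hℓ (hB j) j1 (hδ j) hs (hpos j)
    (hfσ j) hh2 hη hhκ (fun x hx => hM x (ball_subset_closedBall hx)) j2 ?_ fun x hx => ?_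
  · have : η * c / (2 * (M + 2 * η)) * (M + 2 * η) = η * c / 2 := by field_simp
    rw [this]
    rw [Real.norm_eq_abs] at j3
    linarith
  · have e1 := j5 x (by simp [hx])
    rw [Real.dist_eq] at e1
    have e2 := hhV x hx
    rw [abs_sub_comm] at e2
    exact (abs_sub_le _ (V x) _).trans (by linarith)

theorem exists_scales {L α : ℝ} (hL : 0 ≤ L) (hα1 : α < 1) :
    ∃ θ : ℝ, 0 < θ ∧ θ ≤ 1 / 8 ∧ ∃ ρ : ℝ, 0 < ρ ∧ ρ ≤ 1 / 8 ∧ ∃ η : ℝ, 0 < η ∧ η ≤ 1 ∧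
      2 * (2 * η / ρ + (ρ + L * ρ ^ 2)) + L * θ ^ 2 ≤ θ ^ α * θ := by
  have hlim : Tendsto (fun t : ℝ => L * t ^ (1 - α)) (𝓝[>] 0) (𝓝 0) := by
    have h : Tendsto (fun t : ℝ => t ^ (1 - α)) (𝓝 0) (𝓝 (0 ^ (1 - α))) :=
      (Real.continuousAt_rpow_const _ _ (Or.inr (by linarith)))
    rw [Real.zero_rpow (by linarith)] at h
    simpa using (h.const_mul L).mono_left nhdsWithin_le_nhds
  obtain ⟨θ, ⟨hθ1, hθ0⟩, hθ8⟩ := ((hlim.eventually (ge_mem_nhds (half_pos one_pos))).and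
    self_mem_nhdsWithin |>.and (mem_nhdsWithin_of_mem_nhds
      (ge_mem_nhds (by norm_num : (0 : ℝ) < 1 / 8)))).exists
  have hθ : 0 < θ := hθ0
  set ω := θ ^ α * θ with hω
  have hω0 : 0 < ω := by positivity
  have hLθ : L * θ ^ 2 ≤ ω / 2 := by
    have h : θ ^ (1 - α) * θ ^ α = θ := by rw [← Real.rpow_add hθ]; simp
    calc L * θ ^ 2 = L * θ ^ (1 - α) * ω := by rw [hω, sq]; nth_rewrite 1 [← h]; ring
      _ ≤ 1 / 2 * ω := mul_le_mul_of_nonneg_right hθ1 hω0.le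
      _ = ω / 2 := by ring
  have hLω : 0 < ω / (8 * (1 + L)) := by positivity
  refine ⟨θ, hθ, hθ8, min (1 / 8) (ω / (8 * (1 + L))), by positivity, min_le_left _ _, ?_⟩
  set ρ := min (1 / 8) (ω / (8 * (1 + L))) with hρ
  have hρ0 : 0 < ρ := by positivity
  have hρ1 : ρ ≤ 1 / 8 := min_le_left _ _
  have hρω : ρ * (1 + L) ≤ ω / 8 := by
    have h : ρ ≤ ω / (8 * (1 + L)) := min_le_right _ _
    rw [le_div_iff₀ (by positivity)] at h
    linarith
  have hρL : L * ρ ^ 2 ≤ L * ρ := by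
    refine mul_le_mul_of_nonneg_left ?_ hL
    nlinarith
  refine ⟨min 1 (ρ * ω / 16), by positivity, min_le_left _ _, ?_⟩
  have hη : 2 * min 1 (ρ * ω / 16) / ρ ≤ ω / 8 := by
    rw [div_le_iff₀ hρ0]
    linarith [min_le_right 1 (ρ * ω / 16)]
  linarith

theorem Elliptic.exists_improvement [Nontrivial E] (hE : Elliptic F P) (μ : Measure E)
    [μ.IsAddHaarMeasure] (K : ℝ≥0) {lam : ℝ} (hlam : 0 < lam) {α : ℝ} (hα1 : α < 1) :
    ∃ θ : ℝ, 0 < θ ∧ θ ≤ 1 / 8 ∧ ∃ δ₀ : ℝ, 0 < δ₀ ∧ ∃ σ : ℝ, 0 < σ ∧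
      ∀ (u f : E → ℝ) (δ : ℝ), 0 < δ → δ ≤ δ₀ → Sol μ F P f K (ball 0 2) u → u 0 = 0 → fderiv ℝ u 0 = 0 → (∀ x ∈ ball (0 : E) 1, lam ≤ f x) →
      (∀ x ∈ ball (0 : E) 1, |f x - f 0| ≤ σ * δ) → Close u 0 1 δ →
      (∀ y ∈ ball (0 : E) (1 / 2), ∀ ρ : ℝ, 0 < ρ → ρ ≤ 1 / 2 → Close u y ρ δ) →
      Close u 0 θ (θ ^ α * δ) := by
  obtain ⟨c, hc, C, hC, hell⟩ := hE.exists_ell (K + 1) hlam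
  obtain ⟨θ, hθ, hθ', ρ, hρ, hρ', η, hη, hη', hsmall⟩ := exists_scales (α := α)
    (L := (16 * (C / c + 1)) ^ 3 * ((4 * C + 2) * (1 + 1 / c))) (by positivity) hα1
  refine ⟨θ, hθ, hθ', ?_⟩
  by_contra! hcon
  have hpos : ∀ j : ℕ, (0 : ℝ) < 1 / ((j : ℝ) + 1) := fun j => by positivity
  choose u f δ hδ hδj hsol h0 h1 hlamf hfσ hcl0 hcl hnot using fun j : ℕ =>
    hcon _ (hpos j) _ (hpos j)
  have hlim : Tendsto (fun j : ℕ => 1 / ((j : ℝ) + 1)) (hyperfilter ℕ) (𝓝 0) :=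
    tendsto_one_div_add_atTop_nhds_zero_nat.mono_left Nat.hyperfilter_le_atTop
  obtain ⟨j, hj⟩ := hE.exists_close hlam hc hC hell hθ hθ' hρ hρ' hη hη' hsmall (hyperfilter ℕ)
    hδ (squeeze_zero (fun j => (hδ j).le) hδj hlim) hlim hsol (closedBall_subset_ball one_lt_two) h0 h1 hlamf hfσ hcl0
    fun j y hy => hcl j y hy ρ hρ (by linarith)
  exact hnot j hj

end Improvement

section Regularity

variable {E : Type*} [NormedAddCommGroup E] [InnerProductSpace ℝ E]
  {F : Bil E → ℝ} {P : Bil E → Prop} [MeasurableSpace E] [BorelSpace E] [FiniteDimensional ℝ E]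
  {μ : Measure E} [μ.IsAddHaarMeasure] {K : ℝ≥0} {s : Set E} {u f : E → ℝ}

theorem Elliptic.exists_close_of_isCompact [Nontrivial E] (hE : Elliptic F P)
    (h : Sol μ F P f K s u) (hfc : ContinuousOn f s) (hpos : ∀ x ∈ s, 0 < f x) {k : Set E}
    (hk : IsCompact k) (hks : k ⊆ s) {δ : ℝ} (hδ : 0 < δ) :
    ∃ r : ℝ, 0 < r ∧ ∀ z ∈ k, ∀ ρ : ℝ, 0 < ρ → ρ ≤ r → Close u z ρ δ := by
  by_contra! hcon
  choose z hz ρ hρ hρj hnot using fun j : ℕ => hcon (1 / ((j : ℝ) + 1)) (by positivity)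
  have hlim : Tendsto ρ (hyperfilter ℕ) (𝓝 0) :=
    (squeeze_zero (fun j => (hρ j).le) hρj tendsto_one_div_add_atTop_nhds_zero_nat).mono_left
      Nat.hyperfilter_le_atTop
  obtain ⟨z₀, hz₀, hzl⟩ := hk.ultrafilter_le_nhds ((hyperfilter ℕ).map z) (by
    rw [le_principal_iff]; exact Filter.mem_map.2 (Filter.univ_mem' hz))
  have hzl : Tendsto z (hyperfilter ℕ) (𝓝 z₀) := hzl
  have hmem : ∀ t ∈ 𝓝 z₀, ∀ R : ℝ, ∀ᶠ j in hyperfilter ℕ, ∀ x ∈ ball (0 : E) R,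
      z j + ρ j • x ∈ t := fun t ht R => by
    obtain ⟨d, hd, hdt⟩ := Metric.mem_nhds_iff.1 ht
    have h1 : Tendsto (fun j => ‖z j - z₀‖ + ρ j * R) (hyperfilter ℕ) (𝓝 0) := by
      simpa using (tendsto_iff_norm_sub_tendsto_zero.1 hzl).add (hlim.mul_const R)
    filter_upwards [h1.eventually (gt_mem_nhds hd)] with j hj x hx
    refine hdt (mem_ball_iff_norm.2 ?_)
    rw [add_sub_right_comm]
    refine (norm_add_le _ _).trans_lt (lt_of_le_of_lt ?_ hj)
    rw [norm_smul, Real.norm_of_nonneg (hρ j).le]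
    have := (mem_ball_zero_iff.1 hx).le
    gcongr
    exact (hρ j).le
  have hs : s ∈ 𝓝 z₀ := h.isOpen.mem_nhds (hks hz₀)
  have hsolj : ∀ R, ∀ᶠ j in hyperfilter ℕ,
      Sol μ F P (fun x => f (z j + ρ j • x)) K (ball 0 R) (blow u (z j) (ρ j)) := fun R =>
    (hmem s hs R).mono fun j hj => (h.blow (hρ j).ne' (z j)).mono isOpen_ball hj
  have hfd0 : ∀ j, fderiv ℝ (blow u (z j) (ρ j)) 0 = 0 := fun j => by
    have h1 : DifferentiableAt ℝ u (z j + ρ j • 0) := by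
      simpa using h.c11.diff _ (hks (hz j))
    rw [fderiv_blow (hρ j).ne' h1, smul_zero, add_zero, sub_self, smul_zero]
  obtain ⟨U, hU, hU0, hU1, hUlim⟩ := exists_limit (hyperfilter ℕ)
    (u := fun j => blow u (z j) (ρ j)) (fun R => (hsolj R).mono fun j hj => hj.c11)
    (fun j => blow_zero _ _ _) hfd0
  have hUsol := hE.stability (hpos _ (hks hz₀)) hsolj (fun R ε hε => by
    have h1 : {x | |f x - f z₀| ≤ ε} ∈ 𝓝 z₀ :=
      (tendsto_iff_norm_sub_tendsto_zero.1 (hfc.continuousAt hs)).eventually (ge_mem_nhds hε)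
    exact hmem _ h1 R) hU fun R ε hε => (hUlim R ε hε).mono fun j hj x hx => (hj x hx).1
  obtain ⟨B, hB, -, -, hUB⟩ := hE.liouville (hpos _ (hks hz₀)) hUsol hU0 hU1
  obtain ⟨j, hj, hjs⟩ := ((hUlim 1 δ hδ).and (hmem s hs 2)).exists
  refine hnot j ⟨B, hE.symm _ hB, fun y hy => ?_⟩
  set x := (ρ j)⁻¹ • (y - z j) with hx
  have hyx : z j + ρ j • x = y := by rw [hx, smul_inv_smul₀ (hρ j).ne']; abel
  have hx1 : x ∈ closedBall (0 : E) 1 := by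
    rw [mem_closedBall_zero_iff, hx, norm_smul, norm_inv, Real.norm_of_nonneg (hρ j).le,
      inv_mul_le_iff₀ (hρ j), mul_one]
    exact mem_closedBall_iff_norm.1 hy
  have h1 := (hj x hx1).2
  rw [fderiv_blow (hρ j).ne' (h.c11.diff _ (hjs x (closedBall_subset_ball one_lt_two hx1))), hyx,
    hUB, hx, map_smul, ← smul_sub, norm_smul, norm_inv, Real.norm_of_nonneg (hρ j).le,
    inv_mul_le_iff₀ (hρ j), mul_comm] at h1
  exact h1

theorem C11.close_blow_iff (h : C11 u K s) {z y : E} {r ρ δ : ℝ} (hr : 0 < r) (hρ : 0 ≤ ρ)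
    (hs : ∀ x ∈ closedBall y ρ, z + r • x ∈ s) :
    Close (EvansKrylov.blow u z r) y ρ δ ↔ Close u (z + r • y) (r * ρ) δ := by
  have key : ∀ (B : Bil E), ∀ x ∈ closedBall y ρ,
      (‖fderiv ℝ (EvansKrylov.blow u z r) x - fderiv ℝ (EvansKrylov.blow u z r) y - B (x - y)‖ ≤ δ * ρ ↔
        ‖fderiv ℝ u (z + r • x) - fderiv ℝ u (z + r • y) - B (z + r • x - (z + r • y))‖
          ≤ δ * (r * ρ)) := fun B x hx => by
    rw [fderiv_blow hr.ne' (h.diff _ (hs x hx)),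
      fderiv_blow hr.ne' (h.diff _ (hs y (mem_closedBall_self hρ)))]
    have e : r⁻¹ • (fderiv ℝ u (z + r • x) - fderiv ℝ u z)
        - r⁻¹ • (fderiv ℝ u (z + r • y) - fderiv ℝ u z) - B (x - y)
        = r⁻¹ • (fderiv ℝ u (z + r • x) - fderiv ℝ u (z + r • y)
          - B (z + r • x - (z + r • y))) := by
      rw [add_sub_add_left_eq_sub, ← smul_sub r, map_smul, smul_sub r⁻¹ _ (r • _),
        inv_smul_smul₀ hr.ne']
      module
    rw [e, norm_smul, norm_inv, Real.norm_of_nonneg hr.le, inv_mul_le_iff₀ hr]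
    ring_nf
  refine exists_congr fun B => and_congr_right fun _ => ⟨fun hB w hw => ?_, fun hB x hx => ?_⟩
  · have hw' : z + r • (r⁻¹ • (w - z)) = w := by rw [smul_inv_smul₀ hr.ne']; abel
    have hx : r⁻¹ • (w - z) ∈ closedBall y ρ := by
      have e : r⁻¹ • (w - z) - y = r⁻¹ • (w - (z + r • y)) := by
        rw [← sub_sub, smul_sub r⁻¹ _ (r • y), inv_smul_smul₀ hr.ne']
      rw [mem_closedBall_iff_norm, e, norm_smul, norm_inv, Real.norm_of_nonneg hr.le,
        inv_mul_le_iff₀ hr]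
      exact mem_closedBall_iff_norm.1 hw
    have := (key B _ hx).1 (hB _ hx)
    rwa [hw'] at this
  · refine (key B x hx).2 (hB _ ?_)
    rw [mem_closedBall_iff_norm, add_sub_add_left_eq_sub, ← smul_sub, norm_smul,
      Real.norm_of_nonneg hr.le]
    exact mul_le_mul_of_nonneg_left (mem_closedBall_iff_norm.1 hx) hr.le

end Regularity

section Regularity

variable {E : Type*} [NormedAddCommGroup E] [InnerProductSpace ℝ E]
  {F : Bil E → ℝ} {P : Bil E → Prop} [MeasurableSpace E] [BorelSpace E] [FiniteDimensional ℝ E]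
  {μ : Measure E} [μ.IsAddHaarMeasure] {K : ℝ≥0} {s : Set E} {u f : E → ℝ}

theorem Elliptic.exists_close_pow [Nontrivial E] (hE : Elliptic F P) {z₀ : E} {R : ℝ} (hR : 0 < R)
    (h : Sol μ F P f K (ball z₀ (4 * R)) u) {lam : ℝ} (hlam : 0 < lam)
    (hlamf : ∀ x ∈ ball z₀ (4 * R), lam ≤ f x) {Cf α : ℝ≥0} (hα : 0 < α) (hα1 : α < 1)
    (hf : HolderOnWith Cf α f (ball z₀ (4 * R))) :
    ∃ θ : ℝ, 0 < θ ∧ θ < 1 ∧ ∃ r : ℝ, 0 < r ∧ ∃ δ : ℝ, 0 < δ ∧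
      ∀ k : ℕ, ∀ z ∈ ball z₀ R, ∀ ρ : ℝ, 0 < ρ → ρ ≤ θ ^ k * r →
        Close u z ρ ((θ ^ (α : ℝ)) ^ k * δ) := by
  have hαr : (0 : ℝ) < α := hα
  obtain ⟨θ, hθ, hθ', δ, hδ, σ, hσ, himp⟩ := hE.exists_improvement μ K hlam (α := α) (by exact_mod_cast hα1)
  obtain ⟨r₀, hr₀, hinit⟩ := hE.exists_close_of_isCompact h (hf.continuousOn hα)
    (fun x hx => hlam.trans_le (hlamf x hx)) (isCompact_closedBall z₀ (2 * R))
    (closedBall_subset_ball (by linarith)) hδ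
  have hlim : Tendsto (fun t : ℝ => Cf * (2 * t) ^ (α : ℝ)) (𝓝[>] 0) (𝓝 0) := by
    have h : Tendsto (fun t : ℝ => t ^ (α : ℝ)) (𝓝 0) (𝓝 (0 ^ (α : ℝ))) :=
      (Real.continuousAt_rpow_const _ _ (Or.inr hαr.le))
    rw [Real.zero_rpow hαr.ne'] at h
    have h2 : Tendsto (fun t : ℝ => 2 * t) (𝓝 0) (𝓝 0) := by
      simpa using (tendsto_id (x := 𝓝 (0 : ℝ))).const_mul 2
    simpa using ((h.comp h2).const_mul (Cf : ℝ)).mono_left nhdsWithin_le_nhds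
  have hnear : ∀ a : ℝ, 0 < a → ∀ᶠ t in 𝓝[>] (0 : ℝ), t ≤ a := fun a ha =>
    mem_nhdsWithin_of_mem_nhds (ge_mem_nhds ha)
  have hIoi : ∀ᶠ t in 𝓝[>] (0 : ℝ), t ∈ Ioi 0 := self_mem_nhdsWithin
  obtain ⟨r, hrf, hr', hr₀', hrR⟩ := ((hlim.eventually (ge_mem_nhds (mul_pos hσ hδ))).and
    (hIoi.and
      ((hnear _ hr₀).and (hnear _ (half_pos hR))))).exists
  have hr : 0 < r := hr'
  have hω : 0 < θ ^ (α : ℝ) := by positivity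
  have hω1 : θ ^ (α : ℝ) ≤ 1 := Real.rpow_le_one hθ.le (by linarith) hαr.le
  have key : ∀ k : ℕ, ∀ z ∈ ball z₀ (R * (1 + (1 / 2) ^ k)), ∀ ρ : ℝ, 0 < ρ → ρ ≤ θ ^ k * r →
      Close u z ρ ((θ ^ (α : ℝ)) ^ k * δ) := by
    intro k
    induction k with
    | zero =>
      intro z hz ρ hρ hρr
      rw [pow_zero, one_mul] at hρr ⊢
      refine hinit z (ball_subset_closedBall ?_) ρ hρ (hρr.trans hr₀')
      rwa [pow_zero, show R * (1 + 1) = 2 * R by ring] at hz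
    | succ k ih =>
      intro z hz ρ hρ hρr
      set t := ρ / θ with ht
      have ht0 : 0 < t := by positivity
      have htr : t ≤ θ ^ k * r := by
        rw [ht, div_le_iff₀ hθ]
        calc ρ ≤ θ ^ (k + 1) * r := hρr
          _ = θ ^ k * r * θ := by ring
      have hθk : θ ^ k ≤ (1 / 2) ^ k := pow_le_pow_left₀ hθ.le (by linarith) k
      have hk1 : ((1 : ℝ) / 2) ^ k ≤ 1 := pow_le_one₀ (by norm_num) (by norm_num)
      have htR : t ≤ R * (1 / 2) ^ (k + 1) := by
        calc t ≤ θ ^ k * r := htr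
          _ ≤ (1 / 2) ^ k * (R / 2) := by gcongr
          _ = R * (1 / 2) ^ (k + 1) := by ring
      have htR' : t ≤ R / 2 := by
        refine htR.trans ?_
        rw [pow_succ]
        nlinarith
      have hz2 : ‖z - z₀‖ < 2 * R := by
        have := mem_ball_iff_norm.1 hz
        rw [pow_succ] at this
        nlinarith
      have hsub : ∀ x ∈ ball (0 : E) 2, z + t • x ∈ ball z₀ (4 * R) := fun x hx => by
        rw [mem_ball_iff_norm, add_sub_right_comm]
        refine (norm_add_le _ _).trans_lt ?_
        rw [norm_smul, Real.norm_of_nonneg ht0.le]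
        have := (mem_ball_zero_iff.1 hx).le
        nlinarith
      have hzs : z ∈ ball z₀ (4 * R) := by simpa using hsub 0 (by simp)
      have hδk : 0 < (θ ^ (α : ℝ)) ^ k * δ := by positivity
      have hfin := himp (blow u z t) (fun x => f (z + t • x)) ((θ ^ (α : ℝ)) ^ k * δ) hδk
        (mul_le_of_le_one_left hδ.le (pow_le_one₀ hω.le hω1))
        ((h.blow ht0.ne' z).mono isOpen_ball hsub) (blow_zero _ _ _)
        (by
          have h1 : DifferentiableAt ℝ u (z + t • 0) := by simpa using h.c11.diff _ hzs
          rw [fderiv_blow ht0.ne' h1, smul_zero, add_zero, sub_self, smul_zero])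
        (fun x hx => hlamf _ (hsub x (ball_subset_ball one_le_two hx)))
        (fun x hx => by
          have e1 := hf.dist_le (hsub x (ball_subset_ball one_le_two hx)) (hsub 0 (by simp))
          rw [Real.dist_eq] at e1
          refine e1.trans ?_
          have e2 : dist (z + t • x) (z + t • 0) ≤ θ ^ k * (2 * r) := by
            rw [dist_add_left, dist_eq_norm, smul_zero, sub_zero, norm_smul,
              Real.norm_of_nonneg ht0.le]
            have := (mem_ball_zero_iff.1 hx).le
            have h3 : 0 < θ ^ k * r := by positivity
            nlinarith [norm_nonneg x]
          calc (Cf : ℝ) * dist (z + t • x) (z + t • 0) ^ (α : ℝ)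
              ≤ Cf * (θ ^ k * (2 * r)) ^ (α : ℝ) := by gcongr
            _ = (θ ^ (α : ℝ)) ^ k * (Cf * (2 * r) ^ (α : ℝ)) := by
                rw [Real.mul_rpow (by positivity) (by positivity), ← Real.rpow_pow_comm hθ.le]; ring
            _ ≤ (θ ^ (α : ℝ)) ^ k * (σ * δ) := by gcongr
            _ = σ * ((θ ^ (α : ℝ)) ^ k * δ) := by ring)
        ((h.c11.close_blow_iff ht0 zero_le_one fun x hx =>
            hsub x (closedBall_subset_ball one_lt_two hx)).2 (by
          rw [smul_zero, add_zero, mul_one]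
          refine ih z (ball_subset_ball ?_ hz) t ht0 htr
          rw [pow_succ]
          nlinarith [show (0 : ℝ) < (1 / 2) ^ k by positivity]))
        (fun y hy ρ' hρ' hρ'' => (h.c11.close_blow_iff ht0 hρ'.le fun x hx => hsub x (by
            have e1 := mem_ball_zero_iff.1 hy
            have e2 := mem_closedBall_iff_norm.1 hx
            have e3 := norm_le_norm_add_norm_sub' x y
            exact mem_ball_zero_iff.2 (by linarith))).2 (by
          refine ih _ ?_ _ (by positivity) (by nlinarith)
          have e0 := mem_ball_iff_norm.1 hz
          have e1 := mem_ball_zero_iff.1 hy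
          rw [mem_ball_iff_norm, add_sub_right_comm]
          refine (norm_add_le _ _).trans_lt ?_
          rw [norm_smul, Real.norm_of_nonneg ht0.le]
          have e2 : t * ‖y‖ ≤ t * (1 / 2) := by gcongr
          rw [pow_succ] at e0 htR
          nlinarith))
      rw [h.c11.close_blow_iff ht0 hθ.le fun x hx => hsub x
        (closedBall_subset_ball (by linarith) hx), smul_zero, add_zero, ht,
        div_mul_cancel₀ _ hθ.ne'] at hfin
      rwa [pow_succ', mul_assoc]
  refine ⟨θ, hθ, by linarith, r, hr, δ, hδ, fun k z hz => key k z (ball_subset_ball ?_ hz)⟩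
  have : (0 : ℝ) ≤ R * (1 / 2) ^ k := by positivity
  linarith

theorem Elliptic.exists_close_rpow [Nontrivial E] (hE : Elliptic F P) {z₀ : E} {R : ℝ} (hR : 0 < R)
    (h : Sol μ F P f K (ball z₀ (4 * R)) u) {lam : ℝ} (hlam : 0 < lam)
    (hlamf : ∀ x ∈ ball z₀ (4 * R), lam ≤ f x) {Cf α : ℝ≥0} (hα : 0 < α) (hα1 : α < 1)
    (hf : HolderOnWith Cf α f (ball z₀ (4 * R))) :
    ∃ r : ℝ, 0 < r ∧ ∃ C : ℝ, 0 < C ∧ ∀ z ∈ ball z₀ R, ∀ ρ : ℝ, 0 < ρ → ρ ≤ r →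
      Close u z ρ (C * ρ ^ (α : ℝ)) := by
  have hαr : (0 : ℝ) < α := hα
  obtain ⟨θ, hθ, hθ1, r, hr, δ, hδ, hcl⟩ := hE.exists_close_pow hR h hlam hlamf hα hα1 hf
  refine ⟨r, hr, δ / (θ * r) ^ (α : ℝ), by positivity, fun z hz ρ hρ hρr => ?_⟩
  obtain ⟨k, hk1, hk2⟩ := exists_nat_pow_near_of_lt_one (div_pos hρ hr) ((div_le_one hr).2 hρr)
    hθ hθ1
  rw [div_le_iff₀ hr] at hk2
  rw [lt_div_iff₀ hr] at hk1
  obtain ⟨B, hB, hBy⟩ := hcl k z hz ρ hρ hk2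
  refine ⟨B, hB, fun y hy => (hBy y hy).trans (mul_le_mul_of_nonneg_right ?_ hρ.le)⟩
  rw [div_mul_eq_mul_div, le_div_iff₀ (by positivity), mul_right_comm, mul_comm δ]
  refine mul_le_mul_of_nonneg_right ?_ hδ.le
  rw [Real.rpow_pow_comm hθ.le, ← Real.mul_rpow (by positivity) (by positivity)]
  refine Real.rpow_le_rpow (by positivity) ?_ hαr.le
  rw [← mul_assoc, ← pow_succ]
  exact hk1.le

end Regularity

section Regularity

variable {E : Type*} [NormedAddCommGroup E] [InnerProductSpace ℝ E] [FiniteDimensional ℝ E]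
  {u : E → ℝ}

theorem norm_le_of_forall_norm_eq {B : Bil E} {ρ t : ℝ} (hρ : 0 < ρ) (ht : 0 ≤ t)
    (h : ∀ x : E, ‖x‖ = ρ → ‖B x‖ ≤ t * ρ) : ‖B‖ ≤ t := by
  refine B.opNorm_le_of_unit_norm ht fun x hx => ?_
  have := h (ρ • x) (by rw [norm_smul, hx, mul_one, Real.norm_of_nonneg hρ.le])
  rw [map_smul, norm_smul, Real.norm_of_nonneg hρ.le, mul_comm] at this
  exact le_of_mul_le_mul_right this hρ

theorem exists_hess_of_close {z : E} {r C α : ℝ} (hr : 0 < r) (hC : 0 < C) (hα : 0 < α)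
    (h : ∀ ρ : ℝ, 0 < ρ → ρ ≤ r → Close u z ρ (C * ρ ^ α)) :
    ∃ D : Bil E, ∀ y : E, ‖y - z‖ ≤ r → ‖fderiv ℝ u y - fderiv ℝ u z - D (y - z)‖
      ≤ (C + 4 * C / (1 - (1 / 2) ^ α)) * ‖y - z‖ ^ α * ‖y - z‖ := by
  have hq : ((1 : ℝ) / 2) ^ α < 1 := Real.rpow_lt_one (by norm_num) (by norm_num) hα
  set A := 4 * C / (1 - (1 / 2) ^ α) with hA
  have hA0 : 0 < A := div_pos (by positivity) (by linarith)
  have hAq : A = 4 * C + A * (1 / 2) ^ α := by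
    have : A * (1 - (1 / 2) ^ α) = 4 * C := div_mul_cancel₀ _ (by linarith)
    linarith
  have h' : ∀ ρ : ℝ, ∃ B : Bil E, 0 < ρ → ρ ≤ r → ∀ y ∈ closedBall z ρ,
      ‖fderiv ℝ u y - fderiv ℝ u z - B (y - z)‖ ≤ C * ρ ^ α * ρ := fun ρ => by
    by_cases hρ : 0 < ρ ∧ ρ ≤ r
    · obtain ⟨B, -, hB⟩ := h ρ hρ.1 hρ.2
      exact ⟨B, fun _ _ => hB⟩
    · exact ⟨0, fun h1 h2 => absurd ⟨h1, h2⟩ hρ⟩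
  choose g hg using h'
  have hstep : ∀ ρ t : ℝ, 0 < ρ → ρ ≤ r → t ≤ ρ → ρ / 2 ≤ t → ‖g ρ - g t‖ ≤ 4 * C * ρ ^ α :=
    fun ρ t hρ hρr htρ hρt => by
      have ht : 0 < t := by linarith
      refine norm_le_of_forall_norm_eq ht (by positivity) fun x hx => ?_
      have e1 := hg ρ hρ hρr (z + x) (by rw [mem_closedBall_iff_norm, add_sub_cancel_left, hx]; exact htρ)
      have e2 := hg t ht (htρ.trans hρr) (z + x)
        (by rw [mem_closedBall_iff_norm, add_sub_cancel_left, hx])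
      rw [add_sub_cancel_left] at e1 e2
      have e3 : (g ρ - g t) x = (fderiv ℝ u (z + x) - fderiv ℝ u z - g t x)
          - (fderiv ℝ u (z + x) - fderiv ℝ u z - g ρ x) := by rw [sub_apply]; abel
      rw [e3]
      refine (norm_sub_le _ _).trans ((add_le_add e2 e1).trans ?_)
      have e4 : t ^ α ≤ ρ ^ α := Real.rpow_le_rpow ht.le htρ hα.le
      have e5 : C * t ^ α * t ≤ C * ρ ^ α * t := by gcongr
      have e6 : C * ρ ^ α * ρ ≤ C * ρ ^ α * (2 * t) := by gcongr; linarith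
      have e7 : 0 ≤ C * ρ ^ α * t := by positivity
      linarith
  have hmain : ∀ k : ℕ, ∀ ρ t : ℝ, 0 < ρ → ρ ≤ r → t ≤ ρ → ρ / 2 ^ (k + 1) ≤ t →
      ‖g ρ - g t‖ ≤ A * ρ ^ α := by
    intro k
    induction k with
    | zero =>
      intro ρ t hρ hρr htρ hρt
      refine (hstep ρ t hρ hρr htρ (by simpa using hρt)).trans ?_
      have : 0 ≤ A * (1 / 2) ^ α := by positivity
      gcongr
      linarith
    | succ k ih =>
      intro ρ t hρ hρr htρ hρt
      have hA4 : 4 * C ≤ A := by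
        have : 0 ≤ A * (1 / 2) ^ α := by positivity
        linarith
      rcases le_total (ρ / 2) t with h2 | h2
      · exact (hstep ρ t hρ hρr htρ h2).trans (by gcongr)
      · have e1 := hstep ρ (ρ / 2) hρ hρr (by linarith) le_rfl
        have e2 := ih (ρ / 2) t (by positivity) (by linarith) h2
          (by rwa [div_div, ← pow_succ'])
        refine (norm_sub_le_norm_sub_add_norm_sub _ (g (ρ / 2)) _).trans ((add_le_add e1 e2).trans ?_)
        rw [div_eq_mul_one_div ρ 2, Real.mul_rpow hρ.le (by norm_num)]
        nth_rewrite 2 [hAq]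
        linarith
  have hall : ∀ ρ t : ℝ, 0 < t → t ≤ ρ → ρ ≤ r → ‖g ρ - g t‖ ≤ A * ρ ^ α := fun ρ t ht htρ hρr => by
    obtain ⟨k, hk⟩ := exists_pow_lt_of_lt_one (div_pos ht (ht.trans_le htρ))
      (by norm_num : (1 : ℝ) / 2 < 1)
    refine hmain k ρ t (ht.trans_le htρ) hρr htρ ?_
    rw [lt_div_iff₀ (ht.trans_le htρ), one_div, inv_pow, ← div_eq_inv_mul] at hk
    refine le_trans ?_ hk.le
    have := ht.trans_le htρ
    gcongr <;> norm_num
  have hev : ∀ ρ : ℝ, 0 < ρ → ∀ᶠ t in (Ultrafilter.of (𝓝[>] (0 : ℝ)) : Filter ℝ), 0 < t ∧ t ≤ ρ :=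
    fun ρ hρ => Ultrafilter.of_le (𝓝[>] (0 : ℝ)) (Ioc_mem_nhdsGT hρ)
  obtain ⟨D, -, hD⟩ := Ultrafilter.exists_tendsto_of_bounded (Ultrafilter.of (𝓝[>] (0 : ℝ)))
    (g := g) (C := ‖g r‖ + A * r ^ α) ((hev r hr).mono fun t ht => by
      have := hall r t ht.1 ht.2 le_rfl
      have e2 := norm_sub_norm_le (g t) (g r)
      rw [norm_sub_rev] at e2
      linarith)
  have hgD : ∀ ρ : ℝ, 0 < ρ → ρ ≤ r → ‖g ρ - D‖ ≤ A * ρ ^ α := fun ρ hρ hρr =>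
    le_of_tendsto ((tendsto_const_nhds.sub hD).norm)
      ((hev ρ hρ).mono fun t ht => hall ρ t ht.1 ht.2 hρr)
  refine ⟨D, fun y hy => ?_⟩
  rcases (norm_nonneg (y - z)).eq_or_lt with h0 | h0
  · rw [← h0]
    rw [eq_comm, norm_eq_zero] at h0
    rw [sub_eq_zero.1 h0]
    simp
  · set ρ := ‖y - z‖ with hρ
    have e1 := hg ρ h0 hy y (mem_closedBall_iff_norm.2 le_rfl)
    have e2 := (g ρ - D).le_of_opNorm_le (hgD ρ h0 hy) (y - z)
    rw [← hρ] at e2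
    have e3 : fderiv ℝ u y - fderiv ℝ u z - D (y - z)
        = (fderiv ℝ u y - fderiv ℝ u z - g ρ (y - z)) + (g ρ - D) (y - z) := by
      rw [sub_apply]; abel
    rw [e3]
    exact (norm_add_le _ _).trans ((add_le_add e1 e2).trans_eq (by ring))

theorem exists_holderOnWith_of_close {z₀ : E} {R r C : ℝ} {α : ℝ≥0} (hR : 0 < R) (hr : 0 < r)
    (hC : 0 < C) (hα : 0 < α)
    (h : ∀ z ∈ ball z₀ R, ∀ ρ : ℝ, 0 < ρ → ρ ≤ r → Close u z ρ (C * ρ ^ (α : ℝ))) :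
    ∃ ε : ℝ, 0 < ε ∧ ε ≤ R ∧ (∀ z ∈ ball z₀ ε, DifferentiableAt ℝ (fderiv ℝ u) z) ∧
      ∃ C' : ℝ≥0, HolderOnWith C' α (hess u) (ball z₀ ε) := by
  have hαr : (0 : ℝ) < α := hα
  set A := C + 4 * C / (1 - (1 / 2) ^ (α : ℝ)) with hA
  have hA0 : 0 < A := by
    have hq : ((1 : ℝ) / 2) ^ (α : ℝ) < 1 := Real.rpow_lt_one (by norm_num) (by norm_num) hαr
    have : 0 < 4 * C / (1 - (1 / 2) ^ (α : ℝ)) := div_pos (by positivity) (by linarith)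
    positivity
  have hD : ∀ z ∈ ball z₀ R, DifferentiableAt ℝ (fderiv ℝ u) z ∧ ∀ y : E, ‖y - z‖ ≤ r →
      ‖fderiv ℝ u y - fderiv ℝ u z - hess u z (y - z)‖ ≤ A * ‖y - z‖ ^ (α : ℝ) * ‖y - z‖ :=
    fun z hz => by
      obtain ⟨D, hD⟩ := exists_hess_of_close hr hC hαr (h z hz)
      have hfd : HasFDerivAt (fderiv ℝ u) D z := by
        rw [hasFDerivAt_iff_isLittleO]
        refine Asymptotics.IsLittleO.of_bound fun ε hε => ?_
        have hlim : Tendsto (fun y => A * ‖y - z‖ ^ (α : ℝ)) (𝓝 z) (𝓝 0) := by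
          have h1 : Continuous fun y => A * ‖y - z‖ ^ (α : ℝ) :=
            continuous_const.mul ((continuous_id.sub continuous_const).norm.rpow_const
              fun _ => Or.inr hαr.le)
          simpa [hαr.ne'] using h1.tendsto z
        filter_upwards [hlim.eventually (ge_mem_nhds hε), closedBall_mem_nhds z hr] with y h1 h2
        exact (hD y (mem_closedBall_iff_norm.1 h2)).trans
          (mul_le_mul_of_nonneg_right h1 (norm_nonneg _))
      have : hess u z = D := hfd.fderiv
      exact ⟨hfd.differentiableAt, this ▸ hD⟩
  refine ⟨min R (r / 4), by positivity, min_le_left _ _,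
    fun z hz => (hD z (ball_subset_ball (min_le_left _ _) hz)).1, Real.toNNReal ((2 + 2 * 2 ^ (α : ℝ)) * A), ?_⟩
  intro z hz y hy
  have hzy : ‖z - y‖ ≤ r / 2 := by
    have h1 := (mem_ball_iff_norm.1 hz).le.trans (min_le_right _ _)
    have h2 := (mem_ball_iff_norm.1 hy).le.trans (min_le_right _ _)
    have h3 := norm_sub_le_norm_sub_add_norm_sub z z₀ y
    rw [norm_sub_rev z₀ y] at h3
    linarith
  rw [edist_dist, edist_dist, ENNReal.ofReal_rpow_of_nonneg dist_nonneg α.coe_nonneg,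
    ← ENNReal.ofReal_coe_nnreal, ← ENNReal.ofReal_mul (NNReal.coe_nonneg _)]
  refine ENNReal.ofReal_le_ofReal ?_
  rw [dist_eq_norm, dist_eq_norm, Real.coe_toNNReal _ (by positivity)]
  rcases (norm_nonneg (z - y)).eq_or_lt with h0 | h0
  · rw [eq_comm, norm_eq_zero] at h0
    rw [sub_eq_zero.1 h0, sub_self, norm_zero]
    positivity
  · set d := ‖z - y‖ with hd
    have hDz := (hD z (ball_subset_ball (min_le_left _ _) hz)).2
    have hDy := (hD y (ball_subset_ball (min_le_left _ _) hy)).2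
    refine norm_le_of_forall_norm_eq h0 (by positivity) fun v hv => ?_
    have e1 := hDz (z + v) (by rw [add_sub_cancel_left, hv]; linarith)
    have e3 := hDy z (by linarith)
    have hn : ‖z + v - y‖ ≤ 2 * d := by
      rw [add_sub_right_comm]
      linarith [norm_add_le (z - y) v]
    have e2 := hDy (z + v) (by linarith)
    have e4 : A * ‖z + v - y‖ ^ (α : ℝ) * ‖z + v - y‖ ≤ A * (2 * d) ^ (α : ℝ) * (2 * d) := by
      gcongr
    rw [Real.mul_rpow (by norm_num) h0.le] at e4
    rw [add_sub_cancel_left, hv] at e1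
    rw [← hd] at e3
    have e5 : (hess u z - hess u y) v
        = (fderiv ℝ u (z + v) - fderiv ℝ u y - hess u y (z + v - y))
          - (fderiv ℝ u (z + v) - fderiv ℝ u z - hess u z v)
          - (fderiv ℝ u z - fderiv ℝ u y - hess u y (z - y)) := by
      rw [add_sub_right_comm, map_add, sub_apply]
      abel
    rw [e5]
    refine (norm_sub_le _ _).trans ((add_le_add ((norm_sub_le _ _).trans
      (add_le_add (e2.trans e4) e1)) e3).trans_eq (by ring))

end Regularity

section MatrixDeterminant

open Matrix
open scoped MatrixOrder

variable {ι : Type*} [Fintype ι] [DecidableEq ι]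

theorem exists_posSemidef_sub_smul_one {A : Matrix ι ι ℂ} (hA : A.PosDef) :
    ∃ ε > (0 : ℝ), (A - (ε : ℂ) • (1 : Matrix ι ι ℂ)).PosSemidef := by
  obtain ⟨ε, hε, hle⟩ : ∃ ε > (0 : ℝ), ∀ i, ε ≤ hA.1.eigenvalues i := by
    rcases isEmpty_or_nonempty ι with h | h
    · exact ⟨1, one_pos, fun i => isEmptyElim i⟩
    · obtain ⟨i, hi⟩ := Finite.exists_min hA.1.eigenvalues
      exact ⟨_, hA.eigenvalues_pos i, hi⟩
  refine ⟨ε, hε, ?_⟩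
  have h1 : A - (ε : ℂ) • (1 : Matrix ι ι ℂ) =
      Unitary.conjStarAlgAut ℂ _ hA.1.eigenvectorUnitary
        (Matrix.diagonal (RCLike.ofReal ∘ hA.1.eigenvalues) - (ε : ℂ) • (1 : Matrix ι ι ℂ)) := by
    rw [map_sub, ← hA.1.spectral_theorem, map_smul, map_one]
  rw [h1, ← diagonal_one, ← diagonal_smul, diagonal_sub]
  simp [Unitary.isUnit_coe.posSemidef_star_right_conjugate_iff, posSemidef_diagonal_iff, hle]

theorem hasDerivAt_det_add_smul {A : Matrix ι ι ℂ} (hA : IsUnit A.det) (X : Matrix ι ι ℂ) :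
    HasDerivAt (fun t : ℝ => (A + (t : ℂ) • X).det) (A.det * (A⁻¹ * X).trace) 0 := by
  have h1 : ∀ r : ℂ, (A + r • X).det = A.det * (1 + (A⁻¹ * X).trace * r
      + (det (1 + (Polynomial.X : Polynomial ℂ) • (A⁻¹ * X).map Polynomial.C)).divX.divX.eval r
        * r ^ 2) := fun r => by
    rw [← det_one_add_smul, ← det_mul, mul_add, mul_one, mul_smul_comm, ← mul_assoc,
      mul_nonsing_inv _ hA, one_mul]
  set q := (det (1 + (Polynomial.X : Polynomial ℂ) • (A⁻¹ * X).map Polynomial.C)).divX.divX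
  have h2 : HasDerivAt (fun r : ℂ => (A + r • X).det) (A.det * (A⁻¹ * X).trace) ((0 : ℝ) : ℂ) := by
    rw [funext h1]
    have := ((((hasDerivAt_id (((0 : ℝ) : ℂ))).const_mul (A⁻¹ * X).trace).const_add 1).add
      ((q.hasDerivAt _).mul ((hasDerivAt_id (((0 : ℝ) : ℂ))).pow 2))).const_mul A.det
    simpa using this
  exact h2.comp_ofReal

theorem trace_inv_mul_re_pos {A X : Matrix ι ι ℂ} (hA : A.PosDef) (hX : X.PosSemidef)
    (h0 : X ≠ 0) : 0 < (A⁻¹ * X).trace.re := by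
  obtain ⟨S, hS⟩ := CStarAlgebra.nonneg_iff_eq_star_mul_self.mp hA.inv.posSemidef.nonneg
  rw [star_eq_conjTranspose] at hS
  have hu : IsUnit S := by
    have := hA.inv.isUnit
    rw [hS, isUnit_iff_isUnit_det, det_mul] at this
    exact (isUnit_iff_isUnit_det _).2 (isUnit_of_mul_isUnit_right this)
  have hp := hX.mul_mul_conjTranspose_same S
  have ht : (A⁻¹ * X).trace = (S * X * Sᴴ).trace := by
    rw [hS, mul_assoc, trace_mul_comm, mul_assoc]
  rw [ht]
  have hnn := hp.trace_nonneg
  refine (Complex.le_def.1 hnn).1.lt_of_ne fun h => ?_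
  have : (S * X * Sᴴ).trace = 0 := Complex.ext h.symm (Complex.le_def.1 hnn).2.symm
  rw [hp.trace_eq_zero_iff] at this
  have hu' : IsUnit Sᴴ := hu.star
  rw [hu'.mul_left_eq_zero, hu.mul_right_eq_zero] at this
  exact h0 this

theorem card_le_trace_inv_mul_re {A B : Matrix ι ι ℂ} (hA : A.PosDef) (hB : B.PosDef)
    (h : A.det = B.det) : (Fintype.card ι : ℝ) ≤ (A⁻¹ * B).trace.re := by
  obtain ⟨S, hS⟩ := CStarAlgebra.nonneg_iff_eq_star_mul_self.mp hA.inv.posSemidef.nonneg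
  rw [star_eq_conjTranspose] at hS
  have hp := hB.posSemidef.mul_mul_conjTranspose_same S
  have ht : (A⁻¹ * B).trace = (S * B * Sᴴ).trace := by
    rw [hS, mul_assoc, trace_mul_comm, mul_assoc]
  have hd : (S * B * Sᴴ).det = 1 := by
    have h1 : (A⁻¹ * A).det = 1 := by rw [nonsing_inv_mul _ hA.det_pos.ne'.isUnit, det_one]
    rw [hS, det_mul, det_mul, h] at h1
    rw [det_mul, det_mul, ← h1]
    ring
  rw [hp.1.det_eq_prod_eigenvalues] at hd
  have hd' : ∏ i, hp.1.eigenvalues i = 1 := by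
    refine Complex.ofReal_injective (Eq.trans ?_ hd)
    exact Complex.ofReal_prod _ _
  have hpos : ∀ i, 0 < hp.1.eigenvalues i := fun i => by
    refine (hp.eigenvalues_nonneg i).lt_of_ne fun h0 => ?_
    rw [Finset.prod_eq_zero (Finset.mem_univ i) h0.symm] at hd'
    exact zero_ne_one hd'
  rw [ht, hp.1.trace_eq_sum_eigenvalues]
  have hlog : ∑ i, Real.log (hp.1.eigenvalues i) = 0 := by
    rw [← Real.log_prod fun i _ => (hpos i).ne', hd', Real.log_one]
  have hsum : ∑ i, Real.log (hp.1.eigenvalues i) ≤ ∑ i, (hp.1.eigenvalues i - 1) :=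
    Finset.sum_le_sum fun i _ => Real.log_le_sub_one_of_pos (hpos i)
  rw [hlog, Finset.sum_sub_distrib] at hsum
  simp at hsum ⊢
  linarith

end MatrixDeterminant

section ComplexHessian

open Matrix

variable {n : ℕ}

/-- The Hermitian matrix of the complex Hessian attached to a real bilinear form on `ℂⁿ`. -/
def hermMat (B : Bil (Cn n)) : Matrix (Fin n) (Fin n) ℂ := fun i j =>
  (1/4 : ℂ) * ( ((B (EuclideanSpace.single i 1) (EuclideanSpace.single j 1)
      + B (EuclideanSpace.single i Complex.I) (EuclideanSpace.single j Complex.I) : ℝ) : ℂ)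
    + Complex.I * ((B (EuclideanSpace.single i 1) (EuclideanSpace.single j Complex.I)
      - B (EuclideanSpace.single i Complex.I) (EuclideanSpace.single j 1) : ℝ) : ℂ) )

theorem hermMat_re (B : Bil (Cn n)) (i j : Fin n) : (hermMat B i j).re =
    (1/4) * (B (EuclideanSpace.single i 1) (EuclideanSpace.single j 1)
      + B (EuclideanSpace.single i Complex.I) (EuclideanSpace.single j Complex.I)) := by
  simp only [hermMat, ← Complex.ofReal_one, ← Complex.ofReal_ofNat, ← Complex.ofReal_div]
  rw [Complex.re_ofReal_mul]
  simp

theorem hermMat_im (B : Bil (Cn n)) (i j : Fin n) : (hermMat B i j).im =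
    (1/4) * (B (EuclideanSpace.single i 1) (EuclideanSpace.single j Complex.I)
      - B (EuclideanSpace.single i Complex.I) (EuclideanSpace.single j 1)) := by
  simp only [hermMat, ← Complex.ofReal_one, ← Complex.ofReal_ofNat, ← Complex.ofReal_div]
  rw [Complex.im_ofReal_mul]
  simp

theorem hermMat_add (A B : Bil (Cn n)) : hermMat (A + B) = hermMat A + hermMat B := by
  ext i j
  refine Complex.ext ?_ ?_
  · simp only [hermMat_re, Matrix.add_apply, Complex.add_re, _root_.add_apply]; ring
  · simp only [hermMat_im, Matrix.add_apply, Complex.add_im, _root_.add_apply]; ring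

theorem hermMat_smul (t : ℝ) (B : Bil (Cn n)) : hermMat (t • B) = (t : ℂ) • hermMat B := by
  ext i j
  refine Complex.ext ?_ ?_
  · simp only [hermMat_re, Matrix.smul_apply, smul_eq_mul, Complex.re_ofReal_mul,
      _root_.smul_apply]; ring
  · simp only [hermMat_im, Matrix.smul_apply, smul_eq_mul, Complex.im_ofReal_mul,
      _root_.smul_apply]; ring

theorem hermMat_sub (A B : Bil (Cn n)) : hermMat (A - B) = hermMat A - hermMat B := by
  have h : A - B = A + (-1 : ℝ) • B := by rw [neg_one_smul, sub_eq_add_neg]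
  rw [h, hermMat_add, hermMat_smul]
  simp [sub_eq_add_neg]

theorem real_inner_single (i j : Fin n) (a b : ℂ) :
    inner ℝ (EuclideanSpace.single i a) (EuclideanSpace.single j b) =
      if i = j then a.re * b.re + a.im * b.im else 0 := by
  rw [PiLp.inner_apply, Finset.sum_eq_single i]
  · by_cases h : i = j
    · subst h
      simp [mul_comm]
    · simp [h]
  · intro k _ hk
    simp [hk]
  · simp

theorem hermMat_idForm : hermMat (idForm (Cn n)) = ((1/2 : ℝ) : ℂ) • (1 : Matrix _ _ ℂ) := by
  ext i j
  refine Complex.ext ?_ ?_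
  · rw [hermMat_re, Matrix.smul_apply, smul_eq_mul, Complex.re_ofReal_mul]
    simp only [idForm_apply, real_inner_single, Matrix.one_apply]
    by_cases h : i = j <;> simp [h]
    norm_num
  · rw [hermMat_im, Matrix.smul_apply, smul_eq_mul, Complex.im_ofReal_mul]
    simp only [idForm_apply, real_inner_single, Matrix.one_apply]
    by_cases h : i = j <;> simp [h]

theorem isHermitian_hermMat {B : Bil (Cn n)} (hB : Symm B) : (hermMat B).IsHermitian := by
  ext i j
  rw [conjTranspose_apply]
  refine Complex.ext ?_ ?_
  · simp only [hermMat_re, Complex.star_def, Complex.conj_re, hB (EuclideanSpace.single j _)]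
  · simp only [hermMat_im, Complex.star_def, Complex.conj_im, hB (EuclideanSpace.single j _)]
    ring

theorem posSemidef_hermMat {B : Bil (Cn n)} (hB : Symm B) (h : NonNeg B) :
    (hermMat B).PosSemidef := by
  refine .of_dotProduct_mulVec_nonneg (isHermitian_hermMat hB) fun c => ?_
  rw [Complex.le_def]
  refine ⟨?_, ((isHermitian_hermMat hB).im_star_dotProduct_mulVec_self c).symm⟩
  have h1 := h (∑ i, ((c i).re • EuclideanSpace.single i (1 : ℂ)
    - (c i).im • EuclideanSpace.single i Complex.I))
  have h2 := h (∑ i, ((c i).re • EuclideanSpace.single i Complex.I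
    + (c i).im • EuclideanSpace.single i (1 : ℂ)))
  have h3 : (star c ⬝ᵥ hermMat B *ᵥ c).re = (1/4) * (
      B (∑ i, ((c i).re • EuclideanSpace.single i (1 : ℂ)
        - (c i).im • EuclideanSpace.single i Complex.I))
        (∑ i, ((c i).re • EuclideanSpace.single i (1 : ℂ)
        - (c i).im • EuclideanSpace.single i Complex.I))
      + B (∑ i, ((c i).re • EuclideanSpace.single i Complex.I
        + (c i).im • EuclideanSpace.single i (1 : ℂ)))
        (∑ i, ((c i).re • EuclideanSpace.single i Complex.I
        + (c i).im • EuclideanSpace.single i (1 : ℂ)))) := by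
    simp only [dotProduct, mulVec, Finset.mul_sum, Complex.re_sum, map_sum, _root_.sum_apply,
      ← Finset.sum_add_distrib]
    rw [Finset.sum_comm]
    refine Finset.sum_congr rfl fun i _ => Finset.sum_congr rfl fun j _ => ?_
    simp only [map_add, map_sub, map_smul, _root_.add_apply, _root_.sub_apply, _root_.smul_apply,
      smul_eq_mul, Pi.star_apply, Complex.star_def, Complex.mul_re, Complex.mul_im,
      Complex.conj_re, Complex.conj_im, hermMat_re, hermMat_im]
    ring
  rw [h3]
  simp only [Complex.zero_re]
  linarith

end ComplexHessian

section ComplexMongeAmpere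

open Matrix

variable {n : ℕ}

theorem Symm.apply_eq_zero {E : Type*} [NormedAddCommGroup E] [InnerProductSpace ℝ E] {B : Bil E}
    (hs : Symm B) (h : NonNeg B) {x : E} (hx : B x x = 0) (y : E) : B x y = 0 := by
  by_contra h0
  have h1 := h (y + (-(B y y + 1) / (2 * B x y)) • x)
  simp only [map_add, map_smul, _root_.add_apply, _root_.smul_apply, smul_eq_mul, hx,
    hs y x] at h1
  have h2 : -(B y y + 1) / (2 * B x y) * B x y = -(B y y + 1) / 2 := by
    field_simp
  rw [h2] at h1
  linarith

theorem eq_zero_of_hermMat_eq_zero {B : Bil (Cn n)} (hs : Symm B) (h : NonNeg B)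
    (h0 : hermMat B = 0) : B = 0 := by
  have hd : ∀ i : Fin n, B (EuclideanSpace.single i 1) (EuclideanSpace.single i 1) = 0 ∧
      B (EuclideanSpace.single i Complex.I) (EuclideanSpace.single i Complex.I) = 0 := fun i => by
    have h1 := hermMat_re B i i
    rw [h0, Matrix.zero_apply, Complex.zero_re] at h1
    have h2 := h (EuclideanSpace.single i 1)
    have h3 := h (EuclideanSpace.single i Complex.I)
    constructor <;> linarith
  ext v w
  have hv : v = ∑ i, ((v i).re • EuclideanSpace.single i (1 : ℂ)
      + (v i).im • EuclideanSpace.single i Complex.I) := by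
    ext k
    rw [WithLp.ofLp_sum, Finset.sum_apply, Finset.sum_eq_single k]
    · refine Complex.ext ?_ ?_ <;> simp
    · intro j _ hj
      simp [hj.symm]
    · simp
  rw [hv]
  simp [_root_.sum_apply, hs.apply_eq_zero h (hd _).1, hs.apply_eq_zero h (hd _).2]

/-- The real part of the determinant of the complex Hessian, as a function of the real Hessian. -/
def detHerm (B : Bil (Cn n)) : ℝ := (hermMat B).det.re

/-- Real symmetric forms with positive semidefinite complex Hessian. -/
def PshForm (B : Bil (Cn n)) : Prop := Symm B ∧ (hermMat B).PosSemidef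

theorem continuous_hermMat : Continuous (hermMat : Bil (Cn n) → Matrix (Fin n) (Fin n) ℂ) := by
  refine continuous_matrix fun i j => ?_
  unfold hermMat
  fun_prop

theorem contDiff_detHerm : ContDiff ℝ 1 (detHerm : Bil (Cn n) → ℝ) := by
  have h1 : ∀ i j, ContDiff ℝ 1 fun B : Bil (Cn n) => hermMat B i j := fun i j => by
    unfold hermMat
    have h (v w : Cn n) : ContDiff ℝ 1 fun B : Bil (Cn n) => B v w :=
      (contDiff_id.clm_apply contDiff_const).clm_apply contDiff_const
    exact contDiff_const.mul ((Complex.ofRealCLM.contDiff.comp ((h _ _).add (h _ _))).add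
      (contDiff_const.mul (Complex.ofRealCLM.contDiff.comp ((h _ _).sub (h _ _)))))
  unfold detHerm
  simp only [det_apply']
  exact Complex.reCLM.contDiff.comp (ContDiff.sum fun σ _ =>
    contDiff_const.mul (contDiff_prod fun i _ => h1 _ _))

theorem PshForm.posDef {A : Bil (Cn n)} (hA : PshForm A) (h : 0 < detHerm A) :
    (hermMat A).PosDef :=
  hA.2.posDef_iff_det_ne_zero.2 fun h0 => by simp [detHerm, h0] at h

theorem PshForm.det_eq {A : Bil (Cn n)} (hA : PshForm A) : (hermMat A).det = (detHerm A : ℂ) :=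
  Complex.ext (by simp [detHerm]) (by simpa using (Complex.le_def.1 hA.2.det_nonneg).2.symm)

theorem fderiv_detHerm {A : Bil (Cn n)} (hA : PshForm A) (h : 0 < detHerm A) (X : Bil (Cn n)) :
    fderiv ℝ detHerm A X = detHerm A * ((hermMat A)⁻¹ * hermMat X).trace.re := by
  have h1 : HasDerivAt (fun t : ℝ => A + t • X) X 0 := by
    simpa using ((hasDerivAt_id (0 : ℝ)).smul_const X).const_add A
  have h2 : HasFDerivAt detHerm (fderiv ℝ detHerm A) (A + (0 : ℝ) • X) := by
    rw [zero_smul, add_zero]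
    exact (contDiff_detHerm.differentiable one_ne_zero A).hasFDerivAt
  have h3 := h2.comp_hasDerivAt (0 : ℝ) h1
  have h4 := Complex.reCLM.hasFDerivAt.comp_hasDerivAt (0 : ℝ)
    (hasDerivAt_det_add_smul ((hA.posDef h).det_pos.ne'.isUnit) (hermMat X))
  have h5 : (detHerm ∘ fun t : ℝ => A + t • X)
      = Complex.reCLM ∘ fun t : ℝ => (hermMat A + (t : ℂ) • hermMat X).det := by
    funext t
    simp [detHerm, hermMat_add, hermMat_smul]
  rw [h5] at h3
  rw [h3.unique h4, hA.det_eq, Complex.reCLM_apply, Complex.re_ofReal_mul]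

theorem elliptic_detHerm : Elliptic (detHerm : Bil (Cn n) → ℝ) PshForm where
  contDiff := contDiff_detHerm
  isClosed := by
    have h1 : IsClosed {M : Matrix (Fin n) (Fin n) ℂ | M.PosSemidef} := by
      simp only [posSemidef_iff_dotProduct_mulVec, IsHermitian, ofPred_and, ofPred_forall]
      refine (isClosed_eq (by fun_prop) continuous_id).inter (isClosed_iInter fun x => ?_)
      exact isClosed_le continuous_const (by fun_prop)
    exact isClosed_symm.inter (h1.preimage continuous_hermMat)
  symm := fun B h => h.1
  mono := fun A B hA hB h => ⟨hB, by
    have h1 := hA.2.add (posSemidef_hermMat (hB.sub hA.1) h)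
    rwa [← hermMat_add, add_sub_cancel] at h1⟩
  pos := fun A X hA h hs hX h0 => by
    rw [fderiv_detHerm hA h]
    exact mul_pos h (trace_inv_mul_re_pos (hA.posDef h) (posSemidef_hermMat hs hX)
      fun h1 => h0 (eq_zero_of_hermMat_eq_zero hs hX h1))
  concave := fun A B hA hB h hAB => by
    rw [fderiv_detHerm hA h, hermMat_sub, mul_sub, nonsing_inv_mul _
      (hA.posDef h).det_pos.ne'.isUnit, trace_sub, trace_one, Complex.sub_re, Complex.natCast_re]
    have h1 := card_le_trace_inv_mul_re (hA.posDef h) (hB.posDef (hAB ▸ h))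
      (by rw [hA.det_eq, hB.det_eq, hAB])
    exact mul_nonneg h.le (sub_nonneg.2 h1)
  exists_sub := fun A hA h => by
    obtain ⟨ε, hε, h1⟩ := exists_posSemidef_sub_smul_one (hA.posDef h)
    refine ⟨2 * ε, by positivity, hA.1.sub (symm_idForm.smul _), ?_⟩
    rw [hermMat_sub, hermMat_smul, hermMat_idForm, smul_smul, ← Complex.ofReal_mul]
    convert h1 using 4
    ring

end ComplexMongeAmpere

section InteriorRegularity

theorem contDiffOn_two_of_continuousOn_hess {E : Type*} [NormedAddCommGroup E]
    [InnerProductSpace ℝ E] {s : Set E} (hs : IsOpen s) {u : E → ℝ} (h1 : DifferentiableOn ℝ u s)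
    (h2 : ∀ x ∈ s, DifferentiableAt ℝ (fderiv ℝ u) x) (h3 : ContinuousOn (hess u) s) :
    ContDiffOn ℝ 2 u s := by
  rw [← one_add_one_eq_two, contDiffOn_succ_iff_fderiv_of_isOpen hs]
  refine ⟨h1, by simp, ?_⟩
  rw [← zero_add (1 : WithTop ℕ∞), contDiffOn_succ_iff_fderiv_of_isOpen hs]
  exact ⟨fun x hx => (h2 x hx).differentiableWithinAt, by simp, contDiffOn_zero.2 h3⟩

variable {n : ℕ}

instance isAddHaarMeasure_volume : (volume : Measure (Cn n)).IsAddHaarMeasure :=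
  inferInstanceAs (Measure.addHaar : Measure (Cn n)).IsAddHaarMeasure

theorem exists_holderOnWith_hess {Ω : Set (Cn n)} (hΩ : IsOpen Ω) {u f : Cn n → ℝ} {lam : ℝ}
    {α : ℝ≥0} (hα : 0 < α) (hα1 : α < 1) (hu11 : C11On u Ω) (hae : AESecondDiff u Ω)
    (hpsh : PshAE u Ω) (hdet : ∀ᵐ z, z ∈ Ω → (complexHessian u z).det = (f z : ℂ))
    (hlam : 0 < lam) (hflam : ∀ z ∈ Ω, lam ≤ f z) (hf : ∃ C : ℝ≥0, HolderOnWith C α f Ω)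
    {z : Cn n} (hz : z ∈ Ω) :
    ∃ ε : ℝ, 0 < ε ∧ ball z ε ⊆ Ω ∧ (∀ x ∈ ball z ε, DifferentiableAt ℝ (fderiv ℝ u) x) ∧
      ∃ C' : ℝ≥0, HolderOnWith C' α (hess u) (ball z ε) := by
  obtain ⟨ε, hε, K, hsub, hlip⟩ := hu11.2 z hz
  rcases subsingleton_or_nontrivial (Cn n) with hs | hs
  · exact ⟨ε, hε, hsub, fun x _ => (hasFDerivAt_of_subsingleton _ x).differentiableAt, 0,
      fun x _ y _ => by simp [Subsingleton.elim x y]⟩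
  obtain ⟨Cf, hf⟩ := hf
  have hR : 0 < ε / 4 := by positivity
  have h4 : 4 * (ε / 4) = ε := by ring
  have hc : C11 u K (ball z ε) :=
    ⟨fun x hx => (hu11.1.differentiableOn one_ne_zero).differentiableAt
      (hΩ.mem_nhds (hsub hx)), hlip⟩
  have hsol : Sol volume detHerm PshForm f K (ball z (4 * (ε / 4))) u := by
    rw [h4]
    refine ⟨isOpen_ball, hc, ?_⟩
    filter_upwards [hae, hpsh, hdet] with x h1 h2 h3 hx
    refine ⟨h1 (hsub hx), ⟨hc.symm_hess (isOpen_ball.mem_nhds hx) (h1 (hsub hx)), h2 (hsub hx)⟩, ?_⟩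
    have := congrArg Complex.re (h3 (hsub hx))
    rwa [Complex.ofReal_re] at this
  rw [← h4] at hsub
  obtain ⟨r, hr, C, hC, hcl⟩ := elliptic_detHerm.exists_close_rpow hR hsol hlam
    (fun x hx => hflam x (hsub hx)) hα hα1 (hf.mono hsub)
  obtain ⟨δ, hδ, hδR, hd, hH⟩ := exists_holderOnWith_of_close hR hr hC hα hcl
  exact ⟨δ, hδ, (ball_subset_ball (by linarith)).trans hsub, hd, hH⟩

end InteriorRegularity

end EvansKrylov

theorem interior_C2alpha_regularity_complex_MongeAmpere
    {n : ℕ} (Ω : Set (Cn n)) (hΩ : IsOpen Ω) (hΩconn : IsConnected Ω)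
    (u f : Cn n → ℝ) (lam : ℝ) (α : NNReal)
    (hα : 0 < α) (hα1 : α < 1)
    (hu11 : C11On u Ω) (hae : AESecondDiff u Ω) (hpsh : PshAE u Ω)
    (hdet : ∀ᵐ z, z ∈ Ω → (complexHessian u z).det = (f z : ℂ))
    (hlam : 0 < lam) (hflam : ∀ z ∈ Ω, lam ≤ f z)
    (hf : ∃ C : NNReal, HolderOnWith C α f Ω) :
    ContDiffOn ℝ 2 u Ω ∧
      ∀ z ∈ Ω, ∃ ε > 0, ball z ε ⊆ Ω ∧
        ∃ C' : NNReal, HolderOnWith C' α (fun x => fderiv ℝ (fderiv ℝ u) x) (ball z ε) := by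
  have hmain := fun z (hz : z ∈ Ω) => EvansKrylov.exists_holderOnWith_hess hΩ hα hα1 hu11 hae hpsh
    hdet hlam hflam hf hz
  refine ⟨?_, fun z hz => ?_⟩
  · refine EvansKrylov.contDiffOn_two_of_continuousOn_hess hΩ
      (hu11.1.differentiableOn one_ne_zero) (fun z hz => ?_) fun z hz => ?_
    · obtain ⟨ε, hε, -, hd, -⟩ := hmain z hz
      exact hd z (mem_ball_self hε)
    · obtain ⟨ε, hε, -, -, C', hC⟩ := hmain z hz
      exact ((hC.continuousOn hα).continuousAt (ball_mem_nhds z hε)).continuousWithinAt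
  · obtain ⟨ε, hε, hsub, -, hC⟩ := hmain z hz
    exact ⟨ε, hε, hsub, hC⟩
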